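/- arXiv:2002.03615 — 8 statements merged into one kernel-verified Lean document; each statement's English description precedes it below -/
import Mathlib

section
/- Let f be a homeomorphism of a compact metric space (X,d). If there exist a point x ∈ X and ε > 0 such that the sets f^n(B(x,ε)), n ∈ ℤ, are pairwise disjoint (i.e. x is a wandering point with wandering ball B(x,ε)), then hpol(f) ≥ 1. -/
open Filter Topology Metric
open scoped ENNReal

variable {X : Type*}

/-- Minimal number of balls of radius `ε` for the Bowen metric
`d_n^f(x,y) = max_{0 ≤ j ≤ n-1} dist (f^[j] x) (f^[j] y)` needed to cover `X`. -/
noncomputable def covNum [PseudoMetricSpace X] (f : X → X) (ε : ℝ) (n : ℕ) : ℕ :=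
  sInf {m : ℕ | ∃ S : Finset X, S.card = m ∧
    ∀ x : X, ∃ s ∈ S, ∀ j < n, dist (f^[j] x) (f^[j] s) < ε}

/-- The polynomial entropy `hpol f = lim_{ε → 0} limsup_n log (Cov_ε(n)) / log n`,
with values in `[0,+∞]`.  Since `ε ↦ limsup_n log (Cov_ε(n)) / log n` is antitone,
the limit as `ε → 0` is the supremum over `ε > 0`. -/
noncomputable def hpol [PseudoMetricSpace X] (f : X → X) : ℝ≥0∞ :=
  ⨆ (ε : ℝ) (_ : 0 < ε),
    Filter.atTop.limsup fun n : ℕ =>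
      ENNReal.ofReal (Real.log (covNum f ε n) / Real.log n)

theorem covNum_set_nonempty [MetricSpace X] [CompactSpace X] (f : X → X) (hf : Continuous f)
    (ε : ℝ) (hε : 0 < ε) (n : ℕ) :
    {m : ℕ | ∃ S : Finset X, S.card = m ∧
      ∀ x : X, ∃ s ∈ S, ∀ j < n, dist (f^[j] x) (f^[j] s) < ε}.Nonempty := by
  obtain ⟨t, ht⟩ := CompactSpace.elim_nhds_subcover
    (fun s : X => {y | ∀ j ∈ Finset.range n, dist (f^[j] y) (f^[j] s) < ε}) (by
      intro s
      show ∀ᶠ y in 𝓝 s, ∀ j ∈ Finset.range n, dist (f^[j] y) (f^[j] s) < ε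
      rw [Filter.eventually_all_finset]
      intro j _
      have hc : Continuous fun y => dist (f^[j] y) (f^[j] s) :=
        (hf.iterate j).dist continuous_const
      exact hc.continuousAt.eventually_lt continuousAt_const (by simpa using hε))
  refine ⟨t.card, t, rfl, fun x => ?_⟩
  have hx : x ∈ (⊤ : Set X) := trivial
  rw [← ht] at hx
  simp only [Set.mem_iUnion] at hx
  obtain ⟨s, hs, h⟩ := hx
  exact ⟨s, hs, fun j hj => h j (Finset.mem_range.2 hj)⟩

theorem le_covNum_of_wandering [MetricSpace X] [CompactSpace X]
    (f : X ≃ₜ X) (x : X) (ε : ℝ) (hε : 0 < ε)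
    (hw : ∀ m n : ℤ, m ≠ n →
      Disjoint ((f.toEquiv ^ m) '' Metric.ball x ε) ((f.toEquiv ^ n) '' Metric.ball x ε))
    (n : ℕ) : n ≤ covNum (⇑f) ε n := by
  refine le_csInf (covNum_set_nonempty _ f.continuous ε hε n) ?_
  rintro m ⟨S, rfl, hS⟩
  choose g hgS hg using fun k : ℕ => hS ((⇑f.symm)^[k] x)
  have hball : ∀ k < n, (⇑f)^[k] (g k) ∈ Metric.ball x ε := by
    intro k hk
    have h := hg k k hk
    have h2 : (⇑f)^[k] ((⇑f.symm)^[k] x) = x :=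
      Function.LeftInverse.iterate (f := ⇑f.symm) (g := ⇑f) (fun y => f.apply_symm_apply y) k x
    rw [h2, dist_comm] at h
    exact h
  have key : ∀ k l : ℕ, k < l → l < n → g k ≠ g l := by
    intro k l hkl hl he
    have h1 := hball k (hkl.trans hl)
    have h2 := hball l hl
    have hd := hw ((l - k : ℕ) : ℤ) 0 (by omega)
    rw [Set.disjoint_left] at hd
    refine @hd ((⇑f)^[l] (g l)) ⟨_, h1, ?_⟩ ⟨_, h2, by simp⟩
    rw [zpow_natCast, ← Equiv.Perm.iterate_eq_pow, he]
    show (⇑f)^[l - k] ((⇑f)^[k] (g l)) = _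
    rw [← Function.iterate_add_apply, Nat.sub_add_cancel hkl.le]
  have := Finset.card_le_card_of_injOn (s := Finset.range n) (t := S) g (fun k _ => hgS k) (by
    intro k hk l hl he
    have hk' : k < n := by simpa using hk
    have hl' : l < n := by simpa using hl
    rcases lt_trichotomy k l with h | h | h
    · exact absurd he (key k l h hl')
    · exact h
    · exact absurd he.symm (key l k h hk'))
  simpa using this

/-- If a homeomorphism `f` of a compact metric space has a wandering point `x`
with wandering ball `B(x,ε)` (the images `f^n(B(x,ε))`, `n ∈ ℤ`, are pairwise
disjoint), then `hpol f ≥ 1`. -/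
theorem one_le_hpol_of_wandering [MetricSpace X] [CompactSpace X]
    (f : X ≃ₜ X) (x : X) (ε : ℝ) (hε : 0 < ε)
    (hw : ∀ m n : ℤ, m ≠ n →
      Disjoint ((f.toEquiv ^ m) '' Metric.ball x ε) ((f.toEquiv ^ n) '' Metric.ball x ε)) :
    1 ≤ hpol (⇑f) := by
  refine le_trans ?_ (le_iSup₂_of_le ε hε le_rfl)
  refine le_limsup_of_frequently_le (Eventually.frequently ?_)
  filter_upwards [eventually_ge_atTop 2] with n hn
  rw [ENNReal.one_le_ofReal]
  have hn' : (2 : ℝ) ≤ n := by exact_mod_cast hn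
  rw [one_le_div (Real.log_pos (by linarith))]
  exact Real.log_le_log (by linarith) (by exact_mod_cast le_covNum_of_wandering f x ε hε hw n)
end

section
/- Let k ≥ 1 and let F : ℝ^k → ℝ^k be the linear map given in the canonical basis (e_1,…,e_k) by F(e_1) = e_1 and F(e_m) = e_m + e_{m-1} for 2 ≤ m ≤ k (a single unipotent Jordan block of size k with integer entries). F preserves ℤ^k and hence induces a homeomorphism F̄ of the torus ℝ^k/ℤ^k. Then hpol(F̄) = k(k-1)/2. -/
open Filter Topology Metric
open scoped ENNReal

variable {X : Type*}

def TT (z : ℕ → ℝ) : ℕ → ℝ := fun i => z i + z (i+1)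

lemma TT_iter_sub (h : ℕ) (x y : ℕ → ℝ) : TT^[h] (x - y) = TT^[h] x - TT^[h] y := by
  induction h generalizing x y with
  | zero => rfl
  | succ h ih =>
    simp only [Function.iterate_succ, Function.comp]
    rw [← ih]; congr 1; ext i; simp [TT]; ring

lemma TT_iter_zero (m : ℕ) (z : ℕ → ℝ) (hz : ∀ i, m < i → z i = 0) (h : ℕ) :
    (∀ i, m < i → TT^[h] z i = 0) ∧ TT^[h] z m = z m ∧
      (∀ l, l + 1 = m → TT^[h] z l = z l + h * z m) := by
  induction h with
  | zero => simpa using hz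
  | succ h ih =>
    obtain ⟨h1, h2, h3⟩ := ih
    simp only [Function.iterate_succ_apply']
    refine ⟨fun i hi => ?_, ?_, fun l hl => ?_⟩
    · simp [TT, h1 i hi, h1 (i+1) (by omega)]
    · simp [TT, h1 (m+1) (by omega), h2]
    · simp only [TT, h3 l hl, hl, h2]; push_cast; ring

lemma TT_diff (h m : ℕ) : ∀ (z : ℕ → ℝ) (_ : ∀ i, m < i → z i = 0) (B : ℝ)
    (_ : ∀ l ≤ m, |TT^[l*h] z 0| ≤ B), (h:ℝ)^m * |z m| ≤ 2^m * B := by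
  induction m with
  | zero => intro z _ B hB; simpa using hB 0 le_rfl
  | succ m ih =>
    intro z hz B hB
    obtain ⟨h1, h2, h3⟩ := TT_iter_zero (m+1) z hz h
    have := ih (TT^[h] z - z) (fun i hi => ?_) (2*B) (fun l hl => ?_)
    · simp only [Pi.sub_apply, h3 m rfl, add_sub_cancel_left, abs_mul, Nat.abs_cast] at this
      rw [pow_succ, pow_succ]; linarith
    · rcases Nat.lt_or_ge (m+1) i with hi' | hi'
      · simp [h1 i hi', hz i hi']
      · obtain rfl : i = m+1 := by omega
        simp [h2]
    · rw [TT_iter_sub, ← Function.iterate_add_apply]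
      have e1 := hB l (by omega)
      have e2 := hB (l+1) (by omega)
      have : l * h + h = (l+1)*h := by ring
      rw [this, Pi.sub_apply]
      refine (abs_sub _ _).trans ?_
      linarith

lemma TT_upper (n : ℕ) (hn : 0 < n) (z : ℕ → ℝ) (δ : ℝ) (hz : ∀ i, |z i| ≤ δ / n^i) (j i : ℕ) :
    |TT^[j] z i| ≤ (1 + 1/(n:ℝ))^j * (δ / n^i) := by
  induction j generalizing i with
  | zero => simpa using hz i
  | succ j ih =>
    rw [Function.iterate_succ_apply']
    have hn' : (n:ℝ) ≠ 0 := by positivity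
    calc _ ≤ _ := abs_add_le _ _
      _ ≤ _ := add_le_add (ih i) (ih (i+1))
      _ = _ := by rw [pow_succ, pow_succ]; field_simp

lemma one_add_pow_le (n : ℕ) (hn : 0 < n) (j : ℕ) (hj : j < n) : (1 + 1/(n:ℝ))^j ≤ 3 := by
  have hn' : (n:ℝ) ≠ 0 := by positivity
  calc (1 + 1/(n:ℝ))^j ≤ (Real.exp (1/n))^j := by
        gcongr; rw [add_comm]; exact Real.add_one_le_exp _
    _ = Real.exp (j/n) := by rw [← Real.exp_nat_mul]; congr 1; ring
    _ ≤ Real.exp 1 := by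
        gcongr
        rw [div_le_one (by positivity)]; exact_mod_cast hj.le
    _ ≤ 3 := by linarith [Real.exp_one_lt_d9]

noncomputable def ext0 {k : ℕ} (x : Fin k → ℝ) : ℕ → ℝ := fun i => if h : i < k then x ⟨i, h⟩ else 0

def pit {k : ℕ} (x : Fin k → ℝ) : Fin k → AddCircle (1:ℝ) := fun i => ((x i : ℝ) : AddCircle (1 : ℝ))

noncomputable def GG {k : ℕ} (x : Fin k → ℝ) : Fin k → ℝ := fun i => x i + ext0 x (i+1)

lemma ext0_GG {k : ℕ} (x : Fin k → ℝ) : ext0 (GG x) = TT (ext0 x) := by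
  ext i
  by_cases h : i < k
  · simp [ext0, GG, TT, h]
  · simp [ext0, TT, h, show ¬ (i+1 < k) by omega]

lemma ext0_GG_iter {k : ℕ} (x : Fin k → ℝ) (j : ℕ) : ext0 (GG^[j] x) = TT^[j] (ext0 x) := by
  induction j with
  | zero => rfl
  | succ j ih => rw [Function.iterate_succ_apply', Function.iterate_succ_apply', ext0_GG, ih]

lemma ext0_fin {k : ℕ} (x : Fin k → ℝ) (i : Fin k) : ext0 x i = x i := by simp [ext0]

lemma ext0_sub {k : ℕ} (x y : Fin k → ℝ) : ext0 (x - y) = ext0 x - ext0 y := by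
  ext i; by_cases h : i < k <;> simp [ext0, h]

lemma GG_iter_apply {k : ℕ} (x : Fin k → ℝ) (j : ℕ) (i : Fin k) :
    (GG^[j] x) i = TT^[j] (ext0 x) i := by
  rw [← ext0_GG_iter, ext0_fin]

lemma GG_iter_sub {k : ℕ} (x y : Fin k → ℝ) (j : ℕ) : GG^[j] (x - y) = GG^[j] x - GG^[j] y := by
  ext i; simp [GG_iter_apply, ext0_sub, TT_iter_sub]

lemma F_eq_GG (k : ℕ) (hk : 1 ≤ k)
    (F : (Fin k → ℝ) →ₗ[ℝ] (Fin k → ℝ))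
    (hF0 : F (Pi.single (⟨0, hk⟩ : Fin k) 1) = Pi.single (⟨0, hk⟩ : Fin k) 1)
    (hFm : ∀ m : Fin k, 0 < (m : ℕ) →
      F (Pi.single m 1) =
        Pi.single m 1 + Pi.single (⟨(m : ℕ) - 1, lt_of_le_of_lt (Nat.sub_le _ _) m.2⟩ : Fin k) 1)
    (x : Fin k → ℝ) : F x = GG x := by
  let G : (Fin k → ℝ) →ₗ[ℝ] (Fin k → ℝ) :=
    { toFun := GG
      map_add' := by
        intro x y; ext i; simp only [GG, ext0, Pi.add_apply]; split_ifs <;> ring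
      map_smul' := by
        intro c y; ext i; simp only [GG, ext0, Pi.smul_apply, smul_eq_mul, RingHom.id_apply]
        split_ifs <;> ring }
  suffices F = G by rw [this]; rfl
  refine LinearMap.pi_ext' fun m => LinearMap.ext_ring ?_
  simp only [LinearMap.comp_apply, LinearMap.single_apply]
  show F (Pi.single m 1) = GG (Pi.single m 1)
  rcases Nat.eq_zero_or_pos (m:ℕ) with h | h
  · obtain rfl : m = ⟨0, hk⟩ := Fin.ext h
    rw [hF0]; ext i
    simp [GG, ext0, Pi.single_apply, Fin.ext_iff]
  · rw [hFm m h]; ext i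
    simp only [GG, ext0, Pi.single_apply, Fin.ext_iff, Pi.add_apply]
    congr 1
    have := m.2
    by_cases h1 : (i:ℕ) + 1 < k
    · simp only [h1, dite_true]
      exact if_congr (by omega) rfl rfl
    · simp only [h1, dite_false]
      exact if_neg (by omega)

lemma pit_surj {k : ℕ} (t : Fin k → AddCircle (1:ℝ)) :
    ∃ x : Fin k → ℝ, pit x = t ∧ ∀ i, 0 ≤ x i ∧ x i < 1 := by
  have : ∀ i, ∃ y : ℝ, (y : AddCircle (1:ℝ)) = t i ∧ 0 ≤ y ∧ y < 1 := by
    intro i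
    have := AddCircle.coe_image_Ico_eq (1:ℝ) 0
    have h2 : t i ∈ ((↑) '' Set.Ico (0:ℝ) (0 + 1) : Set (AddCircle (1:ℝ))) := by
      rw [this]; trivial
    obtain ⟨y, hy, e⟩ := h2
    exact ⟨y, e, hy.1, by simpa using hy.2⟩
  choose x hx using this
  exact ⟨x, funext fun i => (hx i).1, fun i => (hx i).2⟩

lemma norm_coe_le (x : ℝ) : ‖(x : AddCircle (1:ℝ))‖ ≤ |x| := by
  rw [AddCircle.norm_eq]
  simpa using round_le x 0

lemma dist_iter {k : ℕ} (x y : Fin k → ℝ) (j : ℕ) (i : Fin k) :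
    dist (pit (GG^[j] x) i) (pit (GG^[j] y) i)
      = ‖((GG^[j] (x - y) i : ℝ) : AddCircle (1:ℝ))‖ := by
  rw [dist_eq_norm, GG_iter_sub]; simp [pit]

section
variable {k : ℕ} {f : (Fin k → AddCircle (1 : ℝ)) → (Fin k → AddCircle (1 : ℝ))}

lemma f_iter (hf : ∀ x, f (pit x) = pit (GG x)) (x : Fin k → ℝ) (j : ℕ) :
    f^[j] (pit x) = pit (GG^[j] x) := by
  induction j with
  | zero => rfl
  | succ j ih => rw [Function.iterate_succ_apply', Function.iterate_succ_apply', ih, hf]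

noncomputable def grid (N : Fin k → ℕ) (a : (i : Fin k) → Fin (N i)) : Fin k → ℝ :=
  fun i => (a i : ℝ) / N i

lemma cover_grid (hf : ∀ x, f (pit x) = pit (GG x)) (ε : ℝ) (hε : 0 < ε) (M : ℕ)
    (hM : 3 < ε * M) (n : ℕ) (hn : 0 < n) :
    ∃ S : Finset (Fin k → AddCircle (1:ℝ)), S.card ≤ M^k * n^(k*(k-1)/2) ∧
    ∀ x, ∃ s ∈ S, ∀ j < n, dist (f^[j] x) (f^[j] s) < ε := by
  classical
  have hM0 : 0 < M := by
    rcases Nat.eq_zero_or_pos M with h | h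
    · subst h; norm_num at hM
    · exact h
  let N : Fin k → ℕ := fun i => M * n^(i:ℕ)
  have hN : ∀ i, 0 < N i := fun i => by positivity
  refine ⟨Finset.univ.image (fun a => pit (grid N a)), ?_, ?_⟩
  · refine Finset.card_image_le.trans ?_
    rw [Finset.card_univ, Fintype.card_pi]
    simp only [Fintype.card_fin, N, Finset.prod_mul_distrib, Finset.prod_const, Finset.card_univ,
      Finset.prod_pow_eq_pow_sum]
    rw [Fin.sum_univ_eq_sum_range (fun i => i), Finset.sum_range_id]
  · intro t
    obtain ⟨x, rfl, hx⟩ := pit_surj t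
    have hlt : ∀ i, ⌊x i * N i⌋₊ < N i := fun i => by
      have : (0:ℝ) < N i := by exact_mod_cast hN i
      rw [Nat.floor_lt (mul_nonneg (hx i).1 this.le)]
      nlinarith [(hx i).2]
    let a : (i : Fin k) → Fin (N i) := fun i => ⟨⌊x i * N i⌋₊, hlt i⟩
    refine ⟨pit (grid N a), Finset.mem_image_of_mem _ (Finset.mem_univ _), fun j hj => ?_⟩
    rw [f_iter hf, f_iter hf, dist_pi_lt_iff hε]
    intro i
    rw [dist_iter]
    refine (norm_coe_le _).trans_lt ?_
    rw [GG_iter_apply]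
    have hb : ∀ i, |ext0 (x - grid N a) i| ≤ (1/(M:ℝ)) / n^i := by
      intro i
      by_cases h : i < k
      · have h1 := Nat.floor_le (a := x ⟨i,h⟩ * N ⟨i,h⟩) (mul_nonneg (hx _).1 (by positivity))
        have h2 := Nat.lt_floor_add_one (x ⟨i,h⟩ * N ⟨i,h⟩)
        have hNp : (0:ℝ) < N ⟨i,h⟩ := by exact_mod_cast hN _
        have e : (1/(M:ℝ)) / n^i = 1 / N ⟨i,h⟩ := by
          simp only [N]; push_cast; rw [div_div]
        simp only [ext0, h, dite_true, Pi.sub_apply, grid, a]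
        rw [e, abs_le]
        constructor
        · have := (div_le_iff₀ hNp).2 h1
          have h3 : 0 < 1 / (N ⟨i,h⟩ : ℝ) := by positivity
          linarith
        · rw [sub_le_iff_le_add, ← add_div, le_div_iff₀ hNp]; linarith
      · simp only [ext0, h, dite_false, abs_zero]; positivity
    have hMr : (0:ℝ) < M := by exact_mod_cast hM0
    have hn1 : (1:ℝ) ≤ n^(i:ℕ) := one_le_pow₀ (by exact_mod_cast hn)
    calc _ ≤ _ := TT_upper n hn _ _ hb j i
      _ ≤ 3 * (1/(M:ℝ)) := by
          exact mul_le_mul (one_add_pow_le n hn j hj) (div_le_self (by positivity) hn1)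
            (by positivity) (by norm_num)
      _ < ε := by rw [mul_one_div, div_lt_iff₀ hMr]; exact hM

lemma stay {z : Fin k → ℝ} {η : ℝ} (hη : 3 * η ≤ 1) {n : ℕ} (hz : ∀ i, |z i| < η)
    (h : ∀ j < n, ∀ i, ‖((GG^[j] z i : ℝ) : AddCircle (1:ℝ))‖ < η) :
    ∀ j < n, ∀ i, |GG^[j] z i| < η := by
  intro j
  induction j with
  | zero => intro _; simpa using hz
  | succ j ih =>
    intro hj i
    have ih := ih (by omega)
    have hη0 : 0 < η := (abs_nonneg _).trans_lt (hz i)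
    have h1 := h (j+1) hj i
    rw [AddCircle.norm_eq] at h1
    simp only [inv_one, one_mul, mul_one] at h1
    have h2 : |GG^[j+1] z i| < 2 * η := by
      rw [Function.iterate_succ_apply']
      have e2 : |ext0 (GG^[j] z) (i+1)| < η := by
        by_cases h : (i:ℕ) + 1 < k
        · simp only [ext0, h, dite_true]; exact ih _
        · simpa only [ext0, h, dite_false, abs_zero]
      refine (abs_add_le _ _).trans_lt ?_
      linarith [ih i]
    set w := GG^[j+1] z i
    have h3 : |(round w : ℝ)| < 1 := by
      have := abs_sub w (w - round w)
      rw [sub_sub_cancel] at this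
      linarith
    have h4 : round w = 0 := by
      rw [← Int.abs_lt_one_iff]; exact_mod_cast h3
    simpa [h4] using h1

lemma cover_lower (hf : ∀ x, f (pit x) = pit (GG x)) (ε : ℝ) (hε : 3 * 2^k * (2 * ε) = 1)
    (h : ℕ) (hh : 0 < h) (S : Finset (Fin k → AddCircle (1:ℝ)))
    (hS : ∀ x, ∃ s ∈ S, ∀ j < k * h, dist (f^[j] x) (f^[j] s) < ε) :
    h^(k*(k-1)/2) ≤ S.card := by
  classical
  let N : Fin k → ℕ := fun i => h^(i:ℕ)
  have hN : ∀ i, 0 < N i := fun i => by positivity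
  have hk2 : (1:ℝ) ≤ 2^k := one_le_pow₀ (by norm_num)
  have hε0 : 0 < ε := by
    by_contra hc
    nlinarith
  choose s hs hs' using fun a => hS (pit (grid N a))
  have hinj : Function.Injective s := by
    intro a b hab
    by_contra hne
    have hfil : (Finset.univ.filter (fun i => a i ≠ b i)).Nonempty := by
      by_contra hc
      rw [Finset.not_nonempty_iff_eq_empty] at hc
      apply hne; funext i
      by_contra hi
      have : i ∈ (Finset.univ.filter (fun i => a i ≠ b i)) := by exact Finset.mem_filter.2 ⟨Finset.mem_univ _, hi⟩
      rw [hc] at this; exact absurd this (Finset.notMem_empty _)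
    obtain ⟨m, hm, hmax⟩ := Finset.exists_max_image _ (fun i : Fin k => (i:ℕ)) hfil
    have hm' : a m ≠ b m := (Finset.mem_filter.1 hm).2
    have htop : ∀ i : Fin k, m < i → a i = b i := fun i hi => by
      by_contra hc
      have := hmax i (Finset.mem_filter.2 ⟨Finset.mem_univ _, hc⟩)
      have hi' : (m:ℕ) < i := hi
      omega
    have hkpos : 0 < k * h := Nat.mul_pos (by have := m.2; omega) hh
    let z0 := grid N a - grid N b
    have hd : ∀ j < k * h, ∀ i, ‖((GG^[j] z0 i : ℝ) : AddCircle (1:ℝ))‖ < 2 * ε := by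
      intro j hj i
      rw [← dist_iter]
      have h1 := hs' a j hj
      have h2 := hs' b j hj
      rw [← hab, f_iter hf] at h2
      rw [f_iter hf] at h1
      have := dist_triangle_right (pit (GG^[j] (grid N a))) (pit (GG^[j] (grid N b))) (f^[j] (s a))
      have h4 := dist_le_pi_dist (pit (GG^[j] (grid N a))) (pit (GG^[j] (grid N b))) i
      linarith
    let z : Fin k → ℝ := fun i => z0 i - round (z0 i)
    have hpz : pit z = pit z0 := by
      funext i
      simp only [pit, z]
      rw [AddCircle.coe_sub, sub_eq_self, AddCircle.coe_eq_zero_iff]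
      exact ⟨round (z0 i), by simp⟩
    have hz : ∀ i, |z i| < 2 * ε := by
      intro i
      have := hd 0 hkpos i
      rw [AddCircle.norm_eq] at this
      simpa [z] using this
    have hdz : ∀ j < k * h, ∀ i, ‖((GG^[j] z i : ℝ) : AddCircle (1:ℝ))‖ < 2 * ε := by
      intro j hj i
      have e : pit (GG^[j] z) = pit (GG^[j] z0) := by
        rw [← f_iter hf, ← f_iter hf, hpz]
      have := congrFun e i
      simp only [pit] at this
      rw [this]; exact hd j hj i
    have hst := stay (by nlinarith) hz hdz
    have hext : ∀ i, (m:ℕ) < i → ext0 z i = 0 := by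
      intro i hi
      by_cases hik : i < k
      · simp [ext0, hik, z, z0, grid, htop ⟨i, hik⟩ hi]
      · simp [ext0, hik]
    have hfin := TT_diff h m (ext0 z) hext (2*ε) (fun l hl => by
      have hlk : l * h < k * h := Nat.mul_lt_mul_of_pos_right (by have := m.2; omega) hh
      have := hst (l*h) hlk ⟨0, by have := m.2; omega⟩
      rw [GG_iter_apply] at this
      exact this.le)
    rw [ext0_fin] at hfin
    have hh' : (h:ℝ)^(m:ℕ) ≠ 0 := by positivity
    have hint : (h:ℝ)^(m:ℕ) * z m
        = (((a m : ℕ) : ℤ) - ((b m : ℕ) : ℤ) - (h:ℤ)^(m:ℕ) * round (z0 m) : ℤ) := by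
      push_cast
      simp only [z, mul_sub]
      congr 1
      simp only [z0, grid, Pi.sub_apply, N]; push_cast
      field_simp
    have hge : (1:ℝ) ≤ (h:ℝ)^(m:ℕ) * |z m| := by
      rw [← abs_of_nonneg (show (0:ℝ) ≤ (h:ℝ)^(m:ℕ) by positivity), ← abs_mul, hint]
      rw [← Int.cast_abs]
      rw [← Int.cast_one, Int.cast_le]
      apply Int.one_le_abs
      intro h0
      have hdvd : ((h^(m:ℕ) : ℕ) : ℤ) ∣ ((a m : ℕ) : ℤ) - ((b m : ℕ) : ℤ) := by
        refine ⟨round (z0 m), ?_⟩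
        push_cast; linarith
      have h5 := Int.eq_zero_of_abs_lt_dvd hdvd (by
        have ha := (a m).2
        have hb := (b m).2
        simp only [N] at ha hb
        rw [abs_lt]; omega)
      apply hm'; apply Fin.ext; omega
    have h6 : (2:ℝ)^(m:ℕ) ≤ 2^k := pow_le_pow_right₀ (by norm_num) m.2.le
    nlinarith
  have := Finset.card_le_card_of_injOn (s := Finset.univ) (t := S) s (fun a _ => hs a) hinj.injOn
  rw [Finset.card_univ, Fintype.card_pi] at this
  simp only [Fintype.card_fin, N, Finset.prod_pow_eq_pow_sum] at this
  rwa [Fin.sum_univ_eq_sum_range (fun i => i), Finset.sum_range_id] at this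

lemma covNum_spec {X : Type*} [PseudoMetricSpace X] (f : X → X) (ε : ℝ) (n : ℕ) (S : Finset X)
    (hS : ∀ x, ∃ s ∈ S, ∀ j < n, dist (f^[j] x) (f^[j] s) < ε) :
    covNum f ε n ≤ S.card ∧ ∃ S' : Finset X, S'.card = covNum f ε n ∧
      ∀ x, ∃ s ∈ S', ∀ j < n, dist (f^[j] x) (f^[j] s) < ε :=
  ⟨Nat.sInf_le ⟨S, rfl, hS⟩, Nat.sInf_mem (s := {m : ℕ | ∃ S : Finset X, S.card = m ∧
    ∀ x : X, ∃ s ∈ S, ∀ j < n, dist (f^[j] x) (f^[j] s) < ε}) ⟨_, S, rfl, hS⟩⟩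

lemma hpol_GG (hk : 1 ≤ k) (hf : ∀ x, f (pit x) = pit (GG x)) :
    hpol f = ((k * (k - 1) / 2 : ℕ) : ℝ≥0∞) := by
  have hlog : Tendsto (fun n : ℕ => Real.log n) atTop atTop :=
    Real.tendsto_log_atTop.comp tendsto_natCast_atTop_atTop
  set D := k * (k-1) / 2 with hD
  have hDe : (D : ℝ≥0∞) = ENNReal.ofReal D := by simp
  have hM : ∀ ε : ℝ, 0 < ε → ∃ M : ℕ, 3 < ε * M := fun ε hε => by
    obtain ⟨M, hM⟩ := exists_nat_gt (3/ε)
    exact ⟨M, by rwa [div_lt_iff₀' hε] at hM⟩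
  apply le_antisymm
  · refine iSup₂_le fun ε hε => ?_
    obtain ⟨M, hM⟩ := hM ε hε
    have hM0 : 0 < M := by
      rcases Nat.eq_zero_or_pos M with h | h
      · subst h; norm_num at hM
      · exact h
    have hlim : Tendsto (fun n : ℕ => ENNReal.ofReal (k * Real.log M / Real.log n + D)) atTop
        (𝓝 (D : ℝ≥0∞)) := by
      rw [hDe]
      apply ENNReal.tendsto_ofReal
      simpa using (hlog.const_div_atTop (k * Real.log M)).add_const (D:ℝ)
    rw [← hlim.limsup_eq]
    apply limsup_le_limsup
    · filter_upwards [eventually_gt_atTop 1] with n hn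
      apply ENNReal.ofReal_le_ofReal
      obtain ⟨S, hS, hS'⟩ := cover_grid hf ε hε M hM n (by omega)
      have hc := (covNum_spec f ε n S hS').1.trans hS
      have hln : 0 < Real.log n := Real.log_pos (by exact_mod_cast hn)
      rw [div_add' _ _ _ hln.ne']
      gcongr
      rcases Nat.eq_zero_or_pos (covNum f ε n) with h0 | h0
      · rw [h0]; simp only [Nat.cast_zero, Real.log_zero]
        have : 0 ≤ Real.log M := Real.log_natCast_nonneg M
        positivity
      · have hM' : (M:ℝ) ≠ 0 := by positivity
        have hn' : (n:ℝ) ≠ 0 := by positivity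
        calc Real.log (covNum f ε n) ≤ Real.log ((M^k * n^D : ℕ) : ℝ) :=
              Real.log_le_log (by exact_mod_cast h0) (by exact_mod_cast hc)
          _ = _ := by
            push_cast
            rw [Real.log_mul (by positivity) (by positivity), Real.log_pow, Real.log_pow]
    · isBoundedDefault
    · isBoundedDefault
  · let ε : ℝ := 1 / (3 * 2^k * 2)
    have hε : 0 < ε := by positivity
    have hε1 : 3 * 2^k * (2 * ε) = 1 := by simp only [ε]; field_simp
    obtain ⟨M, hM⟩ := hM ε hε
    refine le_trans ?_ (le_iSup₂ (f := fun (ε : ℝ) (_ : 0 < ε) => Filter.atTop.limsup fun n : ℕ =>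
      ENNReal.ofReal (Real.log (covNum f ε n) / Real.log n)) ε hε)
    have hlim : Tendsto (fun h : ℕ => ENNReal.ofReal (D * (1 - Real.log k / Real.log (k * h : ℕ))))
        atTop (𝓝 (D : ℝ≥0∞)) := by
      rw [hDe]
      apply ENNReal.tendsto_ofReal
      have ht : Tendsto (fun h : ℕ => k * h) atTop atTop := tendsto_id.const_mul_atTop' (by omega)
      simpa using (((hlog.comp ht).const_div_atTop (Real.log k)).const_sub 1).const_mul (D:ℝ)
    have ht : Tendsto (fun h : ℕ => k * h) atTop atTop := tendsto_id.const_mul_atTop' (by omega)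
    rw [← hlim.limsup_eq]
    refine le_trans (limsup_le_limsup (v := (fun n : ℕ =>
      ENNReal.ofReal (Real.log (covNum f ε n) / Real.log n)) ∘ (fun h => k * h)) ?_ ?_ ?_) ?_
    · filter_upwards [eventually_gt_atTop 1] with h hh
      simp only [Function.comp]
      apply ENNReal.ofReal_le_ofReal
      have hkh : 1 < k * h := by nlinarith
      obtain ⟨S0, _, hS0⟩ := cover_grid hf ε hε M hM (k*h) (by omega)
      obtain ⟨S, hS, hS'⟩ := (covNum_spec f ε (k*h) S0 hS0).2
      have hc := cover_lower hf ε hε1 h (by omega) S hS'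
      rw [hS] at hc
      have hln : 0 < Real.log (k*h : ℕ) := Real.log_pos (by exact_mod_cast hkh)
      rw [le_div_iff₀ hln, mul_assoc, sub_mul, div_mul_cancel₀ _ hln.ne', one_mul]
      have hh0 : (h:ℝ) ≠ 0 := by positivity
      have hk0 : (k:ℝ) ≠ 0 := by positivity
      push_cast
      rw [Real.log_mul hk0 hh0, add_sub_cancel_left, ← Real.log_pow]
      apply Real.log_le_log (by positivity)
      exact_mod_cast hc
    · isBoundedDefault
    · isBoundedDefault
    · rw [limsup_comp]
      exact limsup_le_limsup_of_le ht
end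

theorem hpol_jordan_real_torus (k : ℕ) (hk : 1 ≤ k)
    (F : (Fin k → ℝ) →ₗ[ℝ] (Fin k → ℝ))
    (hF0 : F (Pi.single (⟨0, hk⟩ : Fin k) 1) = Pi.single (⟨0, hk⟩ : Fin k) 1)
    (hFm : ∀ m : Fin k, 0 < (m : ℕ) →
      F (Pi.single m 1) =
        Pi.single m 1 + Pi.single (⟨(m : ℕ) - 1, lt_of_le_of_lt (Nat.sub_le _ _) m.2⟩ : Fin k) 1)
    (Fbar : (Fin k → AddCircle (1 : ℝ)) → (Fin k → AddCircle (1 : ℝ)))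
    (hFbar : ∀ x : Fin k → ℝ,
      Fbar (fun i => ((x i : ℝ) : AddCircle (1 : ℝ))) = fun i => ((F x i : ℝ) : AddCircle (1 : ℝ))) :
    hpol Fbar = ((k * (k - 1) / 2 : ℕ) : ℝ≥0∞) := by
  refine hpol_GG hk fun x => ?_
  have := hFbar x
  rw [F_eq_GG k hk F hF0 hFm] at this
  exact this
end

section
/- Let Λ be a lattice in ℂ (a discrete additive subgroup with compact quotient ℂ/Λ), let k ≥ 1, and let F : ℂ^k → ℂ^k be the ℂ-linear map given in the canonical basis (e_1,…,e_k) by F(e_1) = e_1 and F(e_m) = e_m + e_{m-1} for 2 ≤ m ≤ k (a single unipotent Jordan block of size k with integer entries). F preserves Λ^k and hence induces a homeomorphism F̄ of the compact torus (ℂ/Λ)^k = ℂ^k/Λ^k. Then hpol(F̄) = k(k-1). -/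
open Filter Topology Metric
open scoped ENNReal

variable {X : Type*}

namespace JordanTorus

/-- The Jordan shift on sequences. -/
def T (g : ℕ → ℂ) : ℕ → ℂ := fun i => g i + g (i + 1)

/-- Extension by zero. -/
def ext {k : ℕ} (v : Fin k → ℂ) : ℕ → ℂ := fun i => if h : i < k then v ⟨i, h⟩ else 0

lemma ext_apply {k : ℕ} (v : Fin k → ℂ) (i : Fin k) : ext v i = v i := by
  simp [ext]

lemma ext_ge {k : ℕ} (v : Fin k → ℂ) (i : ℕ) (h : k ≤ i) : ext v i = 0 := by
  simp [ext, h]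

lemma ext_sub {k : ℕ} (v w : Fin k → ℂ) : ext (v - w) = ext v - ext w := by
  funext i
  by_cases h : i < k <;> simp [ext, h]

lemma T_sub (g h : ℕ → ℂ) : T (g - h) = T g - T h := by
  funext i
  simp only [T, Pi.sub_apply]; ring

lemma T_iter_sub (j : ℕ) (g h : ℕ → ℂ) : T^[j] (g - h) = T^[j] g - T^[j] h := by
  induction j generalizing g h with
  | zero => rfl
  | succ j ih => simp only [Function.iterate_succ, Function.comp]; rw [T_sub, ih]

lemma T_bound (g : ℕ → ℂ) (δ r : ℝ) (hr : 0 ≤ r)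
    (hg : ∀ i, ‖g i‖ ≤ δ * r ^ i) (j : ℕ) : ∀ i, ‖T^[j] g i‖ ≤ δ * r ^ i * (1 + r) ^ j := by
  induction j with
  | zero => simpa using hg
  | succ j ih =>
    intro i
    rw [Function.iterate_succ_apply']
    calc ‖T (T^[j] g) i‖ ≤ ‖T^[j] g i‖ + ‖T^[j] g (i+1)‖ := norm_add_le _ _
      _ ≤ δ * r ^ i * (1 + r) ^ j + δ * r ^ (i+1) * (1 + r) ^ j := add_le_add (ih i) (ih (i+1))
      _ = _ := by ring

lemma T_top (g : ℕ → ℂ) (l : ℕ) (hg : ∀ m, l + 1 < m → g m = 0) (h : ℕ) :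
    (∀ m, l + 1 < m → T^[h] g m = 0) ∧ T^[h] g (l+1) = g (l+1) ∧
      T^[h] g l = g l + h * g (l+1) := by
  induction h with
  | zero => simpa using hg
  | succ h ih =>
    obtain ⟨h1, h2, h3⟩ := ih
    rw [Function.iterate_succ_apply']
    refine ⟨fun m hm => ?_, ?_, ?_⟩
    · simp [T, h1 m hm, h1 (m+1) (by omega)]
    · simp [T, h2, h1 (l+1+1) (by omega)]
    · simp only [T, h2, h3]; push_cast; ring

lemma T_lower (h : ℕ) (l : ℕ) : ∀ (g : ℕ → ℂ) (A : ℝ), (∀ m, l < m → g m = 0) →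
    (∀ j ≤ l * h, ∀ i, ‖T^[j] g i‖ ≤ A) → (h:ℝ) ^ l * ‖g l‖ ≤ 2 ^ l * A := by
  induction l with
  | zero =>
    intro g A _ hb
    simpa using hb 0 (by simp) 0
  | succ l ih =>
    intro g A hg hb
    obtain ⟨h1, h2, h3⟩ := T_top g l hg h
    have := ih (T^[h] g - g) (2 * A) ?_ ?_
    · have e : (T^[h] g - g) l = h * g (l+1) := by
        simp [h3]
      rw [e, norm_mul, Complex.norm_natCast] at this
      calc (h:ℝ) ^ (l+1) * ‖g (l+1)‖ = (h:ℝ)^l * (h * ‖g (l+1)‖) := by ring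
        _ ≤ _ := this
        _ = _ := by ring
    · intro m hm
      rcases Nat.lt_or_ge (l+1) m with h' | h'
      · simp [h1 m h', hg m h']
      · obtain rfl : m = l + 1 := by omega
        simp [h2]
    · intro j hj i
      rw [T_iter_sub, ← Function.iterate_add_apply]
      have a1 := hb (j + h) (by rw [Nat.add_mul]; omega) i
      have a2 := hb j (by rw [Nat.add_mul]; omega) i
      calc _ ≤ ‖T^[j+h] g i‖ + ‖T^[j] g i‖ := norm_sub_le _ _
        _ ≤ _ := by linarith

lemma norm_mk_lt {Λ : AddSubgroup ℂ} {z : ℂ} {η : ℝ}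
    (h : ‖(QuotientAddGroup.mk z : ℂ ⧸ Λ)‖ < η) : ∃ l ∈ Λ, ‖z - l‖ < η := by
  obtain ⟨m, hm, hn⟩ := QuotientAddGroup.norm_lt_iff.mp h
  refine ⟨z - m, ?_, by simpa using hn⟩
  have := (QuotientAddGroup.eq (s := Λ)).mp hm
  rwa [neg_add_eq_sub] at this

lemma dist_mk {Λ : AddSubgroup ℂ} (a b : ℂ) :
    dist (QuotientAddGroup.mk a : ℂ ⧸ Λ) (QuotientAddGroup.mk b)
      = ‖(QuotientAddGroup.mk (a - b) : ℂ ⧸ Λ)‖ := by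
  rw [dist_eq_norm]; rfl

lemma inj_radius (Λ : AddSubgroup ℂ) [DiscreteTopology Λ] :
    ∃ ρ : ℝ, 0 < ρ ∧ ∀ l ∈ Λ, ‖l‖ < ρ → l = 0 := by
  have : ({0} : Set Λ) ∈ 𝓝 (0 : Λ) := by simp
  obtain ⟨ρ, hρ, h⟩ := Metric.mem_nhds_iff.mp this
  refine ⟨ρ, hρ, fun l hl hn => ?_⟩
  have : (⟨l, hl⟩ : Λ) ∈ ({0} : Set Λ) := h (by simpa using hn)
  simpa using this

lemma fund (Λ : AddSubgroup ℂ) [CompactSpace (ℂ ⧸ Λ)] :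
    ∃ R : ℕ, 0 < R ∧ ∀ q : ℂ ⧸ Λ, ∃ z : ℂ, QuotientAddGroup.mk z = q ∧
      0 ≤ z.re ∧ z.re < R ∧ 0 ≤ z.im ∧ z.im < R := by
  obtain ⟨C, hC⟩ := (isCompact_univ (X := ℂ ⧸ Λ)).isBounded.exists_norm_le
  obtain ⟨R, hR⟩ := exists_nat_gt (max C 0)
  have hR1 : C < R := (le_max_left _ _).trans_lt hR
  have hR0 : (0:ℝ) < R := (le_max_right _ _).trans_lt hR
  refine ⟨2 * R, by have : 0 < R := by exact_mod_cast hR0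
                    omega, fun q => ?_⟩
  obtain ⟨x, rfl⟩ := QuotientAddGroup.mk_surjective q
  obtain ⟨l, hl, hn⟩ := norm_mk_lt (Λ := Λ) (z := x - ⟨R, R⟩) ((hC _ (Set.mem_univ _)).trans_lt hR1)
  have h1 := (Complex.abs_re_le_norm _).trans_lt hn
  have h2 := (Complex.abs_im_le_norm _).trans_lt hn
  rw [abs_lt] at h1 h2
  simp only [Complex.sub_re, Complex.sub_im] at h1 h2
  refine ⟨x - l, ?_, ?_⟩
  · rw [QuotientAddGroup.eq]; simpa using hl
  · simp only [Complex.sub_re, Complex.sub_im]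
    push_cast
    refine ⟨by linarith, by linarith, by linarith, by linarith⟩

lemma F_coord (k : ℕ) (hk : 1 ≤ k)
    (F : (Fin k → ℂ) →ₗ[ℂ] (Fin k → ℂ))
    (hF0 : F (Pi.single (⟨0, hk⟩ : Fin k) 1) = Pi.single (⟨0, hk⟩ : Fin k) 1)
    (hFm : ∀ m : Fin k, 0 < (m : ℕ) →
      F (Pi.single m 1) =
        Pi.single m 1 + Pi.single (⟨(m : ℕ) - 1, lt_of_le_of_lt (Nat.sub_le _ _) m.2⟩ : Fin k) 1)
    (v : Fin k → ℂ) : ext (F v) = T (ext v) := by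
  have key : ∀ m i : Fin k, F (Pi.single m 1) i =
      (if i = m then 1 else 0) + (if (i:ℕ) + 1 = m then 1 else 0) := by
    intro m i
    rcases Nat.eq_zero_or_pos (m:ℕ) with h | h
    · have : m = ⟨0, hk⟩ := Fin.ext h
      subst this
      rw [hF0]
      simp [Pi.single_apply]
    · rw [hFm m h]
      simp only [Pi.add_apply, Pi.single_apply, Fin.ext_iff]
      congr 1
      by_cases h' : (i:ℕ) + 1 = m
      · rw [if_pos h', if_pos (by omega)]
      · rw [if_neg h', if_neg (by omega)]
  have hv : ∀ i, F v i = ∑ m, v m * F (Pi.single m 1) i := by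
    intro i
    conv_lhs => rw [pi_eq_sum_univ' v]
    rw [map_sum, Finset.sum_apply]
    refine Finset.sum_congr rfl fun m _ => ?_
    rw [map_smul]
    simp only [Pi.smul_apply, smul_eq_mul]
  funext i
  by_cases hi : i < k
  · simp only [T]
    have := hv ⟨i, hi⟩
    simp only [key, mul_add, Finset.sum_add_distrib] at this
    simp only [ext, dif_pos hi, this]
    congr 1
    · simp
    · by_cases h' : i + 1 < k
      · rw [dif_pos h', Finset.sum_eq_single (⟨i+1, h'⟩ : Fin k)]
        · simp
        · intro b _ hb
          rw [if_neg, mul_zero]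
          intro h
          exact hb (Fin.ext h.symm)
        · simp
      · rw [dif_neg h']
        refine Finset.sum_eq_zero fun b _ => ?_
        rw [if_neg, mul_zero]
        have := b.2
        omega
  · simp [T, ext_ge _ _ (not_lt.mp hi), ext_ge v (i+1) (by omega)]

lemma card_idx (k L n : ℕ) :
    Fintype.card ((i : Fin k) → Fin (L * n ^ (i:ℕ)) × Fin (L * n ^ (i:ℕ)))
      = L ^ (2 * k) * n ^ (k * (k - 1)) := by
  rw [Fintype.card_pi]
  simp only [Fintype.card_prod, Fintype.card_fin]
  have : ∀ i : Fin k, L * n ^ (i:ℕ) * (L * n ^ (i:ℕ)) = L ^ 2 * n ^ ((i:ℕ) * 2) := by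
    intro i; ring
  simp only [this]
  rw [Finset.prod_mul_distrib, Finset.prod_pow_eq_pow_sum _ (fun i : Fin k => (i:ℕ) * 2), ← Finset.sum_mul,
    Fin.sum_univ_eq_sum_range (fun i => i), Finset.sum_range_id_mul_two]
  simp [pow_mul]

lemma iter_mk {Λ : AddSubgroup ℂ} {k : ℕ}
    {F : (Fin k → ℂ) →ₗ[ℂ] (Fin k → ℂ)}
    {Fbar : (Fin k → ℂ ⧸ Λ) → (Fin k → ℂ ⧸ Λ)}
    (hFbar : ∀ x : Fin k → ℂ,
      Fbar (fun i => QuotientAddGroup.mk (x i)) = fun i => QuotientAddGroup.mk (F x i))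
    (hT : ∀ v, ext (F v) = T (ext v)) (j : ℕ) (x : Fin k → ℂ) :
    Fbar^[j] (fun i => QuotientAddGroup.mk (x i))
      = fun i : Fin k => QuotientAddGroup.mk (T^[j] (ext x) i) := by
  induction j generalizing x with
  | zero => simp [ext_apply]
  | succ j ih => rw [Function.iterate_succ_apply, hFbar, ih, hT]; rfl

lemma dist_iter {Λ : AddSubgroup ℂ} {k : ℕ}
    {F : (Fin k → ℂ) →ₗ[ℂ] (Fin k → ℂ)}
    {Fbar : (Fin k → ℂ ⧸ Λ) → (Fin k → ℂ ⧸ Λ)}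
    (hFbar : ∀ x : Fin k → ℂ,
      Fbar (fun i => QuotientAddGroup.mk (x i)) = fun i => QuotientAddGroup.mk (F x i))
    (hT : ∀ v, ext (F v) = T (ext v)) (j : ℕ) (x y : Fin k → ℂ) {ε : ℝ} (hε : 0 < ε) :
    dist (Fbar^[j] (fun i => QuotientAddGroup.mk (x i)))
      (Fbar^[j] (fun i => QuotientAddGroup.mk (y i))) < ε ↔
    ∀ i : Fin k, ‖(QuotientAddGroup.mk (T^[j] (ext (x - y)) i) : ℂ ⧸ Λ)‖ < ε := by
  rw [iter_mk hFbar hT, iter_mk hFbar hT, dist_pi_lt_iff hε]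
  simp only [dist_mk, ext_sub, T_iter_sub, Pi.sub_apply]

lemma pow_bound (n j : ℕ) (hj : j < n) : (1 + 1 / (n:ℝ)) ^ j ≤ 3 := by
  have hn : (0:ℝ) < n := by exact_mod_cast (by omega : 0 < n)
  have h1 : (1:ℝ) ≤ 1 + 1 / (n:ℝ) := by have : 0 < 1 / (n:ℝ) := by positivity
                                        linarith
  calc (1 + 1 / (n:ℝ)) ^ j ≤ (1 + 1 / (n:ℝ)) ^ n := pow_le_pow_right₀ h1 hj.le
    _ ≤ (Real.exp (1 / n)) ^ n := by
        gcongr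
        rw [add_comm]; exact Real.add_one_le_exp _
    _ = Real.exp 1 := by rw [← Real.exp_nat_mul]; congr 1; field_simp
    _ ≤ 3 := by linarith [Real.exp_one_lt_d9]

/-- grid point -/
def gp (s : ℝ) (a b : ℕ) : ℂ := ⟨a * s, b * s⟩

lemma floor_aux (x : ℝ) (R P : ℕ) (hP : 0 < P) (h0 : 0 ≤ x) (h1 : x < R) :
    ∃ a : Fin (R * P), |x - a * (1 / (P:ℝ))| ≤ 1 / P := by
  have hP' : (0:ℝ) < P := by exact_mod_cast hP
  refine ⟨⟨⌊x * P⌋₊, ?_⟩, ?_⟩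
  · rw [Nat.floor_lt (by positivity)]; push_cast; gcongr
  · have h2 := Nat.floor_le (show 0 ≤ x * P by positivity)
    have h3 := Nat.lt_floor_add_one (x * P)
    simp only
    have e : x - (⌊x * P⌋₊:ℝ) * (1 / (P:ℝ)) = (x * P - ⌊x * P⌋₊) / P := by field_simp
    rw [e, abs_of_nonneg (by apply div_nonneg <;> linarith)]
    gcongr; linarith

lemma upper {Λ : AddSubgroup ℂ} [CompactSpace (ℂ ⧸ Λ)] {k : ℕ}
    {F : (Fin k → ℂ) →ₗ[ℂ] (Fin k → ℂ)}
    {Fbar : (Fin k → ℂ ⧸ Λ) → (Fin k → ℂ ⧸ Λ)}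
    (hFbar : ∀ x : Fin k → ℂ,
      Fbar (fun i => QuotientAddGroup.mk (x i)) = fun i => QuotientAddGroup.mk (F x i))
    (hT : ∀ v, ext (F v) = T (ext v)) {ε : ℝ} (hε : 0 < ε) :
    ∃ L : ℕ, 0 < L ∧ ∀ n : ℕ, 0 < n → ∃ S : Finset (Fin k → ℂ ⧸ Λ),
      S.card ≤ L ^ (2 * k) * n ^ (k * (k - 1)) ∧
      ∀ x, ∃ s ∈ S, ∀ j < n, dist (Fbar^[j] x) (Fbar^[j] s) < ε := by
  classical
  obtain ⟨R, hR, hfund⟩ := fund Λ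
  obtain ⟨Q, hQ⟩ := exists_nat_gt (6 / ε)
  have hQ0 : (0:ℝ) < Q := lt_trans (by positivity) hQ
  have hQ0' : 0 < Q := by exact_mod_cast hQ0
  refine ⟨R * Q, by positivity, fun n hn => ?_⟩
  have hn' : (0:ℝ) < n := by exact_mod_cast hn
  let f : ((i : Fin k) → Fin (R * Q * n ^ (i:ℕ)) × Fin (R * Q * n ^ (i:ℕ))) → (Fin k → ℂ) :=
    fun p i => gp (1 / ((Q * n ^ (i:ℕ) : ℕ) : ℝ)) (p i).1 (p i).2
  refine ⟨Finset.univ.image fun p => (fun i => (QuotientAddGroup.mk (f p i) : ℂ ⧸ Λ)), ?_, ?_⟩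
  · refine Finset.card_image_le.trans ?_
    rw [Finset.card_univ, card_idx]
  · intro x
    choose z hz using fun i => hfund (x i)
    have hx : x = fun i => (QuotientAddGroup.mk (z i) : ℂ ⧸ Λ) := funext fun i => ((hz i).1).symm
    have ha : ∀ i : Fin k, ∃ a : Fin (R * Q * n ^ (i:ℕ)),
        |(z i).re - a * (1 / ((Q * n ^ (i:ℕ) : ℕ) : ℝ))| ≤ 1 / ((Q * n ^ (i:ℕ) : ℕ) : ℝ) := by
      intro i
      rw [mul_assoc]
      exact floor_aux _ R _ (by positivity) (hz i).2.1 (hz i).2.2.1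
    have hb : ∀ i : Fin k, ∃ a : Fin (R * Q * n ^ (i:ℕ)),
        |(z i).im - a * (1 / ((Q * n ^ (i:ℕ) : ℕ) : ℝ))| ≤ 1 / ((Q * n ^ (i:ℕ) : ℕ) : ℝ) := by
      intro i
      rw [mul_assoc]
      exact floor_aux _ R _ (by positivity) (hz i).2.2.2.1 (hz i).2.2.2.2
    choose a ha using ha
    choose b hb using hb
    refine ⟨_, Finset.mem_image_of_mem _ (Finset.mem_univ fun i => (a i, b i)), fun j hj => ?_⟩
    rw [hx, dist_iter hFbar hT j _ _ hε]
    intro i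
    refine (QuotientAddGroup.norm_mk_le_norm).trans_lt ?_
    have hg : ∀ i, ‖ext (z - f fun i => (a i, b i)) i‖ ≤ (2 / Q) * (1 / (n:ℝ)) ^ i := by
      intro i
      by_cases hi : i < k
      · simp only [ext, dif_pos hi]
        refine (Complex.norm_le_abs_re_add_abs_im _).trans ?_
        have h1 := ha ⟨i, hi⟩
        have h2 := hb ⟨i, hi⟩
        refine (add_le_add h1 h2).trans (le_of_eq ?_)
        push_cast
        rw [one_div_pow]
        field_simp
        norm_num
      · rw [ext_ge _ _ (not_lt.mp hi), norm_zero]; positivity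
    refine (T_bound _ _ _ (by positivity) hg j i).trans_lt ?_
    have h1 : (1 / (n:ℝ)) ^ (i:ℕ) ≤ 1 := by
      apply pow_le_one₀ (by positivity)
      rw [div_le_one hn']; exact_mod_cast hn
    calc (2 / (Q:ℝ)) * (1 / (n:ℝ)) ^ (i:ℕ) * (1 + 1 / (n:ℝ)) ^ j ≤ (2 / Q) * 1 * 3 := by
          gcongr; exact pow_bound n j hj
      _ = 6 / Q := by ring
      _ < ε := by
        rw [div_lt_iff₀ hQ0]; rw [div_lt_iff₀ hε] at hQ; linarith

lemma gp_sub_norm_le (s : ℝ) (hs : 0 ≤ s) (P : ℕ) (a b a' b' : ℕ) (ha : a < P) (hb : b < P)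
    (ha' : a' < P) (hb' : b' < P) : ‖gp s a b - gp s a' b'‖ ≤ 2 * (P * s) := by
  have aux : ∀ u w : ℕ, u < P → w < P → |(u:ℝ) * s - w * s| ≤ P * s := by
    intro u w hu hw
    have hu' : (u:ℝ) ≤ P := by exact_mod_cast hu.le
    have hw' : (w:ℝ) ≤ P := by exact_mod_cast hw.le
    have := mul_le_mul_of_nonneg_right hu' hs
    have := mul_le_mul_of_nonneg_right hw' hs
    have : 0 ≤ (u:ℝ) * s := by positivity
    have : 0 ≤ (w:ℝ) * s := by positivity
    rw [abs_le]; constructor <;> linarith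
  refine (Complex.norm_le_abs_re_add_abs_im _).trans ?_
  have h1 := aux a a' ha ha'
  have h2 := aux b b' hb hb'
  simp only [gp, Complex.sub_re, Complex.sub_im]
  linarith

lemma gp_sub_norm_ge (s : ℝ) (hs : 0 ≤ s) (a b a' b' : ℕ) (h : ¬ (a = a' ∧ b = b')) :
    s ≤ ‖gp s a b - gp s a' b'‖ := by
  have aux : ∀ u w : ℕ, u ≠ w → s ≤ |(u:ℝ) * s - w * s| := by
    intro u w hu
    rw [← sub_mul, abs_mul, abs_of_nonneg hs]
    have : (1:ℝ) ≤ |(u:ℝ) - w| := by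
      have h : (u:ℤ) - w ≠ 0 := by omega
      have := Int.one_le_abs h
      exact_mod_cast this
    nlinarith
  by_cases ha : a = a'
  · have hb : b ≠ b' := fun hb => h ⟨ha, hb⟩
    exact (aux b b' hb).trans (by simpa [gp] using Complex.abs_im_le_norm (gp s a b - gp s a' b'))
  · exact (aux a a' ha).trans (by simpa [gp] using Complex.abs_re_le_norm (gp s a b - gp s a' b'))

lemma lower {Λ : AddSubgroup ℂ} [DiscreteTopology Λ] {k : ℕ} (hk : 1 ≤ k)
    {F : (Fin k → ℂ) →ₗ[ℂ] (Fin k → ℂ)}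
    {Fbar : (Fin k → ℂ ⧸ Λ) → (Fin k → ℂ ⧸ Λ)}
    (hFbar : ∀ x : Fin k → ℂ,
      Fbar (fun i => QuotientAddGroup.mk (x i)) = fun i => QuotientAddGroup.mk (F x i))
    (hT : ∀ v, ext (F v) = T (ext v)) :
    ∃ ε : ℝ, 0 < ε ∧ ∀ n : ℕ, 2 * k ≤ n → ∀ S : Finset (Fin k → ℂ ⧸ Λ),
      (∀ x, ∃ s ∈ S, ∀ j < n, dist (Fbar^[j] x) (Fbar^[j] s) < ε) →
      n ^ (k * (k - 1)) ≤ S.card := by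
  classical
  obtain ⟨ρ, hρ, hinj⟩ := inj_radius Λ
  -- separation constant
  let c : ℝ := (1 / (4 * k)) ^ k
  have hk' : (1:ℝ) ≤ k := by exact_mod_cast hk
  have hc : 0 < c := by positivity
  have hc1 : c ≤ 1 := by
    apply pow_le_one₀ (by positivity)
    rw [div_le_one (by positivity)]; linarith
  let ε : ℝ := ρ * c / 16
  have hε : 0 < ε := by positivity
  have hερ : ε ≤ ρ / 16 := by
    have : ρ * c ≤ ρ * 1 := by gcongr
    simp only [ε]; linarith
  refine ⟨ε, hε, fun n hn S hS => ?_⟩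
  have hn0 : 0 < n := by omega
  have hn' : (0:ℝ) < n := by exact_mod_cast hn0
  let s : ℕ → ℝ := fun i => ρ / 4 / n ^ i
  have hs : ∀ i, 0 < s i := fun i => by positivity
  let f : ((i : Fin k) → Fin (1 * n ^ (i:ℕ)) × Fin (1 * n ^ (i:ℕ))) → (Fin k → ℂ) :=
    fun p i => gp (s i) (p i).1 (p i).2
  choose φ hφS hφ using fun p => hS (fun i => (QuotientAddGroup.mk (f p i) : ℂ ⧸ Λ))
  have hφinj : Function.Injective φ := by
    intro p q hpq
    by_contra hne
    set g := ext (f p - f q) with hg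
    have hclose : ∀ j < n, ∀ i : Fin k, ‖(QuotientAddGroup.mk (T^[j] g i) : ℂ ⧸ Λ)‖ < 2 * ε := by
      intro j hj
      rw [← dist_iter hFbar hT j _ _ (by positivity)]
      have h1 := hφ p j hj
      have h2 := hφ q j hj
      rw [← hpq] at h2
      have := dist_triangle_right (Fbar^[j] (fun i => (QuotientAddGroup.mk (f p i) : ℂ ⧸ Λ)))
        (Fbar^[j] (fun i => (QuotientAddGroup.mk (f q i) : ℂ ⧸ Λ))) (Fbar^[j] (φ p))
      linarith
    have hstep : ∀ z : ℂ, ‖(QuotientAddGroup.mk z : ℂ ⧸ Λ)‖ < 2 * ε → ‖z‖ ≤ ρ / 2 →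
        ‖z‖ < 2 * ε := by
      intro z h1 h2
      obtain ⟨l, hl, hn⟩ := norm_mk_lt h1
      have : l = 0 := by
        apply hinj l hl
        have : ‖l‖ ≤ ‖z‖ + ‖z - l‖ := by
          have := norm_sub_le z (z - l)
          simpa using this
        linarith
      simpa [this] using hn
    have hz : ∀ j, ∀ i, k ≤ i → T^[j] g i = 0 := by
      intro j
      induction j with
      | zero => intro i hi; exact ext_ge _ _ hi
      | succ j ih =>
        intro i hi
        rw [Function.iterate_succ_apply']
        simp [T, ih i hi, ih (i+1) (by omega)]
    have hb : ∀ j < n, ∀ i, ‖T^[j] g i‖ < 2 * ε := by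
      intro j
      induction j with
      | zero =>
        intro h0 i
        by_cases hi : i < k
        · apply hstep _ (hclose 0 h0 ⟨i, hi⟩)
          simp only [Function.iterate_zero, id, hg, ext, dif_pos hi]
          refine (gp_sub_norm_le (s i) (hs i).le (n ^ i) _ _ _ _ ?_ ?_ ?_ ?_).trans
            (le_of_eq ?_)
          · simpa using (p ⟨i, hi⟩).1.2
          · simpa using (p ⟨i, hi⟩).2.2
          · simpa using (q ⟨i, hi⟩).1.2
          · simpa using (q ⟨i, hi⟩).2.2
          · simp only [s]; push_cast; field_simp; norm_num
        · rw [hz 0 i (not_lt.mp hi), norm_zero]; positivity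
      | succ j ih =>
        intro hj i
        by_cases hi : i < k
        · apply hstep _ (hclose (j+1) hj ⟨i, hi⟩)
          rw [Function.iterate_succ_apply']
          have h1 := ih (by omega) i
          have h2 := ih (by omega) (i+1)
          have : ‖T (T^[j] g) i‖ ≤ ‖T^[j] g i‖ + ‖T^[j] g (i+1)‖ := norm_add_le _ _
          linarith
        · rw [hz (j+1) i (not_lt.mp hi), norm_zero]; positivity
    -- top index
    have hex : ∃ i : Fin k, p i ≠ q i := by
      by_contra h
      push Not at h
      exact hne (funext h)
    obtain ⟨l, hl, hmax⟩ : ∃ l : Fin k, p l ≠ q l ∧ ∀ m, l < m → p m = q m := by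
      have hne' : (Finset.univ.filter fun i : Fin k => p i ≠ q i).Nonempty := by
        obtain ⟨i, hi⟩ := hex
        exact ⟨i, by simp [hi]⟩
      refine ⟨_, (Finset.mem_filter.mp (Finset.max'_mem _ hne')).2, fun m hm => ?_⟩
      by_contra h
      exact absurd (Finset.le_max' _ m (by simp [h])) (not_le.mpr hm)
    have htop : ∀ m, (l:ℕ) < m → g m = 0 := by
      intro m hm
      by_cases hmk : m < k
      · have := hmax ⟨m, hmk⟩ hm
        simp [hg, ext, hmk, f, this]
      · exact ext_ge _ _ (not_lt.mp hmk)
    have hgl : s l ≤ ‖g l‖ := by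
      rw [hg, ext_apply]
      apply gp_sub_norm_ge _ (hs l).le
      rintro ⟨h1, h2⟩
      exact hl (Prod.ext (Fin.ext h1) (Fin.ext h2))
    let h := n / k
    have hh : (n:ℝ) ≤ 2 * k * h := by
      have h1 : n < k * (n / k + 1) := Nat.lt_mul_div_succ n hk
      have h2 : 2 ≤ n / k := (Nat.le_div_iff_mul_le hk).mpr hn
      have : n ≤ 2 * k * (n / k) := by nlinarith
      exact_mod_cast this
    have hlow := T_lower h l g (2 * ε) htop (fun j hj i => by
      refine (hb j ?_ i).le
      refine lt_of_le_of_lt hj ?_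
      have h1 : (l:ℕ) * (n / k) < k * (n / k) := by
        apply Nat.mul_lt_mul_of_pos_right l.2
        have : 2 ≤ n / k := (Nat.le_div_iff_mul_le hk).mpr hn
        omega
      exact h1.trans_le (Nat.mul_div_le n k))
    have h1 : (h:ℝ) ^ (l:ℕ) * s l ≤ 2 ^ (l:ℕ) * (2 * ε) :=
      (mul_le_mul_of_nonneg_left hgl (by positivity)).trans hlow
    have h2 : (n:ℝ) ^ (l:ℕ) ≤ (2 * k) ^ (l:ℕ) * (h:ℝ) ^ (l:ℕ) := by
      rw [← mul_pow]; gcongr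
    have h3 : ρ / 4 ≤ (4 * k) ^ (l:ℕ) * (2 * ε) := by
      calc ρ / 4 = (n:ℝ) ^ (l:ℕ) * s l := by simp only [s]; field_simp
        _ ≤ (2 * k) ^ (l:ℕ) * (h:ℝ) ^ (l:ℕ) * s l :=
            mul_le_mul_of_nonneg_right h2 (hs l).le
        _ = (2 * k) ^ (l:ℕ) * ((h:ℝ) ^ (l:ℕ) * s l) := by ring
        _ ≤ (2 * k) ^ (l:ℕ) * (2 ^ (l:ℕ) * (2 * ε)) :=
            mul_le_mul_of_nonneg_left h1 (by positivity)
        _ = ((2 * k) * 2) ^ (l:ℕ) * (2 * ε) := by rw [mul_pow (2 * (k:ℝ)) 2]; ring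
        _ = _ := by ring
    have h4 : (4 * (k:ℝ)) ^ (l:ℕ) ≤ (4 * k) ^ k :=
      pow_le_pow_right₀ (by linarith) l.2.le
    have h5 : ρ / 4 ≤ (4 * (k:ℝ)) ^ k * (2 * ε) :=
      h3.trans (mul_le_mul_of_nonneg_right h4 (by positivity))
    have h6 : (4 * (k:ℝ)) ^ k * (2 * ε) = ρ / 8 := by
      have : (4 * (k:ℝ)) ^ k * c = 1 := by
        simp only [c]; rw [← mul_pow, mul_one_div_cancel (by positivity), one_pow]
      calc (4 * (k:ℝ)) ^ k * (2 * ε) = ((4 * (k:ℝ)) ^ k * c) * (ρ / 8) := by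
            simp only [ε]; ring
        _ = _ := by rw [this, one_mul]
    linarith
  have hcard := Finset.card_le_card_of_injOn (s := Finset.univ) (t := S) φ
    (fun p _ => hφS p) hφinj.injOn
  rw [Finset.card_univ, card_idx] at hcard
  simpa using hcard

end JordanTorus

/-- Let `Λ` be a lattice in `ℂ` (a discrete additive subgroup with compact quotient `ℂ/Λ`),
and let `F : ℂ^k → ℂ^k` be the `ℂ`-linear map given in the canonical basis by
`F e_0 = e_0`, `F e_m = e_m + e_{m-1}` (a single unipotent Jordan block of size `k`).
It preserves `Λ^k` and induces a homeomorphism `Fbar` of the compact torus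
`(ℂ/Λ)^k = ℂ^k/Λ^k`, characterized by `Fbar ∘ π = π ∘ F`.  Each factor `ℂ/Λ` carries the
quotient metric, and the product carries the sup metric (a quotient metric of a norm
on `ℂ^k`).  Then `hpol Fbar = k(k-1)`. -/
theorem hpol_jordan_complex_torus (Λ : AddSubgroup ℂ)
    [DiscreteTopology Λ] [CompactSpace (ℂ ⧸ Λ)]
    (k : ℕ) (hk : 1 ≤ k)
    (F : (Fin k → ℂ) →ₗ[ℂ] (Fin k → ℂ))
    (hF0 : F (Pi.single (⟨0, hk⟩ : Fin k) 1) = Pi.single (⟨0, hk⟩ : Fin k) 1)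
    (hFm : ∀ m : Fin k, 0 < (m : ℕ) →
      F (Pi.single m 1) =
        Pi.single m 1 + Pi.single (⟨(m : ℕ) - 1, lt_of_le_of_lt (Nat.sub_le _ _) m.2⟩ : Fin k) 1)
    (Fbar : (Fin k → ℂ ⧸ Λ) → (Fin k → ℂ ⧸ Λ))
    (hFbar : ∀ x : Fin k → ℂ,
      Fbar (fun i => QuotientAddGroup.mk (x i)) = fun i => QuotientAddGroup.mk (F x i)) :
    hpol Fbar = ((k * (k - 1) : ℕ) : ℝ≥0∞) := by
  classical
  have hT := JordanTorus.F_coord k hk F hF0 hFm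
  apply le_antisymm
  · refine iSup₂_le fun ε hε => ?_
    obtain ⟨L, hL, hup⟩ := JordanTorus.upper hFbar hT hε
    set C : ℕ := L ^ (2 * k) with hC
    set D : ℕ := k * (k - 1) with hD
    have hC0 : 0 < C := by positivity
    have hcov : ∀ n : ℕ, 0 < n → covNum Fbar ε n ≤ C * n ^ D := by
      intro n hn
      obtain ⟨S, hS, hS'⟩ := hup n hn
      unfold covNum
      refine le_trans (Nat.sInf_le ?_) hS
      exact ⟨S, rfl, hS'⟩
    have hlim : Tendsto (fun n : ℕ => ENNReal.ofReal (Real.log C / Real.log n + D)) atTop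
        (𝓝 (D : ℝ≥0∞)) := by
      have h1 : Tendsto (fun n : ℕ => Real.log C / Real.log n + D) atTop (𝓝 (0 + (D:ℝ))) :=
        ((Real.tendsto_log_atTop.comp tendsto_natCast_atTop_atTop).const_div_atTop _).add_const _
      have h2 := ENNReal.tendsto_ofReal h1
      rwa [zero_add, ENNReal.ofReal_natCast] at h2
    rw [← hlim.limsup_eq]
    refine limsup_le_limsup ?_
    filter_upwards [eventually_ge_atTop 2] with n hn
    apply ENNReal.ofReal_le_ofReal
    have hn' : (1:ℝ) < n := by exact_mod_cast (by omega : 1 < n)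
    have hlog : 0 < Real.log n := Real.log_pos hn'
    have hC' : (0:ℝ) < C := by exact_mod_cast hC0
    have e : Real.log C / Real.log n + D = Real.log ((C:ℝ) * n ^ D) / Real.log n := by
      rw [Real.log_mul (by positivity) (by positivity), Real.log_pow]
      field_simp
    rw [e]
    refine div_le_div_of_nonneg_right ?_ hlog.le
    rcases Nat.eq_zero_or_pos (covNum Fbar ε n) with h0 | h0
    · rw [h0]
      simp only [Nat.cast_zero, Real.log_zero]
      apply Real.log_nonneg
      have : 1 ≤ C * n ^ D := Nat.succ_le_of_lt (by positivity)
      exact_mod_cast this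
    · apply Real.log_le_log (by exact_mod_cast h0)
      exact_mod_cast hcov n (by omega)
  · obtain ⟨ε, hε, hlow⟩ := JordanTorus.lower hk hFbar hT
    refine le_trans ?_ (le_iSup₂ (f := fun (ε : ℝ) (_ : 0 < ε) =>
      Filter.atTop.limsup fun n : ℕ =>
      ENNReal.ofReal (Real.log (covNum Fbar ε n) / Real.log n)) ε hε)
    refine le_trans ?_ (liminf_le_limsup)
    refine le_liminf_of_le (by isBoundedDefault) ?_
    obtain ⟨L, hL, hup⟩ := JordanTorus.upper hFbar hT hε
    filter_upwards [eventually_ge_atTop 2, eventually_ge_atTop (2 * k)] with n hn hn2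
    have hn' : (1:ℝ) < n := by exact_mod_cast (by omega : 1 < n)
    have hlog : 0 < Real.log n := Real.log_pos hn'
    have hcov : n ^ (k * (k - 1)) ≤ covNum Fbar ε n := by
      obtain ⟨S, _, hS'⟩ := hup n (by omega)
      obtain ⟨S₀, h1, h2⟩ := Nat.sInf_mem (s := {m : ℕ | ∃ S : Finset (Fin k → ℂ ⧸ Λ), S.card = m ∧
        ∀ x, ∃ s ∈ S, ∀ j < n, dist (Fbar^[j] x) (Fbar^[j] s) < ε}) ⟨_, S, rfl, hS'⟩
      unfold covNum
      rw [← h1]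
      exact hlow n hn2 S₀ h2
    rw [← ENNReal.ofReal_natCast]
    apply ENNReal.ofReal_le_ofReal
    rw [le_div_iff₀ hlog, ← Real.log_pow]
    apply Real.log_le_log (by positivity)
    exact_mod_cast hcov
end

section
/- Let Λ be a lattice in ℂ^k (a discrete additive subgroup such that X = ℂ^k/Λ is compact), let A ∈ GL_k(ℂ) be a ℂ-linear automorphism with A(Λ) = Λ, and let B ∈ ℂ^k. Let f be the automorphism of the complex torus X = ℂ^k/Λ induced by z ↦ A z + B. If the topological entropy of f is zero, then hpol(f) ≤ k(k-1). -/
open Filter Topology Metric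
open scoped ENNReal

variable {X : Type*}

/-- The topological entropy `htop f = lim_{ε → 0} limsup_n (1/n) log (Cov_ε(n))`,
with values in `[0,+∞]` (the limit as `ε → 0` is the supremum over `ε > 0`). -/
noncomputable def htop [PseudoMetricSpace X] (f : X → X) : ℝ≥0∞ :=
  ⨆ (ε : ℝ) (_ : 0 < ε),
    Filter.atTop.limsup fun n : ℕ =>
      ENNReal.ofReal (Real.log (covNum f ε n) / n)

lemma aux_pow (j c i : ℕ) (h : i < c) :
    ((j:ℝ)+1)^i ≤ ((j:ℝ)+2)^c - ((j:ℝ)+1)^c := by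
  obtain ⟨m, rfl⟩ : ∃ m, c = m + 1 := ⟨c - 1, by omega⟩
  have h1 : ((j:ℝ)+1)^i ≤ ((j:ℝ)+1)^m := pow_le_pow_right₀ (by linarith [Nat.cast_nonneg (α := ℝ) j]) (by omega)
  have h2 : ((j:ℝ)+1)^m ≤ ((j:ℝ)+2)^m := by gcongr; norm_num
  have h3 : ((j:ℝ)+2) * ((j:ℝ)+1)^m ≤ ((j:ℝ)+2) * ((j:ℝ)+2)^m := by gcongr
  rw [pow_succ, pow_succ]
  nlinarith

lemma exists_triang {V : Type*} [NormedAddCommGroup V] [NormedSpace ℂ V] [FiniteDimensional ℂ V]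
    (A : V →ₗ[ℂ] V) (hA : ∀ (μ : ℂ) (v : V), v ≠ 0 → A v = μ • v → ‖μ‖ ≤ 1) (c : ℕ)
    (hc : c ≤ Module.finrank ℂ V) :
    ∃ b : Fin c → V, LinearIndependent ℂ b ∧
      (∀ i, A (b i) ∈ Submodule.span ℂ (Set.range b)) ∧
      ∃ C : ℝ, 0 ≤ C ∧ ∀ (i : Fin c) (j : ℕ), ‖(A^[j]) (b i)‖ ≤ C * ((j:ℝ)+1)^(i:ℕ) := by
  induction c with
  | zero => exact ⟨fun i => i.elim0, linearIndependent_empty_type, fun i => i.elim0, 0, le_rfl, fun i => i.elim0⟩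
  | succ c ih =>
    obtain ⟨b, hb, hinv, C, hC0, hC⟩ := ih (by omega)
    set W := Submodule.span ℂ (Set.range b) with hW
    have hAW : W ≤ W.comap A := by
      rw [hW, Submodule.span_le]
      rintro _ ⟨i, rfl⟩
      exact hinv i
    have hfr : Module.finrank ℂ W = c := by
      rw [hW, finrank_span_eq_card hb]; simp
    have hne : Nontrivial (V ⧸ W) := by
      rw [Submodule.Quotient.nontrivial_iff]
      intro h
      rw [h, finrank_top] at hfr
      omega
    obtain ⟨μ, hμ⟩ := Module.End.exists_eigenvalue (W.mapQ W A hAW)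
    obtain ⟨y, hy⟩ := hμ.exists_hasEigenvector
    obtain ⟨x, rfl⟩ := W.mkQ_surjective y
    have hxW : x ∉ W := by
      intro h
      exact hy.2 (by simpa using h)
    have hw : A x - μ • x ∈ W := by
      have := hy.apply_eq_smul
      rw [← Submodule.Quotient.mk_eq_zero W, Submodule.Quotient.mk_sub, sub_eq_zero]
      simpa using this
    have hμ1 : ‖μ‖ ≤ 1 := by
      by_contra hlt
      have hinj : Function.Injective (A - μ • LinearMap.id : V →ₗ[ℂ] V) := by
        rw [← LinearMap.ker_eq_bot, LinearMap.ker_eq_bot']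
        intro v hv
        by_contra hv0
        exact hlt (hA μ v hv0 (by simpa [sub_eq_zero] using hv))
      have hmap : ∀ v ∈ W, (A - μ • LinearMap.id : V →ₗ[ℂ] V) v ∈ W := by
        intro v hv
        simpa using W.sub_mem (hAW hv) (W.smul_mem μ hv)
      have hinj' : Function.Injective ((A - μ • LinearMap.id : V →ₗ[ℂ] V).restrict hmap) := by
        intro u v h
        apply Subtype.ext
        apply hinj
        simpa using congrArg Subtype.val h
      obtain ⟨s, hs⟩ := (LinearMap.injective_iff_surjective.mp hinj') ⟨_, hw⟩
      have h2 : (A - μ • LinearMap.id : V →ₗ[ℂ] V) s = (A - μ • LinearMap.id : V →ₗ[ℂ] V) x := by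
        simpa using congrArg Subtype.val hs
      exact hxW (hinj h2 ▸ s.2)
    obtain ⟨a, ha⟩ := (Submodule.mem_span_range_iff_exists_fun ℂ).mp hw
    have hpow : ∀ j : ℕ, (A^[j] : V → V) = ⇑(A^j) := fun j => (Module.End.coe_pow A j).symm
    have hwj : ∀ j : ℕ, ‖(A^[j]) (A x - μ • x)‖ ≤
        ((∑ i, ‖a i‖) * C) * (((j:ℝ)+2)^c - ((j:ℝ)+1)^c) := by
      intro j
      rw [← ha, hpow, map_sum]
      refine (norm_sum_le _ _).trans ?_
      rw [Finset.sum_mul, Finset.sum_mul]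
      refine Finset.sum_le_sum fun i _ => ?_
      rw [map_smul, norm_smul, mul_assoc]
      gcongr
      rw [← hpow]
      exact (hC i j).trans (by gcongr; exact aux_pow j c i i.2)
    set D := (∑ i, ‖a i‖) * C with hD
    have hD0 : 0 ≤ D := by positivity
    have hxj : ∀ j : ℕ, ‖(A^[j]) x‖ ≤ (‖x‖ + D) * ((j:ℝ)+1)^c := by
      intro j
      induction j with
      | zero => simpa using hD0
      | succ j ihj =>
        have e : (A^[j+1]) x = μ • (A^[j]) x + (A^[j]) (A x - μ • x) := by
          rw [Function.iterate_succ_apply]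
          simp only [hpow, map_sub, map_smul]
          abel
        rw [e]
        have h1 : ‖μ • (A^[j]) x‖ ≤ ‖(A^[j]) x‖ := by
          rw [norm_smul]
          exact mul_le_of_le_one_left (norm_nonneg _) hμ1
        have h2 : ((j:ℝ)+1)^c ≤ ((j:ℝ)+2)^c := by gcongr; norm_num
        have h3 := norm_add_le (μ • (A^[j]) x) ((A^[j]) (A x - μ • x))
        have h4 := hwj j
        have h5 : ((j+1:ℕ):ℝ) + 1 = (j:ℝ) + 2 := by push_cast; ring
        rw [h5]
        nlinarith [norm_nonneg x]
    refine ⟨Fin.snoc b x, linearIndependent_finSnoc.mpr ⟨hb, hxW⟩, ?_, max C (‖x‖ + D), le_max_of_le_left hC0, ?_⟩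
    · have hsub : W ≤ Submodule.span ℂ (Set.range (Fin.snoc b x : Fin (c+1) → V)) := by
        apply Submodule.span_mono
        rintro _ ⟨i, rfl⟩
        exact ⟨i.castSucc, by simp⟩
      intro i
      refine Fin.lastCases ?_ (fun i => ?_) i
      · have : A x = (A x - μ • x) + μ • x := by abel
        rw [Fin.snoc_last, this]
        exact Submodule.add_mem _ (hsub hw) (Submodule.smul_mem _ _ (Submodule.subset_span ⟨Fin.last c, by simp⟩))
      · rw [Fin.snoc_castSucc]
        exact hsub (hinv i)
    · intro i j
      refine Fin.lastCases ?_ (fun i => ?_) i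
      · rw [Fin.snoc_last, Fin.val_last]
        exact (hxj j).trans (by gcongr; exact le_max_right _ _)
      · rw [Fin.snoc_castSucc, Fin.val_castSucc]
        exact (hC i j).trans (by gcongr; exact le_max_left _ _)

lemma exists_grid (R : ℝ) (hR : 0 ≤ R) (η : ℝ) (hη : 0 < η) (hη1 : η ≤ 1) :
    ∃ G : Finset ℂ, (G.card : ℝ) ≤ ((2*R+5)/η)^2 ∧ ∀ z : ℂ, ‖z‖ ≤ R → ∃ g ∈ G, ‖z - g‖ ≤ 2*η := by
  classical
  set N : ℤ := ⌈R/η⌉ with hN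
  have hN0 : 0 ≤ N := Int.ceil_nonneg (by positivity)
  have hNR : (N:ℝ) < R/η + 1 := Int.ceil_lt_add_one _
  refine ⟨((Finset.Icc (-N-1) N) ×ˢ (Finset.Icc (-N-1) N)).image
    (fun p : ℤ × ℤ => (⟨η * p.1, η * p.2⟩ : ℂ)), ?_, ?_⟩
  · have h1 : (((Finset.Icc (-N-1) N).card : ℕ) : ℝ) ≤ (2*R+5)/η := by
      rw [Int.card_Icc]
      have : (((N + 1 - (-N-1)).toNat : ℕ) : ℝ) = 2 * N + 2 := by
        have h : (((N + 1 - (-N-1)).toNat : ℕ) : ℤ) = 2 * N + 2 := by omega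
        exact_mod_cast h
      rw [this]
      have h5 : 4 ≤ 5/η := by rw [le_div_iff₀ hη]; linarith
      have : (2*R+5)/η = 2*(R/η) + 5/η := by ring
      linarith
    calc _ ≤ ((((Finset.Icc (-N-1) N) ×ˢ (Finset.Icc (-N-1) N)).card : ℕ) : ℝ) := by
          exact_mod_cast Finset.card_image_le
      _ = (((Finset.Icc (-N-1) N).card : ℕ) : ℝ)^2 := by rw [Finset.card_product]; push_cast; ring
      _ ≤ _ := by gcongr
  · have key : ∀ t : ℝ, |t| ≤ R → ⌊t/η⌋ ∈ Finset.Icc (-N-1) N ∧ |t - η * ⌊t/η⌋| ≤ η := by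
      intro t ht
      have h1 := Int.floor_le (t/η)
      have h2 := Int.lt_floor_add_one (t/η)
      have hb : R/η ≤ N := Int.le_ceil _
      obtain ⟨ht1, ht2⟩ := abs_le.mp ht
      have h3 : t/η ≤ R/η := by gcongr
      have h4 : -(R/η) ≤ t/η := by rw [← neg_div]; gcongr
      have e : t = η * (t/η) := by field_simp
      refine ⟨Finset.mem_Icc.mpr ⟨?_, ?_⟩, ?_⟩
      · have : ((-N-1 : ℤ):ℝ) < ⌊t/η⌋ := by push_cast; linarith
        exact_mod_cast this.le
      · have : ((⌊t/η⌋:ℤ):ℝ) ≤ N := by linarith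
        exact_mod_cast this
      · have e2 : t - η * ⌊t/η⌋ = η * (t/η - ⌊t/η⌋) := by rw [mul_sub, ← e]
        rw [e2, abs_of_nonneg (mul_nonneg hη.le (by linarith))]
        nlinarith
    intro z hz
    obtain ⟨h1, h2⟩ := key z.re ((Complex.abs_re_le_norm z).trans hz)
    obtain ⟨h3, h4⟩ := key z.im ((Complex.abs_im_le_norm z).trans hz)
    refine ⟨_, Finset.mem_image_of_mem _ (Finset.mk_mem_product h1 h3), ?_⟩
    refine (Complex.norm_le_abs_re_add_abs_im _).trans ?_
    simp only [Complex.sub_re, Complex.sub_im]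
    linarith

lemma iter_dist {k : ℕ} {Λ : AddSubgroup (Fin k → ℂ)}
    (A : (Fin k → ℂ) ≃ₗ[ℂ] (Fin k → ℂ)) (B : Fin k → ℂ)
    (f : ((Fin k → ℂ) ⧸ Λ) → ((Fin k → ℂ) ⧸ Λ))
    (hf : ∀ z : Fin k → ℂ, f (QuotientAddGroup.mk z) = QuotientAddGroup.mk (A z + B))
    (j : ℕ) (z w : Fin k → ℂ) :
    dist (f^[j] (QuotientAddGroup.mk z)) (f^[j] (QuotientAddGroup.mk w)) =
      ‖(QuotientAddGroup.mk ((A.toLinearMap)^[j] (z - w)) : (Fin k → ℂ) ⧸ Λ)‖ := by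
  induction j generalizing z w with
  | zero => simp [dist_eq_norm]
  | succ j ih =>
    rw [Function.iterate_succ_apply, Function.iterate_succ_apply, Function.iterate_succ_apply,
      hf, hf, ih]
    congr 3
    simp

lemma f_cont {k : ℕ} {Λ : AddSubgroup (Fin k → ℂ)}
    (A : (Fin k → ℂ) ≃ₗ[ℂ] (Fin k → ℂ)) (B : Fin k → ℂ)
    (f : ((Fin k → ℂ) ⧸ Λ) → ((Fin k → ℂ) ⧸ Λ))
    (hf : ∀ z : Fin k → ℂ, f (QuotientAddGroup.mk z) = QuotientAddGroup.mk (A z + B)) :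
    Continuous f := by
  have hq : IsQuotientMap (QuotientAddGroup.mk : (Fin k → ℂ) → (Fin k → ℂ) ⧸ Λ) :=
    QuotientAddGroup.isQuotientMap_mk Λ
  rw [hq.continuous_iff]
  have e : (f ∘ (QuotientAddGroup.mk : (Fin k → ℂ) → (Fin k → ℂ) ⧸ Λ)) =
      fun z => QuotientAddGroup.mk (A z + B) := funext hf
  rw [e]
  have hA : Continuous A := A.toLinearMap.continuous_of_finiteDimensional
  exact hq.continuous.comp (hA.add continuous_const)

lemma cover_exists {X : Type*} [PseudoMetricSpace X] [CompactSpace X] (f : X → X)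
    (hf : Continuous f) (ε : ℝ) (hε : 0 < ε) (n : ℕ) :
    ∃ S : Finset X, S.card = covNum f ε n ∧
    ∀ x : X, ∃ s ∈ S, ∀ j < n, dist (f^[j] x) (f^[j] s) < ε := by
  have hne : {m : ℕ | ∃ S : Finset X, S.card = m ∧
    ∀ x : X, ∃ s ∈ S, ∀ j < n, dist (f^[j] x) (f^[j] s) < ε}.Nonempty := by
    obtain ⟨t, -, ht⟩ := (isCompact_univ (X := X)).elim_nhds_subcover
      (fun s => {x | ∀ j ∈ Finset.range n, dist (f^[j] x) (f^[j] s) < ε}) (fun s _ => by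
        have : ∀ᶠ x in 𝓝 s, ∀ j ∈ Finset.range n, dist (f^[j] x) (f^[j] s) < ε := by
          rw [Filter.eventually_all_finset]
          intro j _
          exact ((hf.iterate j).tendsto s).eventually (Metric.ball_mem_nhds _ hε)
        exact this)
    refine ⟨t.card, t, rfl, fun x => ?_⟩
    have := ht (Set.mem_univ x)
    simp only [Set.mem_iUnion] at this
    obtain ⟨s, hs, h⟩ := this
    exact ⟨s, hs, fun j hj => h j (Finset.mem_range.mpr hj)⟩
  exact Nat.sInf_mem hne

lemma norm_mk_local {k : ℕ} (Λ : AddSubgroup (Fin k → ℂ)) [DiscreteTopology Λ] :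
    ∃ r : ℝ, 0 < r ∧ ∀ z : Fin k → ℂ, ‖z‖ < r →
      ‖(QuotientAddGroup.mk z : (Fin k → ℂ) ⧸ Λ)‖ = ‖z‖ := by
  obtain ⟨ρ, hρ, h⟩ := Metric.isOpen_iff.mp (isOpen_discrete ({0} : Set Λ)) 0 rfl
  refine ⟨ρ/2, by positivity, fun z hz => le_antisymm QuotientAddGroup.norm_mk_le_norm ?_⟩
  rw [QuotientAddGroup.le_norm_iff]
  intro m hm
  have hmem : -m + z ∈ Λ := QuotientAddGroup.eq.mp hm
  by_cases hlt : ‖-m + z‖ < ρ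
  · have h1 : (⟨_, hmem⟩ : Λ) ∈ ({0} : Set Λ) := h (by
      rw [Metric.mem_ball, dist_zero_right]; exact hlt)
    have h2 : -m + z = 0 := congrArg Subtype.val h1
    have : z = m := by rw [neg_add_eq_zero] at h2; exact h2.symm
    rw [this]
  · have := norm_add_le (-m) z
    rw [norm_neg] at this
    linarith

lemma eig_le_one {k : ℕ} {Λ : AddSubgroup (Fin k → ℂ)}
    [DiscreteTopology Λ] [CompactSpace ((Fin k → ℂ) ⧸ Λ)]
    (A : (Fin k → ℂ) ≃ₗ[ℂ] (Fin k → ℂ)) (B : Fin k → ℂ)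
    (f : ((Fin k → ℂ) ⧸ Λ) → ((Fin k → ℂ) ⧸ Λ))
    (hf : ∀ z : Fin k → ℂ, f (QuotientAddGroup.mk z) = QuotientAddGroup.mk (A z + B))
    (h0 : htop f = 0) (μ : ℂ) (v₀ : Fin k → ℂ) (hv₀ : v₀ ≠ 0) (hAv₀ : A v₀ = μ • v₀) :
    ‖μ‖ ≤ 1 := by
  by_contra hlt
  push Not at hlt
  set L := ‖μ‖ with hL
  have hL0 : 0 < L := by linarith
  obtain ⟨v, hv1, hAv⟩ : ∃ v : Fin k → ℂ, ‖v‖ = 1 ∧ A v = μ • v := by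
    refine ⟨((‖v₀‖⁻¹ : ℝ) : ℂ) • v₀, ?_, ?_⟩
    · rw [norm_smul, Complex.norm_real, norm_inv, norm_norm]
      exact inv_mul_cancel₀ (norm_ne_zero_iff.mpr hv₀)
    · rw [map_smul, hAv₀, smul_comm]
  have hAj : ∀ (j : ℕ) (u : ℂ), (A.toLinearMap)^[j] (u • v) = (μ^j * u) • v := by
    intro j
    induction j with
    | zero => simp
    | succ j ih =>
      intro u
      rw [Function.iterate_succ_apply]
      have : A.toLinearMap (u • v) = (u * μ) • v := by
        simp [hAv, smul_smul]
      rw [this, ih]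
      ring_nf
  obtain ⟨r, hr, hloc⟩ := norm_mk_local Λ
  set ε := r / (2*L) with hε
  have hε0 : 0 < ε := by positivity
  have hεL : 2*ε*L = r := by rw [hε]; field_simp
  have hεr : 2*ε < r := by nlinarith
  have hexp : ∀ (n : ℕ) (u : ℂ), ‖u‖ < 2*ε →
      (∀ j < n, ‖(QuotientAddGroup.mk ((A.toLinearMap)^[j] (u • v)) : (Fin k → ℂ) ⧸ Λ)‖ < 2*ε) →
      ∀ j < n, L^j * ‖u‖ < 2*ε := by
    intro n u hu h j
    induction j with
    | zero => intro _; simpa using hu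
    | succ j ih =>
      intro hj
      have h1 := ih (by omega)
      have h2 : ‖(A.toLinearMap)^[j+1] (u • v)‖ = L^(j+1) * ‖u‖ := by
        rw [hAj, norm_smul, hv1, norm_mul, norm_pow, mul_one]
      have h3 : L^(j+1) * ‖u‖ < r := by
        rw [pow_succ, ← hεL]
        nlinarith
      have h4 := h (j+1) hj
      rw [hloc _ (by rw [h2]; exact h3), h2] at h4
      exact h4
  have hlow : ∀ m : ℕ, L^m / 2 ≤ covNum f ε (m+1) := by
    intro m
    obtain ⟨S, hS, hcov⟩ := cover_exists f (f_cont A B f hf) ε hε0 (m+1)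
    have hLm : 1 ≤ L^m := one_le_pow₀ hlt.le
    set N := ⌊L^m⌋₊ with hN
    have hN1 : (N:ℝ) ≤ L^m := Nat.floor_le (by positivity)
    let t : ℕ → ℂ := fun i => ((2*ε*i/L^m : ℝ) : ℂ)
    choose s hsS hs using fun i : ℕ => hcov (QuotientAddGroup.mk (t i • v))
    have hcard : N ≤ S.card := by
      rw [← Finset.card_range N]
      refine Finset.card_le_card_of_injOn s (fun i _ => hsS i) ?_
      intro i hi l hl hil
      simp only [Finset.coe_range, Set.mem_Iio] at hi hl
      by_contra hne
      have hnorm : ‖t i - t l‖ = 2*ε*|(i:ℝ)-l|/L^m := by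
        simp only [t]
        rw [← Complex.ofReal_sub, Complex.norm_real, Real.norm_eq_abs,
          show 2*ε*i/L^m - 2*ε*l/L^m = (2*ε/L^m) * ((i:ℝ)-l) by ring, abs_mul,
          abs_of_pos (by positivity)]
        ring
      have hi' : (i:ℝ) < N := by exact_mod_cast hi
      have hl' : (l:ℝ) < N := by exact_mod_cast hl
      have habs : |(i:ℝ)-l| < L^m := by
        rw [abs_lt]
        constructor <;> linarith [Nat.cast_nonneg (α := ℝ) i, Nat.cast_nonneg (α := ℝ) l]
      have habs1 : 1 ≤ |(i:ℝ)-l| := by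
        have : (1:ℤ) ≤ |(i:ℤ)-l| := Int.one_le_abs (by omega)
        exact_mod_cast this
      have hu : ‖t i - t l‖ < 2*ε := by
        rw [hnorm, div_lt_iff₀ (by positivity)]
        gcongr
      have := hexp (m+1) (t i - t l) hu (by
        intro j hj
        have h1 := hs i j hj
        have h2 := hs l j hj
        rw [← hil] at h2
        rw [sub_smul, ← iter_dist A B f hf]
        have := dist_triangle_right (f^[j] (QuotientAddGroup.mk (t i • v))) (f^[j] (QuotientAddGroup.mk (t l • v))) (f^[j] (s i))
        linarith) m (by omega)
      rw [hnorm, mul_div_cancel₀ _ (by positivity)] at this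
      nlinarith
    rw [← hS]
    have h1 : (N:ℝ) ≤ S.card := by exact_mod_cast hcard
    have h2 : L^m < N + 1 := Nat.lt_floor_add_one _
    have h3 : (1:ℝ) ≤ N := by
      have : 1 ≤ N := Nat.le_floor (by simpa using hLm)
      exact_mod_cast this
    linarith
  have hlogL : 0 < Real.log L := Real.log_pos hlt
  have hle : ENNReal.ofReal (Real.log L / 2) ≤ htop f := by
    unfold htop
    refine le_trans ?_ (le_iSup₂ ε hε0)
    refine Filter.le_limsup_of_frequently_le (Filter.Eventually.frequently ?_)
    obtain ⟨M, hM⟩ := exists_nat_gt (2 * Real.log 2 / Real.log L)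
    filter_upwards [Filter.eventually_ge_atTop (M+2)] with n hn
    obtain ⟨m, rfl⟩ : ∃ m, n = m + 1 := ⟨n-1, by omega⟩
    apply ENNReal.ofReal_le_ofReal
    have h1 : Real.log (L^m/2) ≤ Real.log (covNum f ε (m+1)) :=
      Real.log_le_log (by positivity) (hlow m)
    rw [Real.log_div (by positivity) (by norm_num), Real.log_pow] at h1
    have hmM : (M:ℝ) + 1 ≤ m := by exact_mod_cast (by omega : M + 1 ≤ m)
    rw [div_lt_iff₀ hlogL] at hM
    rw [le_div_iff₀ (by positivity)]
    push_cast
    nlinarith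
  rw [h0] at hle
  have := ENNReal.ofReal_pos.mpr (half_pos hlogL)
  exact absurd (lt_of_lt_of_le this hle) (lt_irrefl _)

lemma cov_upper {k : ℕ} {Λ : AddSubgroup (Fin k → ℂ)}
    [CompactSpace ((Fin k → ℂ) ⧸ Λ)]
    (A : (Fin k → ℂ) ≃ₗ[ℂ] (Fin k → ℂ)) (B : Fin k → ℂ)
    (f : ((Fin k → ℂ) ⧸ Λ) → ((Fin k → ℂ) ⧸ Λ))
    (hf : ∀ z : Fin k → ℂ, f (QuotientAddGroup.mk z) = QuotientAddGroup.mk (A z + B))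
    (hA : ∀ (μ : ℂ) (v : Fin k → ℂ), v ≠ 0 → A v = μ • v → ‖μ‖ ≤ 1) (ε : ℝ) (hε : 0 < ε) :
    ∃ K : ℝ, 1 ≤ K ∧ ∀ n : ℕ, 1 ≤ n → (covNum f ε n : ℝ) ≤ K * (n:ℝ)^(k*(k-1)) := by
  classical
  obtain ⟨b, hb, -, C, hC0, hC⟩ := exists_triang A.toLinearMap hA k (by simp)
  let bas := Module.Basis.mk hb (hb.span_eq_top_of_card_eq_finrank' (by simp)).ge
  have hbas : ∀ i, bas i = b i := fun i => by simp [bas]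
  obtain ⟨M, hM⟩ := (isCompact_univ (X := (Fin k → ℂ) ⧸ Λ)).isBounded.exists_norm_le
  have hrep : ∀ x : (Fin k → ℂ) ⧸ Λ, ∃ z : Fin k → ℂ, QuotientAddGroup.mk z = x ∧ ‖z‖ ≤ M + 1 := by
    intro x
    obtain ⟨z, hz, hz'⟩ := QuotientAddGroup.exists_norm_mk_lt x one_pos
    exact ⟨z, hz, by linarith [hM x (Set.mem_univ x)]⟩
  have hM0 : 0 ≤ M := (norm_nonneg _).trans (hM 0 (Set.mem_univ _))
  set R := ‖(bas.equivFunL : (Fin k → ℂ) →L[ℂ] (Fin k → ℂ))‖ * (M+1) with hR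
  have hR0 : 0 ≤ R := by positivity
  have hcoord : ∀ z : Fin k → ℂ, ‖z‖ ≤ M+1 → ∀ i, ‖bas.equivFun z i‖ ≤ R := by
    intro z hz i
    have h1 : ‖(bas.equivFunL : (Fin k → ℂ) →L[ℂ] (Fin k → ℂ)) z‖ ≤ R :=
      (ContinuousLinearMap.le_opNorm _ _).trans (by rw [hR]; gcongr)
    exact (norm_le_pi_norm _ i).trans h1
  set η := ε / (2*k*C + 1 + ε) with hη
  have hη0 : 0 < η := by positivity
  have hη1 : η ≤ 1 := by
    rw [hη, div_le_one (by positivity)]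
    have : 0 ≤ 2*(k:ℝ)*C := by positivity
    linarith
  have hηε : 2*k*C*η < ε := by
    rw [hη, mul_div_assoc', div_lt_iff₀ (by positivity)]
    nlinarith
  have hQ : 1 ≤ (2*R+5)/η := by rw [le_div_iff₀ hη0]; linarith
  refine ⟨(((2*R+5)/η)^2)^k, one_le_pow₀ (one_le_pow₀ hQ), fun n hn => ?_⟩
  have hn1 : (1:ℝ) ≤ n := by exact_mod_cast hn
  have hn0 : (0:ℝ) < n := by linarith
  choose G hGc hG using fun i : Fin k => exists_grid R hR0 (η / (n:ℝ)^(i:ℕ)) (by positivity)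
    ((div_le_self hη0.le (one_le_pow₀ hn1)).trans hη1)
  let S : Finset ((Fin k → ℂ) ⧸ Λ) := (Fintype.piFinset G).image
    (fun g => QuotientAddGroup.mk (∑ i, g i • b i))
  have hScov : ∀ x, ∃ s ∈ S, ∀ j < n, dist (f^[j] x) (f^[j] s) < ε := by
    intro x
    obtain ⟨z, rfl, hz⟩ := hrep x
    choose g hg hgd using fun i => hG i (bas.equivFun z i) (hcoord z hz i)
    refine ⟨_, Finset.mem_image_of_mem _ (Fintype.mem_piFinset.mpr hg), fun j hj => ?_⟩
    rw [iter_dist A B f hf]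
    refine lt_of_le_of_lt QuotientAddGroup.norm_mk_le_norm ?_
    have e : z - ∑ i, g i • b i = ∑ i, (bas.equivFun z i - g i) • b i := by
      simp only [sub_smul, Finset.sum_sub_distrib]
      congr 1
      rw [← bas.sum_equivFun z]
      simp only [hbas, map_sum]
      conv_lhs => rw [← bas.sum_equivFun z]
      simp [hbas]
    have hpow : ((A.toLinearMap)^[j] : (Fin k → ℂ) → (Fin k → ℂ)) = ⇑((A.toLinearMap : Module.End ℂ (Fin k → ℂ))^j) :=
      (Module.End.coe_pow _ j).symm
    rw [e, hpow, map_sum]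
    refine lt_of_le_of_lt (norm_sum_le _ _) (lt_of_le_of_lt ?_ hηε)
    have : ∀ i ∈ (Finset.univ : Finset (Fin k)),
        ‖((A.toLinearMap : Module.End ℂ (Fin k → ℂ))^j) ((bas.equivFun z i - g i) • b i)‖ ≤ 2*C*η := by
      intro i _
      rw [map_smul, norm_smul, ← hpow]
      have hj1 : (j:ℝ)+1 ≤ n := by exact_mod_cast hj
      calc _ ≤ (2*(η / (n:ℝ)^(i:ℕ))) * (C * ((j:ℝ)+1)^(i:ℕ)) := by
            gcongr
            · exact hgd i
            · exact hC i j
        _ ≤ (2*(η / (n:ℝ)^(i:ℕ))) * (C * (n:ℝ)^(i:ℕ)) := by gcongr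
        _ = 2*C*η := by field_simp
    refine (Finset.sum_le_sum this).trans ?_
    simp
    linarith
  have h1 : covNum f ε n ≤ S.card := Nat.sInf_le ⟨S, rfl, hScov⟩
  have h2 : S.card ≤ ∏ i, (G i).card := by
    rw [← Fintype.card_piFinset]; exact Finset.card_image_le
  calc (covNum f ε n : ℝ) ≤ ((∏ i, (G i).card : ℕ) : ℝ) := by exact_mod_cast h1.trans h2
    _ = ∏ i, ((G i).card : ℝ) := by push_cast; rfl
    _ ≤ ∏ i : Fin k, (((2*R+5)/η)^2 * (n:ℝ)^((i:ℕ)*2)) := by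
        refine Finset.prod_le_prod (fun _ _ => by positivity) fun i _ => ?_
        refine (hGc i).trans (le_of_eq ?_)
        rw [pow_mul, ← mul_pow]
        congr 1
        field_simp
    _ = _ := by
        rw [Finset.prod_mul_distrib, Finset.prod_const, Finset.prod_pow_eq_pow_sum, ← Finset.sum_mul,
          Fin.sum_univ_eq_sum_range (fun i => i) k, Finset.sum_range_id_mul_two]
        simp

theorem hpol_torus_automorphism_le (k : ℕ) (Λ : AddSubgroup (Fin k → ℂ))
    [DiscreteTopology Λ] [CompactSpace ((Fin k → ℂ) ⧸ Λ)]
    (A : (Fin k → ℂ) ≃ₗ[ℂ] (Fin k → ℂ)) (hA : ∀ z : Fin k → ℂ, z ∈ Λ ↔ A z ∈ Λ)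
    (B : Fin k → ℂ)
    (f : ((Fin k → ℂ) ⧸ Λ) → ((Fin k → ℂ) ⧸ Λ))
    (hf : ∀ z : Fin k → ℂ, f (QuotientAddGroup.mk z) = QuotientAddGroup.mk (A z + B))
    (h0 : htop f = 0) :
    hpol f ≤ ((k * (k - 1) : ℕ) : ℝ≥0∞) := by
  have hev : ∀ (μ : ℂ) (v : Fin k → ℂ), v ≠ 0 → A v = μ • v → ‖μ‖ ≤ 1 :=
    fun μ v hv h => eig_le_one A B f hf h0 μ v hv h
  unfold hpol
  refine iSup₂_le fun ε hε => ?_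
  obtain ⟨K, hK1, hK⟩ := cov_upper A B f hf hev ε hε
  set d := k * (k - 1) with hd
  have hlog : Tendsto (fun n : ℕ => Real.log n) atTop atTop :=
    Real.tendsto_log_atTop.comp tendsto_natCast_atTop_atTop
  have ht : Tendsto (fun n : ℕ => ENNReal.ofReal (Real.log K / Real.log n + d)) atTop
      (𝓝 (d : ℝ≥0∞)) := by
    have h1 : Tendsto (fun n : ℕ => Real.log K / Real.log n + d) atTop (𝓝 (0 + (d:ℝ))) :=
      (hlog.const_div_atTop _).add tendsto_const_nhds
    rw [zero_add] at h1
    have h2 := (ENNReal.continuous_ofReal.tendsto _).comp h1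
    rwa [ENNReal.ofReal_natCast] at h2
  rw [← ht.limsup_eq]
  refine Filter.limsup_le_limsup ?_
  filter_upwards [Filter.eventually_ge_atTop 2] with n hn
  apply ENNReal.ofReal_le_ofReal
  have hn2 : (2:ℝ) ≤ n := by exact_mod_cast hn
  have hl : 0 < Real.log n := Real.log_pos (by linarith)
  have hlK : 0 ≤ Real.log K := Real.log_nonneg hK1
  rw [div_le_iff₀ hl, add_mul, div_mul_cancel₀ _ hl.ne']
  rcases Nat.eq_zero_or_pos (covNum f ε n) with h | h
  · rw [h]
    simp only [Nat.cast_zero, Real.log_zero]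
    positivity
  · have h' : (0:ℝ) < covNum f ε n := by exact_mod_cast h
    have := Real.log_le_log h' (hK n (by omega))
    rwa [Real.log_mul (by positivity) (by positivity), Real.log_pow] at this
end

section
/- Let Λ be a lattice in ℂ^k (a discrete additive subgroup such that X = ℂ^k/Λ is compact), let A ∈ GL_k(ℂ) be a ℂ-linear automorphism with A(Λ) = Λ, and let B ∈ ℂ^k. Let f be the automorphism of the complex torus X = ℂ^k/Λ induced by z ↦ A z + B. If the topological entropy of f is zero, then hpol(f) ≤ k². -/
open Filter Topology Metric
open scoped ENNReal

variable {X : Type*}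

theorem tri_basis : ∀ (n : ℕ) (V : Type) [AddCommGroup V] [Module ℂ V] [FiniteDimensional ℂ V]
    (A : V →ₗ[ℂ] V), Module.finrank ℂ V = n →
    (∀ (c : ℂ) (v : V), v ≠ 0 → A v = c • v → ‖c‖ ≤ 1) →
    ∃ b : Module.Basis (Fin n) ℂ V, (∀ i j, i < j → b.repr (A (b j)) i = 0) ∧
      ∀ i, ‖b.repr (A (b i)) i‖ ≤ 1 := by
  intro n
  induction n with
  | zero =>
    intro V _ _ _ A hn _
    exact ⟨Module.finBasisOfFinrankEq ℂ V hn, fun i => i.elim0, fun i => i.elim0⟩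
  | succ n ih =>
    intro V _ _ _ A hn hA
    have : Nontrivial V := Module.nontrivial_of_finrank_pos (R := ℂ) (by omega)
    obtain ⟨c, hc⟩ := Module.End.exists_eigenvalue A
    obtain ⟨v, hv⟩ := hc.exists_hasEigenvector
    have hvA : A v = c • v := hv.apply_eq_smul
    have hcle : ‖c‖ ≤ 1 := hA c v hv.2 hvA
    have hlt : LinearMap.range (A - c • LinearMap.id) < ⊤ := by
      rw [lt_top_iff_ne_top]
      intro h
      have hinj := LinearMap.injective_iff_surjective.2 (LinearMap.range_eq_top.1 h)
      apply hv.2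
      apply hinj
      simp [hvA]
    obtain ⟨φ, hφ, hle⟩ := Submodule.exists_le_ker_of_lt_top _ hlt
    have hφA : ∀ z, φ (A z) = c * φ z := by
      intro z
      have := hle (LinearMap.mem_range_self (A - c • LinearMap.id) z)
      simp [sub_eq_zero] at this
      exact this
    set H := LinearMap.ker φ with hH
    have hinv : ∀ x ∈ H, A x ∈ H := by
      intro x hx
      rw [hH, LinearMap.mem_ker] at *
      rw [hφA, hx, mul_zero]
    obtain ⟨y, hy⟩ : ∃ y, φ y ≠ 0 := by
      by_contra! h
      exact hφ (LinearMap.ext h)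
    have hfr : Module.finrank ℂ H = n := by
      have h1 := LinearMap.finrank_range_add_finrank_ker φ
      have h2 : LinearMap.range φ = ⊤ := LinearMap.range_eq_top.2 (LinearMap.surjective hφ)
      rw [h2, finrank_top, Module.finrank_self, hn] at h1
      change 1 + Module.finrank ℂ H = n + 1 at h1
      omega
    obtain ⟨b', hb1, hb2⟩ := ih H (A.restrict hinv) hfr (by
      intro d w hw hd
      refine hA d w (by simpa using hw) ?_
      simpa using congrArg Subtype.val hd)
    have hli : ∀ (c : ℂ), ∀ x ∈ H, c • y + x = 0 → c = 0 := by
      intro d x hx h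
      have := congrArg φ h
      rw [map_add, map_smul, LinearMap.mem_ker.1 hx] at this
      simpa [hy] using this
    have hsp : ∀ z : V, ∃ c : ℂ, z + c • y ∈ H := by
      intro z
      refine ⟨-(φ z / φ y), ?_⟩
      rw [hH, LinearMap.mem_ker]
      simp [hy]
    let b := Module.Basis.mkFinCons y b' hli hsp
    have hb : ⇑b = Fin.cons y (((↑) : H → V) ∘ b') := Module.Basis.coe_mkFinCons _ _ _ _
    have hb0 : b 0 = y := by rw [hb]; rfl
    have hbs : ∀ i, b (Fin.succ i) = b' i := by intro i; rw [hb]; rfl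
    have hrepr : ∀ h : H, ∀ i, b.repr h i = (Fin.cons 0 (b'.repr h) : Fin (n+1) → ℂ) i := by
      intro h
      have : (h : V) = ∑ i, (Fin.cons 0 (b'.repr h) : Fin (n+1) → ℂ) i • b i := by
        rw [Fin.sum_univ_succ]
        simp only [Fin.cons_zero, Fin.cons_succ, hbs, zero_smul, zero_add]
        have := congrArg Subtype.val (b'.sum_repr h)
        rw [← this, AddSubmonoidClass.coe_finsetSum]
        rfl
      intro i
      conv_lhs => rw [this]
      rw [Module.Basis.repr_sum_self]
    have hAs : ∀ j i, b.repr (A (b (Fin.succ j))) i =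
        (Fin.cons 0 (b'.repr (A.restrict hinv (b' j))) : Fin (n+1) → ℂ) i := by
      intro j i
      rw [← hrepr, hbs]
      rfl
    have hA0 : b.repr (A (b 0)) 0 = c := by
      have hm : A y - c • y ∈ H := by
        rw [hH, LinearMap.mem_ker]; simp [hφA]
      have : A (b 0) = c • b 0 + ((⟨_, hm⟩ : H) : V) := by rw [hb0]; simp
      rw [this, map_add, Finsupp.add_apply, hrepr]
      simp
    refine ⟨b, ?_, ?_⟩
    · intro i j hij
      obtain ⟨j, rfl⟩ := Fin.exists_succ_eq.2 (Fin.ne_zero_of_lt hij)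
      rw [hAs]
      rcases Fin.eq_zero_or_eq_succ i with rfl | ⟨i, rfl⟩
      · simp
      · simpa using hb1 i j (by simpa using hij)
    · intro i
      refine Fin.cases ?_ (fun i => ?_) i
      · rw [hA0]; exact hcle
      · rw [hAs]; simpa using hb2 i

theorem disc_cover (R δ T : ℝ) (hR : 0 ≤ R) (hδ : 0 < δ) (hT : 1 ≤ T) :
    ∃ S : Finset ℂ, (S.card : ℝ) ≤ ((4 * R / δ + 3) * T) ^ 2 ∧
      ∀ c : ℂ, ‖c‖ ≤ R → ∃ s ∈ S, T * ‖c - s‖ ≤ δ := by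
  classical
  have hT0 : 0 < T := by linarith
  set h : ℝ := δ / (2 * T) with hh
  have hpos : 0 < h := by positivity
  set M : ℕ := ⌈R / h⌉₊ with hM
  let I : Finset ℤ := Finset.Icc (-(M : ℤ)) M
  have hI : (I.card : ℝ) ≤ (4 * R / δ + 3) * T := by
    have h1 : I.card = 2 * M + 1 := by
      simp only [I, Int.card_Icc]; omega
    rw [h1]
    have h2 : (M : ℝ) < R / h + 1 := Nat.ceil_lt_add_one (by positivity)
    have h3 : R / h = 2 * R / δ * T := by rw [hh]; field_simp
    push_cast
    rw [h3] at h2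
    have : (4 * R / δ + 3) * T = 2 * (2 * R / δ * T) + 3 * T := by ring
    rw [this]
    linarith
  have key : ∀ x : ℝ, |x| ≤ R → ⌊x / h⌋ ∈ I ∧ |x - ⌊x / h⌋ * h| ≤ h := by
    intro x hx
    have h0 : R / h ≤ M := Nat.le_ceil _
    have hx' := abs_le.1 hx
    have e1 : x / h ≤ R / h := by gcongr; exact hx'.2
    have e2 : -(R / h) ≤ x / h := by rw [← neg_div]; gcongr; exact hx'.1
    refine ⟨?_, ?_⟩
    · simp only [I, Finset.mem_Icc]
      constructor
      · rw [Int.le_floor]; push_cast; linarith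
      · have : (⌊x / h⌋ : ℝ) ≤ M := (Int.floor_le _).trans (e1.trans h0)
        exact_mod_cast this
    · have f1 := Int.floor_le (x / h)
      have f2 := Int.lt_floor_add_one (x / h)
      rw [le_div_iff₀ hpos] at f1
      rw [div_lt_iff₀ hpos] at f2
      rw [abs_le]
      constructor <;> linarith
  refine ⟨(I ×ˢ I).image (fun p => ⟨p.1 * h, p.2 * h⟩), ?_, ?_⟩
  · calc _ ≤ ((I ×ˢ I).card : ℝ) := by exact_mod_cast Finset.card_image_le
      _ = (I.card : ℝ) ^ 2 := by rw [Finset.card_product]; push_cast; ring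
      _ ≤ _ := by gcongr
  · intro c hc
    obtain ⟨a1, a2⟩ := key c.re ((Complex.abs_re_le_norm c).trans hc)
    obtain ⟨b1, b2⟩ := key c.im ((Complex.abs_im_le_norm c).trans hc)
    refine ⟨⟨⌊c.re / h⌋ * h, ⌊c.im / h⌋ * h⟩, Finset.mem_image.2
      ⟨(⌊c.re / h⌋, ⌊c.im / h⌋), Finset.mk_mem_product a1 b1, rfl⟩, ?_⟩
    have : ‖c - ⟨⌊c.re / h⌋ * h, ⌊c.im / h⌋ * h⟩‖ ≤ h + h := by
      refine (Complex.norm_le_abs_re_add_abs_im _).trans ?_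
      simp only [Complex.sub_re, Complex.sub_im]
      exact add_le_add a2 b2
    calc _ ≤ T * (h + h) := by gcongr
      _ = δ := by rw [hh]; field_simp; norm_num

theorem weighted_step {k : ℕ} {V : Type*} [AddCommGroup V] [Module ℂ V] (A : V →ₗ[ℂ] V)
    (b : Module.Basis (Fin k) ℂ V) (h1 : ∀ i j, i < j → b.repr (A (b j)) i = 0)
    (h2 : ∀ i, ‖b.repr (A (b i)) i‖ ≤ 1) (K : ℝ)
    (hK : K = 1 + ∑ i, ∑ j, ‖b.repr (A (b j)) i‖) (n : ℕ) (hn : 1 ≤ n) (δ : ℝ)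
    (z : V) (hz : ∀ i : Fin k, (n * K) ^ (i.rev : ℕ) * ‖b.repr z i‖ ≤ δ) (i : Fin k) :
    (n * K) ^ (i.rev : ℕ) * ‖b.repr (A z) i‖ ≤ (1 + 1 / n) * δ := by
  have hK1 : 1 ≤ K := by
    rw [hK]
    have : 0 ≤ ∑ i, ∑ j, ‖b.repr (A (b j)) i‖ := by positivity
    linarith
  have hn' : (1 : ℝ) ≤ n := by exact_mod_cast hn
  set L : ℝ := n * K with hL
  have hL1 : 1 ≤ L := one_le_mul_of_one_le_of_one_le hn' hK1
  have hL0 : 0 < L := by linarith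
  have hδ : 0 ≤ δ := le_trans (by positivity) (hz i)
  have hrep : b.repr (A z) i = ∑ j, b.repr z j * b.repr (A (b j)) i := by
    conv_lhs => rw [← b.sum_repr z]
    rw [map_sum, map_sum, Finsupp.finsetSum_apply]
    simp only [map_smul, Finsupp.smul_apply, smul_eq_mul]
  have hterm : ∀ j, L ^ (i.rev : ℕ) * ‖b.repr z j * b.repr (A (b j)) i‖ ≤
      (if j = i then δ else 0) + δ * ‖b.repr (A (b j)) i‖ / L := by
    intro j
    rw [norm_mul]
    rcases lt_trichotomy i j with h | h | h
    · rw [h1 i j h]; simp; split_ifs <;> simp [hδ]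
    · subst h
      have : 0 ≤ δ * ‖b.repr (A (b i)) i‖ / L := by positivity
      rw [if_pos rfl, ← mul_assoc]
      have := mul_le_mul (hz i) (h2 i) (norm_nonneg _) hδ
      linarith
    · rw [if_neg h.ne, zero_add, le_div_iff₀ hL0]
      have hlt : (i.rev : ℕ) + 1 ≤ (j.rev : ℕ) := by
        have := Fin.rev_lt_rev.2 h
        exact this
      calc _ = (L ^ ((i.rev : ℕ) + 1) * ‖b.repr z j‖) * ‖b.repr (A (b j)) i‖ := by ring
        _ ≤ (L ^ (j.rev : ℕ) * ‖b.repr z j‖) * ‖b.repr (A (b j)) i‖ := by gcongr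
        _ ≤ δ * ‖b.repr (A (b j)) i‖ := by gcongr; exact hz j
  have hrow : ∑ j, ‖b.repr (A (b j)) i‖ ≤ K := by
    have := Finset.single_le_sum (f := fun i => ∑ j, ‖b.repr (A (b j)) i‖)
      (fun i _ => by positivity) (Finset.mem_univ i)
    rw [hK]
    linarith
  calc _ ≤ L ^ (i.rev : ℕ) * ∑ j, ‖b.repr z j * b.repr (A (b j)) i‖ := by
        rw [hrep]; gcongr; exact norm_sum_le _ _
    _ = ∑ j, L ^ (i.rev : ℕ) * ‖b.repr z j * b.repr (A (b j)) i‖ := by rw [Finset.mul_sum]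
    _ ≤ ∑ j, ((if j = i then δ else 0) + δ * ‖b.repr (A (b j)) i‖ / L) :=
        Finset.sum_le_sum fun j _ => hterm j
    _ = δ + δ * (∑ j, ‖b.repr (A (b j)) i‖) / L := by
        rw [Finset.sum_add_distrib, Finset.sum_ite_eq' , if_pos (Finset.mem_univ _),
          Finset.mul_sum, Finset.sum_div]
    _ ≤ δ + δ * K / L := by gcongr
    _ = (1 + 1 / n) * δ := by
        have : K ≠ 0 := by linarith
        have : (n : ℝ) ≠ 0 := by linarith
        rw [hL]; field_simp; try ring

theorem linear_cover (k : ℕ) (A : (Fin k → ℂ) →ₗ[ℂ] (Fin k → ℂ))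
    (hA : ∀ (c : ℂ) (v : Fin k → ℂ), v ≠ 0 → A v = c • v → ‖c‖ ≤ 1)
    (R ε : ℝ) (hR : 0 ≤ R) (hε : 0 < ε) :
    ∃ C : ℝ, 1 ≤ C ∧ ∀ n : ℕ, 1 ≤ n → ∃ S : Finset (Fin k → ℂ),
      (S.card : ℝ) ≤ C * (n : ℝ) ^ (k ^ 2) ∧
      ∀ z, ‖z‖ ≤ R → ∃ s ∈ S, ∀ j < n, ‖(A ^ j) (z - s)‖ < ε := by
  classical
  obtain ⟨b, h1, h2⟩ := tri_basis k (Fin k → ℂ) A (by simp) hA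
  obtain ⟨K, hK⟩ : ∃ K : ℝ, K = 1 + ∑ i, ∑ j, ‖b.repr (A (b j)) i‖ := ⟨_, rfl⟩
  have hK1 : 1 ≤ K := by
    rw [hK]
    have : 0 ≤ ∑ i, ∑ j, ‖b.repr (A (b j)) i‖ := by positivity
    linarith
  obtain ⟨Cb, hCb⟩ : ∃ Cb : ℝ, Cb = 1 + ∑ i, ‖b i‖ := ⟨_, rfl⟩
  have hCb1 : 1 ≤ Cb := by
    rw [hCb]
    have : 0 ≤ ∑ i, ‖b i‖ := by positivity
    linarith
  obtain ⟨D, hD0, hD⟩ : ∃ D : ℝ, 0 ≤ D ∧ ∀ z i, ‖b.repr z i‖ ≤ D * ‖z‖ := by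
    refine ⟨‖LinearMap.toContinuousLinearMap (b.equivFun : (Fin k → ℂ) →ₗ[ℂ] (Fin k → ℂ))‖,
      norm_nonneg _, fun z i => ?_⟩
    refine le_trans ?_ (ContinuousLinearMap.le_opNorm _ _)
    exact norm_le_pi_norm (b.equivFun z) i
  set δ : ℝ := ε / (4 * Cb) with hδ
  have hδ0 : 0 < δ := by positivity
  set C0 : ℝ := 4 * (D * R) / δ + 3 with hC0
  have hC01 : 1 ≤ C0 := by
    have : 0 ≤ 4 * (D * R) / δ := by positivity
    linarith
  refine ⟨∏ i : Fin k, (C0 * K ^ (i.rev : ℕ)) ^ 2, ?_, ?_⟩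
  · refine Finset.prod_induction _ (fun x => (1 : ℝ) ≤ x)
      (fun _ _ => one_le_mul_of_one_le_of_one_le) le_rfl fun i _ => ?_
    exact one_le_pow₀ (one_le_mul_of_one_le_of_one_le hC01 (one_le_pow₀ hK1))
  intro n hn
  have hn' : (1 : ℝ) ≤ n := by exact_mod_cast hn
  have hL1 : 1 ≤ n * K := one_le_mul_of_one_le_of_one_le hn' hK1
  choose G hG1 hG2 using fun i : Fin k =>
    disc_cover (D * R) δ ((n * K) ^ (i.rev : ℕ)) (by positivity) hδ0 (one_le_pow₀ hL1)
  refine ⟨(Fintype.piFinset G).image b.equivFun.symm, ?_, ?_⟩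
  · calc (((Fintype.piFinset G).image b.equivFun.symm).card : ℝ)
        ≤ ((Fintype.piFinset G).card : ℝ) := by exact_mod_cast Finset.card_image_le
      _ = ∏ i, ((G i).card : ℝ) := by rw [Fintype.card_piFinset]; push_cast; rfl
      _ ≤ ∏ i : Fin k, (C0 * (n * K) ^ (i.rev : ℕ)) ^ 2 :=
          Finset.prod_le_prod (fun _ _ => by positivity) fun i _ => hG1 i
      _ = (∏ i : Fin k, (C0 * K ^ (i.rev : ℕ)) ^ 2) * ∏ i : Fin k, (n : ℝ) ^ (2 * (i.rev : ℕ)) := by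
          rw [← Finset.prod_mul_distrib]
          refine Finset.prod_congr rfl fun i _ => ?_
          rw [mul_pow (n : ℝ), pow_mul' (n : ℝ)]; ring
      _ ≤ _ := by
          rw [Finset.prod_pow_eq_pow_sum]
          gcongr
          have e : ∑ i : Fin k, 2 * (i.rev : ℕ) = ∑ i : Fin k, 2 * (i : ℕ) :=
            Equiv.sum_comp Fin.revPerm (fun i : Fin k => 2 * (i : ℕ))
          rw [e, ← Finset.mul_sum, Fin.sum_univ_eq_sum_range (fun i => i), mul_comm,
              Finset.sum_range_id_mul_two, sq]
          exact Nat.mul_le_mul_left _ (Nat.sub_le _ _)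
  · intro z hz
    choose s hs1 hs2 using fun i => hG2 i (b.repr z i)
      ((hD z i).trans (mul_le_mul_of_nonneg_left hz hD0))
    refine ⟨b.equivFun.symm s, Finset.mem_image_of_mem _ (Fintype.mem_piFinset.2 hs1), ?_⟩
    set w := z - b.equivFun.symm s with hw
    have hw0 : ∀ i : Fin k, (n * K) ^ (i.rev : ℕ) * ‖b.repr w i‖ ≤ δ := by
      intro i
      have : b.repr w i = b.repr z i - s i := by
        rw [hw, map_sub, Finsupp.sub_apply, ← Module.Basis.equivFun_apply b (b.equivFun.symm s),
          LinearEquiv.apply_symm_apply]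
      rw [this]; exact hs2 i
    have hwj : ∀ j : ℕ, ∀ i : Fin k, (n * K) ^ (i.rev : ℕ) * ‖b.repr ((A ^ j) w) i‖ ≤
        (1 + 1 / n) ^ j * δ := by
      intro j
      induction j with
      | zero => simpa using hw0
      | succ j ih =>
        intro i
        have := weighted_step A b h1 h2 K hK n hn _ _ ih i
        rw [pow_succ' A, Module.End.mul_apply, pow_succ' (1 + 1 / (n : ℝ)), mul_assoc]
        exact this
    intro j hj
    have he : (1 + 1 / (n : ℝ)) ^ j ≤ 3 := by
      calc (1 + 1 / (n : ℝ)) ^ j ≤ (1 + 1 / (n : ℝ)) ^ n :=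
            pow_le_pow_right₀ (by simp) hj.le
        _ ≤ (Real.exp (1 / n)) ^ n := by
            gcongr; rw [add_comm]; exact Real.add_one_le_exp _
        _ = Real.exp 1 := by
            rw [← Real.exp_nat_mul]; congr 1; field_simp
        _ ≤ 3 := by have := Real.exp_one_lt_d9; linarith
    have hc : ∀ i, ‖b.repr ((A ^ j) w) i‖ ≤ 3 * δ := by
      intro i
      calc ‖b.repr ((A ^ j) w) i‖ ≤ (n * K) ^ (i.rev : ℕ) * ‖b.repr ((A ^ j) w) i‖ :=
            le_mul_of_one_le_left (norm_nonneg _) (one_le_pow₀ hL1)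
        _ ≤ _ := hwj j i
        _ ≤ _ := by gcongr
    calc ‖(A ^ j) w‖ = ‖∑ i, b.repr ((A ^ j) w) i • b i‖ := by rw [b.sum_repr]
      _ ≤ ∑ i, ‖b.repr ((A ^ j) w) i • b i‖ := norm_sum_le _ _
      _ ≤ ∑ i, 3 * δ * ‖b i‖ := by
          refine Finset.sum_le_sum fun i _ => ?_
          rw [norm_smul]; gcongr; exact hc i
      _ = 3 * δ * (Cb - 1) := by rw [← Finset.mul_sum, hCb]; ring
      _ < 4 * δ * Cb := by nlinarith
      _ = ε := by rw [hδ]; field_simp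

theorem covNum_nonempty {X : Type*} [PseudoMetricSpace X] [CompactSpace X] (f : X → X)
    (hf : Continuous f) (ε : ℝ) (hε : 0 < ε) (n : ℕ) :
    {m : ℕ | ∃ S : Finset X, S.card = m ∧
      ∀ x : X, ∃ s ∈ S, ∀ j < n, dist (f^[j] x) (f^[j] s) < ε}.Nonempty := by
  obtain ⟨t, -, ht⟩ := (isCompact_univ (X := X)).elim_nhds_subcover
    (fun s => {x | ∀ j < n, dist (f^[j] x) (f^[j] s) < ε}) (fun s _ => by
      have : ∀ j ∈ Set.Iio n, ∀ᶠ x in 𝓝 s, dist (f^[j] x) (f^[j] s) < ε := fun j _ =>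
        (hf.iterate j).continuousAt.eventually (Metric.ball_mem_nhds _ hε)
      exact (Filter.eventually_all_finite (Set.finite_Iio n)).2 this)
  refine ⟨t.card, t, rfl, fun x => ?_⟩
  have := ht (Set.mem_univ x)
  simpa using this

theorem torus_cont {k : ℕ} {Λ : AddSubgroup (Fin k → ℂ)}
    {A : (Fin k → ℂ) ≃ₗ[ℂ] (Fin k → ℂ)} {B : Fin k → ℂ}
    {f : ((Fin k → ℂ) ⧸ Λ) → ((Fin k → ℂ) ⧸ Λ)}
    (hf : ∀ z : Fin k → ℂ, f (QuotientAddGroup.mk z) = QuotientAddGroup.mk (A z + B)) :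
    Continuous f := by
  have hq : IsQuotientMap (QuotientAddGroup.mk : (Fin k → ℂ) → (Fin k → ℂ) ⧸ Λ) :=
    isQuotientMap_quot_mk
  rw [hq.continuous_iff]
  have : f ∘ QuotientAddGroup.mk = fun z => (QuotientAddGroup.mk (A z + B) : (Fin k → ℂ) ⧸ Λ) :=
    funext hf
  rw [this]
  have hAc : Continuous (A : (Fin k → ℂ) →ₗ[ℂ] (Fin k → ℂ)) :=
    LinearMap.continuous_of_finiteDimensional _
  exact hq.continuous.comp (hAc.add continuous_const)

theorem torus_dist {k : ℕ} {Λ : AddSubgroup (Fin k → ℂ)}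
    {A : (Fin k → ℂ) ≃ₗ[ℂ] (Fin k → ℂ)} {B : Fin k → ℂ}
    {f : ((Fin k → ℂ) ⧸ Λ) → ((Fin k → ℂ) ⧸ Λ)}
    (hf : ∀ z : Fin k → ℂ, f (QuotientAddGroup.mk z) = QuotientAddGroup.mk (A z + B))
    (j : ℕ) (z w : Fin k → ℂ) :
    dist (f^[j] (QuotientAddGroup.mk z)) (f^[j] (QuotientAddGroup.mk w)) =
      ‖(QuotientAddGroup.mk (((A : (Fin k → ℂ) →ₗ[ℂ] (Fin k → ℂ)) ^ j) (z - w)) :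
        (Fin k → ℂ) ⧸ Λ)‖ := by
  induction j generalizing z w with
  | zero => simp [dist_eq_norm]
  | succ j ih =>
    rw [Function.iterate_succ_apply, Function.iterate_succ_apply, hf, hf, ih, pow_succ,
      Module.End.mul_apply]
    simp

theorem eig_le {k : ℕ} {Λ : AddSubgroup (Fin k → ℂ)}
    [DiscreteTopology Λ] [CompactSpace ((Fin k → ℂ) ⧸ Λ)]
    {A : (Fin k → ℂ) ≃ₗ[ℂ] (Fin k → ℂ)} {B : Fin k → ℂ}
    {f : ((Fin k → ℂ) ⧸ Λ) → ((Fin k → ℂ) ⧸ Λ)}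
    (hf : ∀ z : Fin k → ℂ, f (QuotientAddGroup.mk z) = QuotientAddGroup.mk (A z + B))
    (h0 : htop f = 0) (c : ℂ) (v : Fin k → ℂ) (hv : v ≠ 0) (hc : A v = c • v) : ‖c‖ ≤ 1 := by
  by_contra! hc1
  obtain ⟨r, hr, hrΛ⟩ : ∃ r > 0, ∀ m ∈ Λ, ‖m‖ < r → m = 0 := by
    have : ({0} : Set Λ) ∈ 𝓝 (0 : Λ) := by simp
    obtain ⟨r, hr, h⟩ := Metric.mem_nhds_iff.1 this
    refine ⟨r, hr, fun m hm hmr => ?_⟩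
    have : (⟨m, hm⟩ : Λ) ∈ ({0} : Set Λ) := h (by simpa [Subtype.dist_eq] using hmr)
    simpa using this
  have hv0 : 0 < ‖v‖ := norm_pos_iff.2 hv
  set ε : ℝ := r / (‖c‖ + 1) with hε
  have hε0 : 0 < ε := by positivity
  have hεr : ‖c‖ * ε + ε = r := by rw [hε]; field_simp
  have hcε : ε < ‖c‖ * ε := by nlinarith
  have loc : ∀ w : Fin k → ℂ, ‖w‖ < ‖c‖ * ε → ‖(QuotientAddGroup.mk w : (Fin k → ℂ) ⧸ Λ)‖ < ε →
      ‖w‖ < ε := by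
    intro w hw h
    obtain ⟨m, hm, hme⟩ := QuotientAddGroup.norm_lt_iff.1 h
    have hmem : -m + w ∈ Λ := QuotientAddGroup.eq.1 hm
    have : -m + w = 0 := hrΛ _ hmem (by
      calc ‖-m + w‖ ≤ ‖-m‖ + ‖w‖ := norm_add_le _ _
        _ < r := by rw [norm_neg]; linarith)
    have : w = m := by rw [neg_add_eq_zero] at this; exact this.symm
    rw [this]; exact hme
  have hpow : ∀ (j : ℕ) (t : ℂ), ((A : (Fin k → ℂ) →ₗ[ℂ] (Fin k → ℂ)) ^ j) (t • v) =
      (c ^ j * t) • v := by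
    intro j t
    induction j with
    | zero => simp
    | succ j ih =>
      rw [pow_succ', Module.End.mul_apply, ih]
      simp [hc, smul_smul]
      ring_nf
  have exp : ∀ (n : ℕ) (t : ℂ), ‖t • v‖ < ‖c‖ * ε →
      (∀ j < n, ‖(QuotientAddGroup.mk (((A : (Fin k → ℂ) →ₗ[ℂ] (Fin k → ℂ)) ^ j) (t • v)) :
        (Fin k → ℂ) ⧸ Λ)‖ < ε) → ∀ j < n, ‖c‖ ^ j * ‖t • v‖ < ε := by
    intro n t ht h j
    have hnorm : ∀ j : ℕ, ‖((A : (Fin k → ℂ) →ₗ[ℂ] (Fin k → ℂ)) ^ j) (t • v)‖ =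
        ‖c‖ ^ j * ‖t • v‖ := by
      intro j
      rw [hpow, mul_smul, norm_smul, norm_pow]
    induction j with
    | zero =>
      intro hj
      rw [← hnorm]
      exact loc _ (by simpa using ht) (h 0 hj)
    | succ j ih =>
      intro hj
      have := ih (by omega)
      rw [← hnorm]
      refine loc _ ?_ (h _ hj)
      rw [hnorm, pow_succ', mul_assoc]
      gcongr
  have low : ∀ n : ℕ, ‖c‖ ^ n ≤ covNum f (ε / 2) (n + 1) := by
    intro n
    obtain ⟨S, hS1, hS2⟩ := Nat.sInf_mem
      (covNum_nonempty f (torus_cont hf) (ε / 2) (by positivity) (n + 1))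
    change S.card = covNum f (ε / 2) (n + 1) at hS1
    rw [← hS1]
    have hcn : 0 < ‖c‖ ^ n := by positivity
    set τ : ℝ := ε / (‖c‖ ^ n * ‖v‖) with hτ
    have hτ0 : 0 < τ := by positivity
    have hτv : τ * ‖v‖ * ‖c‖ ^ n = ε := by rw [hτ]; field_simp
    set N : ℕ := ⌊‖c‖ ^ n⌋₊ with hN
    choose s hs1 hs2 using fun i : ℕ => hS2 (QuotientAddGroup.mk (((i * τ : ℝ) : ℂ) • v))
    have hNle : (N : ℝ) ≤ ‖c‖ ^ n := Nat.floor_le hcn.le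
    have hinj : ∀ i ∈ Finset.range (N + 1), ∀ i' ∈ Finset.range (N + 1), s i = s i' → i = i' := by
      intro i hi i' hi' hss
      rw [Finset.mem_range] at hi hi'
      have hd : ∀ j < n + 1, dist (f^[j] (QuotientAddGroup.mk (((i * τ : ℝ) : ℂ) • v)))
          (f^[j] (QuotientAddGroup.mk (((i' * τ : ℝ) : ℂ) • v))) < ε := by
        intro j hj
        have e1 := hs2 i j hj
        have e2 := hs2 i' j hj
        rw [← hss] at e2
        have := dist_triangle_right (f^[j] (QuotientAddGroup.mk (((i * τ : ℝ) : ℂ) • v)))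
          (f^[j] (QuotientAddGroup.mk (((i' * τ : ℝ) : ℂ) • v))) (f^[j] (s i))
        linarith
      simp_rw [torus_dist hf, ← sub_smul] at hd
      have hnm : ‖((((i * τ : ℝ) : ℂ)) - ((i' * τ : ℝ) : ℂ)) • v‖ =
          |(i : ℝ) - i'| * (τ * ‖v‖) := by
        rw [norm_smul, ← Complex.ofReal_sub, Complex.norm_real, ← sub_mul, Real.norm_eq_abs,
          abs_mul, abs_of_pos hτ0, mul_assoc]
      have hab : |(i : ℝ) - i'| ≤ ‖c‖ ^ n := by
        have a1 : (i : ℝ) ≤ N := by exact_mod_cast Nat.lt_succ_iff.1 hi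
        have a2 : (i' : ℝ) ≤ N := by exact_mod_cast Nat.lt_succ_iff.1 hi'
        have a3 : (0 : ℝ) ≤ i := by positivity
        have a4 : (0 : ℝ) ≤ i' := by positivity
        rw [abs_le]; constructor <;> linarith
      have := exp (n + 1) _ (by
        rw [hnm]
        calc _ ≤ ‖c‖ ^ n * (τ * ‖v‖) := by gcongr
          _ = ε := by rw [mul_comm]; exact hτv
          _ < _ := hcε) hd n (by omega)
      rw [hnm] at this
      have h3 : |(i : ℝ) - i'| * ε < 1 * ε := by
        calc _ = ‖c‖ ^ n * (|(i : ℝ) - i'| * (τ * ‖v‖)) := by rw [← hτv]; ring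
          _ < _ := by rw [one_mul]; exact this
      have h4 : |(i : ℝ) - i'| < 1 := lt_of_mul_lt_mul_right h3 hε0.le
      have h5 : |(i : ℤ) - i'| < 1 := by exact_mod_cast h4
      rw [Int.abs_lt_one_iff] at h5
      omega
    have hcard := Finset.card_le_card_of_injOn s (fun i _ => hs1 i) hinj
    rw [Finset.card_range] at hcard
    calc ‖c‖ ^ n ≤ (N : ℝ) + 1 := (Nat.lt_floor_add_one _).le
      _ ≤ S.card := by exact_mod_cast hcard
  have hlog : 0 < Real.log ‖c‖ := Real.log_pos hc1
  have hbad : ENNReal.ofReal (Real.log ‖c‖ / 2) ≤ htop f := by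
    unfold htop
    refine le_trans ?_ (le_iSup₂_of_le (ε / 2) (by positivity) le_rfl)
    refine Filter.le_limsup_of_frequently_le ?_
    refine Filter.Eventually.frequently ?_
    filter_upwards [Filter.eventually_ge_atTop 2] with n hn
    apply ENNReal.ofReal_le_ofReal
    obtain ⟨m, rfl⟩ : ∃ m, n = m + 1 := ⟨n - 1, by omega⟩
    have h1 := Real.log_le_log (by positivity) (low m)
    rw [Real.log_pow] at h1
    rw [div_le_div_iff₀ (by norm_num) (by positivity)]
    have hm : (1 : ℝ) ≤ m := by exact_mod_cast (by omega : 1 ≤ m)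
    push_cast
    nlinarith
  rw [h0] at hbad
  have : 0 < ENNReal.ofReal (Real.log ‖c‖ / 2) := ENNReal.ofReal_pos.2 (by positivity)
  exact absurd hbad (not_le.2 this)

theorem hpol_torus_automorphism_le_sq (k : ℕ) (Λ : AddSubgroup (Fin k → ℂ))
    [DiscreteTopology Λ] [CompactSpace ((Fin k → ℂ) ⧸ Λ)]
    (A : (Fin k → ℂ) ≃ₗ[ℂ] (Fin k → ℂ)) (hA : ∀ z : Fin k → ℂ, z ∈ Λ ↔ A z ∈ Λ)
    (B : Fin k → ℂ)
    (f : ((Fin k → ℂ) ⧸ Λ) → ((Fin k → ℂ) ⧸ Λ))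
    (hf : ∀ z : Fin k → ℂ, f (QuotientAddGroup.mk z) = QuotientAddGroup.mk (A z + B))
    (h0 : htop f = 0) :
    hpol f ≤ ((k ^ 2 : ℕ) : ℝ≥0∞) := by
  classical
  obtain ⟨R, hR0, hR⟩ : ∃ R : ℝ, 0 ≤ R ∧ ∀ x : (Fin k → ℂ) ⧸ Λ, ∃ z : Fin k → ℂ,
      QuotientAddGroup.mk z = x ∧ ‖z‖ ≤ R := by
    obtain ⟨C, hC⟩ := (isCompact_univ (X := (Fin k → ℂ) ⧸ Λ)).isBounded.exists_norm_le
    refine ⟨|C| + 1, by positivity, fun x => ?_⟩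
    obtain ⟨m, hm, h⟩ := QuotientAddGroup.norm_lt_iff.1
      (lt_of_le_of_lt (hC x (Set.mem_univ x)) (lt_of_le_of_lt (le_abs_self C) (lt_add_one _)))
    exact ⟨m, hm, h.le⟩
  unfold hpol
  refine iSup₂_le fun ε hε => ?_
  obtain ⟨C, hC1, hC⟩ := linear_cover k (A : (Fin k → ℂ) →ₗ[ℂ] (Fin k → ℂ))
    (fun c v hv hc => eig_le hf h0 c v hv hc) R ε hR0 hε
  have hcov : ∀ n : ℕ, 1 ≤ n → (covNum f ε n : ℝ) ≤ C * (n : ℝ) ^ (k ^ 2) := by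
    intro n hn
    obtain ⟨S, hS1, hS2⟩ := hC n hn
    refine le_trans ?_ hS1
    refine le_trans ?_ (Nat.cast_le.2 (Finset.card_image_le
      (f := (QuotientAddGroup.mk : (Fin k → ℂ) → (Fin k → ℂ) ⧸ Λ))))
    refine Nat.cast_le.2 (Nat.sInf_le ⟨_, rfl, fun x => ?_⟩)
    obtain ⟨z, rfl, hz⟩ := hR x
    obtain ⟨s, hs, h⟩ := hS2 z hz
    refine ⟨_, Finset.mem_image_of_mem _ hs, fun j hj => ?_⟩
    rw [torus_dist hf]
    exact lt_of_le_of_lt QuotientAddGroup.norm_mk_le_norm (h j hj)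
  have hlim : Tendsto (fun n : ℕ => ENNReal.ofReal (Real.log C / Real.log n + (k ^ 2 : ℕ)))
      atTop (𝓝 ((k ^ 2 : ℕ) : ℝ≥0∞)) := by
    have h1 : Tendsto (fun n : ℕ => Real.log C / Real.log n + (k ^ 2 : ℕ)) atTop
        (𝓝 (0 + (k ^ 2 : ℕ))) :=
      (Tendsto.const_div_atTop (Real.tendsto_log_atTop.comp tendsto_natCast_atTop_atTop) _).add
        tendsto_const_nhds
    have := ENNReal.tendsto_ofReal h1
    rwa [zero_add, ENNReal.ofReal_natCast] at this
  rw [← hlim.limsup_eq]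
  refine Filter.limsup_le_limsup ?_
  filter_upwards [Filter.eventually_ge_atTop 2] with n hn
  apply ENNReal.ofReal_le_ofReal
  have hn2 : (2 : ℝ) ≤ n := by exact_mod_cast hn
  have hlogn : 0 < Real.log n := Real.log_pos (by linarith)
  have hle : Real.log (covNum f ε n) ≤ Real.log C + (k ^ 2 : ℕ) * Real.log n := by
    have hpos : 0 ≤ Real.log C + (k ^ 2 : ℕ) * Real.log n := by
      have := Real.log_nonneg hC1
      positivity
    rcases Nat.eq_zero_or_pos (covNum f ε n) with h | h
    · rw [h]; simpa using hpos
    · have := Real.log_le_log (by exact_mod_cast h) (hcov n (by omega))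
      rwa [Real.log_mul (by linarith) (by positivity), Real.log_pow] at this
  rw [div_le_iff₀ hlogn, add_mul, div_mul_cancel₀ _ hlogn.ne']
  exact hle
end

section
/- Let f be a homeomorphism of a compact metric space (X,d). If hpol(f) < 1/2, then for every pair of points x, y ∈ X one has limsup_{n→+∞} d(f^n(x), f^n(y)) ≥ d(x,y)/2. -/
open Filter Topology Metric
open scoped ENNReal

variable {X : Type*}

theorem aux_cov_nonempty {X : Type*} [MetricSpace X] [CompactSpace X] (f : X ≃ₜ X)
    (ε : ℝ) (hε : 0 < ε) (n : ℕ) :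
    ∃ S : Finset X, S.card = covNum (⇑f) ε n ∧
      ∀ x : X, ∃ s ∈ S, ∀ j < n, dist ((⇑f)^[j] x) ((⇑f)^[j] s) < ε := by
  have hne : {m : ℕ | ∃ S : Finset X, S.card = m ∧
    ∀ x : X, ∃ s ∈ S, ∀ j < n, dist ((⇑f)^[j] x) ((⇑f)^[j] s) < ε}.Nonempty := by
    obtain ⟨t, -, ht⟩ := (isCompact_univ (X := X)).elim_nhds_subcover
      (fun s => {x | ∀ j < n, dist ((⇑f)^[j] x) ((⇑f)^[j] s) < ε}) (by
        intro s _
        have : ∀ᶠ x in 𝓝 s, ∀ j ∈ Finset.range n, dist ((⇑f)^[j] x) ((⇑f)^[j] s) < ε := by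
          rw [Filter.eventually_all_finset]
          intro j _
          have hc : Continuous ((⇑f)^[j]) := f.continuous.iterate j
          exact Metric.tendsto_nhds.1 hc.continuousAt ε hε
        filter_upwards [this] with x hx j hj
        exact hx j (Finset.mem_range.2 hj))
    refine ⟨t.card, t, rfl, fun x => ?_⟩
    have := ht (Set.mem_univ x)
    simpa using this
  exact Nat.sInf_mem hne

theorem aux_cov_lower {X : Type*} [MetricSpace X] [CompactSpace X] (f : X ≃ₜ X)
    (ε : ℝ) (hε : 0 < ε) (x y : X) (N : ℕ) 
    (hN : ∀ n ≥ N, dist ((⇑f)^[n] x) ((⇑f)^[n] y) + 4 * ε ≤ dist x y) (M : ℕ) :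
    M + 1 ≤ covNum (⇑f) ε (M * N + 1) ^ 2 := by
  obtain ⟨S, hS, hcov⟩ := aux_cov_nonempty f ε hε (M * N + 1)
  rw [← hS]
  by_contra hlt
  push Not at hlt
  choose g hgS hg using hcov
  let F : ℕ → X × X := fun i => (g ((⇑f.symm)^[i * N] x), g ((⇑f.symm)^[i * N] y))
  have key : ∀ i j : ℕ, i < j → j ≤ M → F i = F j → False := by
    intro i j hij hjM hF
    have hk : j * N = (j - i) * N + i * N := by
      rw [← Nat.add_mul]; congr 1; omega
    have hp : N ≤ (j - i) * N := Nat.le_mul_of_pos_left N (by omega)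
    have hl : j * N < M * N + 1 := Nat.lt_succ_of_le (Nat.mul_le_mul_right N hjM)
    have hinv : ∀ (k : ℕ) (z : X), (⇑f)^[k] ((⇑f.symm)^[k] z) = z := fun k z =>
      Function.LeftInverse.iterate (f := ⇑f.symm) (g := ⇑f) f.apply_symm_apply k z
    have close : ∀ z : X, g ((⇑f.symm)^[i * N] z) = g ((⇑f.symm)^[j * N] z) →
        dist ((⇑f)^[(j - i) * N] z) z < 2 * ε := by
      intro z hz
      have h1 := hg ((⇑f.symm)^[i * N] z) (j * N) hl
      have h2 := hg ((⇑f.symm)^[j * N] z) (j * N) hl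
      rw [← hz, hinv] at h2
      have h3 : (⇑f)^[j * N] ((⇑f.symm)^[i * N] z) = (⇑f)^[(j - i) * N] z := by
        rw [hk, Function.iterate_add_apply, hinv]
      rw [h3] at h1
      have := dist_triangle_right ((⇑f)^[(j - i) * N] z) z
        ((⇑f)^[j * N] (g ((⇑f.symm)^[i * N] z)))
      linarith
    have hx := close x (congrArg Prod.fst hF)
    have hy := close y (congrArg Prod.snd hF)
    have h4 := hN _ hp
    have h5 := dist_triangle4 x ((⇑f)^[(j - i) * N] x) ((⇑f)^[(j - i) * N] y) y
    rw [dist_comm x ((⇑f)^[(j - i) * N] x)] at h5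
    linarith
  obtain ⟨i, hi, j, hj, hne, hF⟩ := Finset.exists_ne_map_eq_of_card_lt_of_maps_to
    (s := Finset.range (M + 1)) (t := S ×ˢ S) (f := F)
    (by simpa [Finset.card_product, sq] using hlt)
    (by intro i _; simp [F, hgS])
  simp only [Finset.mem_range] at hi hj
  rcases lt_or_gt_of_ne hne with h | h
  · exact key i j h (by omega) hF
  · exact key j i h (by omega) hF.symm

/-- If a homeomorphism `f` of a compact metric space satisfies `hpol f < 1/2`, then
`limsup_{n → +∞} dist (f^n x) (f^n y) ≥ dist x y / 2` for every pair of points `x, y`. -/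
theorem limsup_dist_ge_of_hpol_lt_half [MetricSpace X] [CompactSpace X]
    (f : X ≃ₜ X) (h : hpol (⇑f) < 1 / 2) (x y : X) :
    dist x y / 2 ≤ Filter.atTop.limsup fun n : ℕ => dist ((⇑f)^[n] x) ((⇑f)^[n] y) := by
  by_contra hlt
  push Not at hlt
  have hb : IsBoundedUnder (· ≤ ·) atTop
      (fun n : ℕ => dist ((⇑f)^[n] x) ((⇑f)^[n] y)) :=
    isBoundedUnder_of ⟨Metric.diam (Set.univ : Set X), fun n =>
      Metric.dist_le_diam_of_mem isCompact_univ.isBounded (Set.mem_univ _) (Set.mem_univ _)⟩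
  have hev := eventually_lt_of_limsup_lt hlt hb
  obtain ⟨N, hN⟩ := eventually_atTop.1 hev
  have hpos : 0 < dist x y := by
    have := hN N le_rfl
    have h0 : 0 ≤ dist ((⇑f)^[N] x) ((⇑f)^[N] y) := dist_nonneg
    linarith
  set ε := dist x y / 8 with hεdef
  have hε : 0 < ε := by positivity
  have hlow := aux_cov_lower f ε hε x y (N + 1) (fun n hn => by
    have := hN n (by omega)
    linarith)
  have hls : atTop.limsup (fun n : ℕ =>
      ENNReal.ofReal (Real.log (covNum (⇑f) ε n) / Real.log n)) < 1 / 2 :=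
    lt_of_le_of_lt (le_iSup₂ (f := fun (ε : ℝ) (_ : 0 < ε) => atTop.limsup (fun n : ℕ =>
      ENNReal.ofReal (Real.log (covNum (⇑f) ε n) / Real.log n))) ε hε) h
  obtain ⟨c, hc1, hc2⟩ := exists_between hls
  have hctop : c ≠ ⊤ := (lt_of_lt_of_le hc2 le_top).ne
  have hc : c.toReal < 1 / 2 := by
    have := (ENNReal.toReal_lt_toReal hctop (by simp)).2 hc2
    simpa using this
  have hev2 := eventually_lt_of_limsup_lt hc1
  have htend : Tendsto (fun M : ℕ => M * (N + 1) + 1) atTop atTop :=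
    tendsto_atTop_mono (fun M => by simp only [id]; nlinarith [Nat.zero_le (M * N)]) tendsto_id
  have hlog : Tendsto (fun n : ℕ => Real.log n) atTop atTop :=
    Real.tendsto_log_atTop.comp tendsto_natCast_atTop_atTop
  have hbig := hlog.eventually_gt_atTop (max 0 (Real.log (N + 1) / (1 - 2 * c.toReal)))
  obtain ⟨M, h1, h2⟩ := (htend.eventually (hev2.and hbig)).exists
  have hM := hlow M
  set n := M * (N + 1) + 1 with hn
  have hL : 0 < Real.log n := lt_of_le_of_lt (le_max_left _ _) h2
  have hL2 := lt_of_le_of_lt (le_max_right _ _) h2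
  rw [div_lt_iff₀ (by linarith)] at hL2
  have h3 : Real.log (covNum (⇑f) ε n) < c.toReal * Real.log n := by
    rw [← div_lt_iff₀ hL]
    exact (ENNReal.ofReal_lt_iff_lt_toReal
      (div_nonneg (Real.log_natCast_nonneg _) hL.le) hctop).1 h1
  have hCpos : 0 < covNum (⇑f) ε n := by
    rcases Nat.eq_zero_or_pos (covNum (⇑f) ε n) with h0 | h0
    · rw [h0] at hM; simp at hM
    · exact h0
  have h4 : n ≤ covNum (⇑f) ε n ^ 2 * (N + 1) := by
    have := Nat.mul_le_mul_right (N + 1) hM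
    refine le_trans ?_ this
    rw [hn]; nlinarith
  have h5 : (n : ℝ) ≤ (covNum (⇑f) ε n : ℝ) ^ 2 * ((N : ℝ) + 1) := by exact_mod_cast h4
  have hnpos : (0 : ℝ) < n := by exact_mod_cast Nat.succ_pos _
  have hCR : (0 : ℝ) < covNum (⇑f) ε n := by exact_mod_cast hCpos
  have h6 := Real.log_le_log hnpos h5
  rw [Real.log_mul (by positivity) (by positivity), Real.log_pow] at h6
  push_cast at h6
  nlinarith
end

section
/- Let (X,d) be a compact metric space for which there exist constants C > 0 and D ≥ 0 such that for every ε ∈ (0,1] the space X can be covered by at most C·ε^{-D} balls of radius ε. Let f be a homeomorphism of X and let Lip_f(n) denote the maximum of the Lipschitz constants of the maps id, f, f², …, f^{n-1} (possibly +∞). Then: (a) if α > 0 and Lip_f(n) ≤ n^α for all sufficiently large n, then hpol(f) ≤ α·D; (b) if Lip_f(n) = o(n^α) for every α > 0, then hpol(f) = 0. -/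
open Filter Topology Metric
open scoped ENNReal

variable {X : Type*}

/-- The (possibly infinite) Lipschitz constant of a self-map of a metric space:
the supremum of the ratios `edist (g x) (g y) / edist x y`. -/
noncomputable def lipConst [PseudoMetricSpace X] (g : X → X) : ℝ≥0∞ :=
  ⨆ (x : X) (y : X), edist (g x) (g y) / edist x y

/-- `lipGrowth f n = Lip_f(n)`: the maximum of the Lipschitz constants of
`id, f, f², …, f^[n-1]`. -/
noncomputable def lipGrowth [PseudoMetricSpace X] (f : X → X) (n : ℕ) : ℝ≥0∞ :=
  ⨆ j ∈ Finset.range n, lipConst (f^[j])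

theorem aux_dist_le [MetricSpace X] (f : X → X) (n : ℕ) (L : ℝ) (hL : 0 ≤ L)
    (h : lipGrowth f n ≤ ENNReal.ofReal L) (x y : X) (j : ℕ) (hj : j < n) :
    dist (f^[j] x) (f^[j] y) ≤ L * dist x y := by
  rcases eq_or_ne x y with rfl | hxy
  · simp
  have h1 : edist (f^[j] x) (f^[j] y) / edist x y ≤ ENNReal.ofReal L := by
    refine le_trans ?_ h
    refine le_trans ?_ (le_iSup₂ (f := fun j (_ : j ∈ Finset.range n) => lipConst (f^[j])) j
      (Finset.mem_range.mpr hj))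
    exact le_iSup₂ (f := fun x y => edist (f^[j] x) (f^[j] y) / edist x y) x y
  rw [ENNReal.div_le_iff (by simpa using hxy) (edist_ne_top x y), edist_dist, edist_dist,
    ← ENNReal.ofReal_mul hL] at h1
  exact (ENNReal.ofReal_le_ofReal_iff (by positivity)).mp h1

theorem aux_a [MetricSpace X]
    (C D : ℝ) (hC : 0 < C)
    (hcov : ∀ ε : ℝ, 0 < ε → ε ≤ 1 → ∃ S : Finset X,
      (S.card : ℝ) ≤ C * ε ^ (-D) ∧ ∀ x : X, ∃ s ∈ S, dist x s < ε)
    (f : X → X) (α : ℝ) (hα : 0 < α)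
    (h : ∀ᶠ n : ℕ in atTop, lipGrowth f n ≤ ENNReal.ofReal ((n : ℝ) ^ α)) :
    hpol f ≤ ENNReal.ofReal (α * D) := by
  refine iSup₂_le fun ε hε => ?_
  obtain ⟨η, hη0, hη1, hηε⟩ : ∃ η : ℝ, 0 < η ∧ η ≤ 1 ∧ η ≤ ε :=
    ⟨min ε 1, lt_min hε one_pos, min_le_right _ _, min_le_left _ _⟩
  have hK : 0 < C * η ^ (-D) := by positivity
  have hlog : Tendsto (fun n : ℕ => Real.log (n : ℝ)) atTop atTop :=
    Real.tendsto_log_atTop.comp tendsto_natCast_atTop_atTop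
  have ht : Tendsto (fun n : ℕ => ENNReal.ofReal (Real.log (C * η ^ (-D)) / Real.log n + α * D))
      atTop (𝓝 (ENNReal.ofReal (α * D))) := by
    apply ENNReal.tendsto_ofReal
    simpa using (hlog.const_div_atTop (Real.log (C * η ^ (-D)))).add_const (α * D)
  rw [← ht.limsup_eq]
  refine limsup_le_limsup ?_
  filter_upwards [h, eventually_ge_atTop 2] with n hn hn2
  have hn1 : (1 : ℝ) < n := by exact_mod_cast hn2
  have hn0 : (0 : ℝ) < n := by linarith
  have hp : 0 < (n : ℝ) ^ α := Real.rpow_pos_of_pos hn0 _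
  have hp1 : 1 ≤ (n : ℝ) ^ α := Real.one_le_rpow hn1.le hα.le
  have hl : 0 < Real.log n := Real.log_pos hn1
  obtain ⟨S, hS, hSc⟩ := hcov (η / (n : ℝ) ^ α) (by positivity)
    ((div_le_one hp).mpr (hη1.trans hp1))
  have hcard : covNum f ε n ≤ S.card := by
    refine Nat.sInf_le ⟨S, rfl, fun x => ?_⟩
    obtain ⟨s, hs, hxs⟩ := hSc x
    refine ⟨s, hs, fun j hj => ?_⟩
    have h1 := aux_dist_le f n _ hp.le hn x s j hj
    rw [lt_div_iff₀ hp] at hxs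
    linarith
  rcases Nat.eq_zero_or_pos (covNum f ε n) with h0 | h0
  · simp [h0]
  apply ENNReal.ofReal_le_ofReal
  rw [div_le_iff₀ hl, add_mul, div_mul_cancel₀ _ hl.ne']
  have hb : (covNum f ε n : ℝ) ≤ C * η ^ (-D) * (n : ℝ) ^ (α * D) := by
    refine le_trans (by exact_mod_cast hcard) (hS.trans (le_of_eq ?_))
    rw [Real.div_rpow hη0.le hp.le, ← Real.rpow_mul hn0.le, mul_neg, Real.rpow_neg hn0.le]
    field_simp
  have := Real.log_le_log (by exact_mod_cast h0) hb
  rwa [Real.log_mul hK.ne' (by positivity), Real.log_rpow hn0] at this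

/-- Let `(X,d)` be a compact metric space such that for some constants `C > 0`, `D ≥ 0`,
for every `ε ∈ (0,1]` the space `X` can be covered by at most `C ε^{-D}` balls of
radius `ε`.  Let `f` be a homeomorphism of `X`.  Then:
(a) if `α > 0` and `Lip_f(n) ≤ n^α` for all sufficiently large `n`, then `hpol f ≤ α D`;
(b) if `Lip_f(n) = o(n^α)` for every `α > 0`, then `hpol f = 0`. -/
theorem hpol_le_of_slow_lipschitz_growth [MetricSpace X] [CompactSpace X]
    (C D : ℝ) (hC : 0 < C) (hD : 0 ≤ D)
    (hcov : ∀ ε : ℝ, 0 < ε → ε ≤ 1 → ∃ S : Finset X,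
      (S.card : ℝ) ≤ C * ε ^ (-D) ∧ ∀ x : X, ∃ s ∈ S, dist x s < ε)
    (f : X ≃ₜ X) :
    (∀ α : ℝ, 0 < α →
      (∀ᶠ n : ℕ in atTop, lipGrowth (⇑f) n ≤ ENNReal.ofReal ((n : ℝ) ^ α)) →
      hpol (⇑f) ≤ ENNReal.ofReal (α * D)) ∧
    ((∀ α : ℝ, 0 < α → ∀ c : ℝ, 0 < c →
      ∀ᶠ n : ℕ in atTop, lipGrowth (⇑f) n ≤ ENNReal.ofReal (c * (n : ℝ) ^ α)) →
      hpol (⇑f) = 0) := by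
  have key := fun α hα h => aux_a C D hC hcov (⇑f) α hα h
  refine ⟨key, fun h => ?_⟩
  have ht : Tendsto (fun α : ℝ => ENNReal.ofReal (α * D)) (𝓝[>] 0) (𝓝 0) := by
    have : Tendsto (fun α : ℝ => ENNReal.ofReal (α * D)) (𝓝 0) (𝓝 (ENNReal.ofReal (0 * D))) :=
      ENNReal.tendsto_ofReal (tendsto_id.mul_const D)
    simp only [zero_mul, ENNReal.ofReal_zero] at this
    exact this.mono_left nhdsWithin_le_nhds
  refine le_antisymm (ge_of_tendsto ht ?_) zero_le
  filter_upwards [self_mem_nhdsWithin] with α hα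
  exact key α hα (by simpa using h α hα 1 one_pos)
end

section
/- There exist an irrational number α ∈ ℝ and a real-analytic, 1-periodic function g : ℝ → ℝ with ∫₀¹ g(x)dx = 0 such that the homeomorphism f of the torus 𝕋² = (ℝ/ℤ)² defined by f(x,y) = (x+α, y+g(x)) satisfies: (1) f is minimal (every f-orbit is dense in 𝕋²); (2) the family of iterates {f^n : n ∈ ℤ} is not equicontinuous; (3) for every ε > 0, sup_{x∈ℝ} |∑_{j=0}^{n-1} g'(x+jα)| = o(n^ε) as n → ∞ (so the Lipschitz constants of the iterates f^n grow slower than n^ε for every ε > 0); (4) hpol(f) = 0. Moreover f preserves the Haar (Lebesgue) probability measure of 𝕋². -/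
open Filter Topology Metric
open scoped ENNReal

variable {X : Type*}

open Asymptotics MeasureTheory


namespace Slow

def q : ℕ → ℕ
  | 0 => 1
  | (k+1) => 2 ^ q k

lemma q_succ (k : ℕ) : q (k+1) = 2 ^ q k := rfl

lemma q_pos (k : ℕ) : 0 < q k := by
  cases k <;> simp [q]

lemma q_strictMono : StrictMono q := strictMono_nat_of_lt_succ fun k => by
  rw [q_succ]; exact Nat.lt_two_pow_self

lemma q_two_mul (k : ℕ) : 2 * q k ≤ q (k+1) := by
  rw [q_succ]
  obtain ⟨m, hm⟩ := Nat.exists_eq_succ_of_ne_zero (q_pos k).ne'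
  rw [hm, Nat.succ_eq_add_one, pow_succ]
  have : m < 2 ^ m := Nat.lt_two_pow_self
  omega

lemma q_dvd_succ (k : ℕ) : q k ∣ q (k+1) := by
  cases k with
  | zero => simp [q]
  | succ k =>
    rw [q_succ, q_succ (k+1)]
    exact pow_dvd_pow 2 (q_strictMono (Nat.lt_succ_self k)).le

lemma q_dvd {j k : ℕ} (h : j ≤ k) : q j ∣ q k := by
  induction h with
  | refl => exact dvd_rfl
  | step _ ih => exact ih.trans (q_dvd_succ _)

lemma q_geom (k i : ℕ) : 2 ^ i * q k ≤ q (k + i) := by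
  induction i with
  | zero => simp
  | succ i ih =>
    have := q_two_mul (k+i)
    rw [← add_assoc, pow_succ]; nlinarith

lemma Qpos (k : ℕ) : (0:ℝ) < q k := by exact_mod_cast q_pos k

lemma summable_q (a : ℕ) {r : ℝ} (h0 : 0 ≤ r) (h1 : r < 1) :
    Summable fun k => (q k : ℝ) ^ a * r ^ (q k) := by
  have := summable_pow_mul_geometric_of_norm_lt_one (R := ℝ) a (r := r)
    (by rw [Real.norm_of_nonneg h0]; exact h1)
  exact this.comp_injective q_strictMono.injective

lemma inv_q_le (k i : ℕ) : ((q (i + k) : ℝ))⁻¹ ≤ (q k : ℝ)⁻¹ * (1/2) ^ i := by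
  have h : ((2:ℝ) ^ i * q k) ≤ q (i + k) := by
    rw [add_comm i k]; exact_mod_cast q_geom k i
  have h2 := Qpos k
  calc ((q (i + k) : ℝ))⁻¹ ≤ (2 ^ i * q k : ℝ)⁻¹ := by
        apply inv_anti₀ (by positivity) h
    _ = _ := by rw [mul_inv, mul_comm, one_div, inv_pow]

lemma summable_inv (k : ℕ) : Summable fun i => ((q (i + k) : ℝ))⁻¹ :=
  Summable.of_nonneg_of_le (fun i => by positivity) (inv_q_le k)
    ((summable_geometric_of_lt_one (by norm_num) (by norm_num)).mul_left _)

noncomputable def α : ℝ := ∑' k, ((q k : ℝ))⁻¹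

noncomputable def δ (k : ℕ) : ℝ := q k * ∑' i, ((q (i + (k+1)) : ℝ))⁻¹

lemma δ_le (k : ℕ) : δ k ≤ 2 * q k * (1/2) ^ (q k) := by
  have h : ∑' i, ((q (i + (k+1)) : ℝ))⁻¹ ≤ (q (k+1) : ℝ)⁻¹ * 2 := by
    have h3 := (summable_geometric_of_lt_one (r := (1/2:ℝ)) (by norm_num) (by norm_num)).mul_left
      ((q (k+1) : ℝ)⁻¹)
    refine ((summable_inv (k+1)).tsum_le_tsum (inv_q_le (k+1)) h3).trans ?_
    rw [tsum_mul_left, tsum_geometric_two]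
  have h2 : (q (k+1) : ℝ)⁻¹ = (1/2) ^ (q k) := by rw [q_succ]; push_cast; simp
  rw [h2] at h
  unfold δ
  have := Qpos k
  nlinarith

lemma le_δ (k : ℕ) : (q k : ℝ) * (q (k+1) : ℝ)⁻¹ ≤ δ k := by
  unfold δ
  have := (summable_inv (k+1)).le_tsum 0 (fun j _ => by positivity)
  simp only [zero_add] at this
  exact mul_le_mul_of_nonneg_left this (Qpos k).le

lemma δ_pos (k : ℕ) : 0 < δ k := lt_of_lt_of_le
  (mul_pos (Qpos k) (inv_pos.2 (Qpos (k+1)))) (le_δ k)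

lemma exists_p (k : ℕ) : ∃ p : ℕ, (q k : ℝ) * α = p + δ k := by
  have h := (summable_inv 0).sum_add_tsum_nat_add (k+1)
  simp only [add_zero] at h
  have hd : ∀ i ∈ Finset.range (k+1), (q k : ℝ) * ((q i : ℝ))⁻¹ = ((q k / q i : ℕ) : ℝ) := by
    intro i hi
    rw [Nat.cast_div (q_dvd (by simpa [Nat.lt_succ_iff] using hi)) (Qpos i).ne', div_eq_mul_inv]
  refine ⟨∑ i ∈ Finset.range (k+1), q k / q i, ?_⟩
  rw [α, ← h, mul_add, Finset.mul_sum, Finset.sum_congr rfl hd, δ]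
  push_cast; rfl

lemma tendsto_e : Tendsto (fun k => (q k : ℝ)^2 * (1/2) ^ (q k)) atTop (𝓝 0) :=
  (summable_q 2 (by norm_num) (by norm_num)).tendsto_atTop_zero

lemma tendsto_δ : Tendsto δ atTop (𝓝 0) := by
  have h := (summable_q 1 (r := 1/2) (by norm_num) (by norm_num)).tendsto_atTop_zero.const_mul 2
  simp only [pow_one, mul_zero] at h
  exact squeeze_zero (fun k => (δ_pos k).le) (fun k => (δ_le k).trans (by rw [mul_assoc])) h

lemma irr : Irrational α := by
  rintro ⟨r, hr⟩
  have h := tendsto_δ.const_mul (r.den : ℝ)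
  rw [mul_zero] at h
  obtain ⟨k, hk⟩ := (h.eventually (gt_mem_nhds one_pos)).exists
  obtain ⟨p, hp⟩ := exists_p k
  have hden : (0:ℝ) < r.den := by exact_mod_cast r.den_pos
  have h1 : (r.den : ℝ) * α = r.num := by
    rw [← hr]; exact_mod_cast Rat.den_mul_eq_num r
  have h2 : (r.den : ℝ) * δ k = ((q k * r.num - r.den * p : ℤ) : ℝ) := by
    push_cast; rw [← h1]; linear_combination (-(r.den:ℝ)) * hp
  have h3 : 0 < (r.den : ℝ) * δ k := mul_pos hden (δ_pos k)
  rw [h2] at hk h3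
  have a1 : (0:ℤ) < (q k * r.num - r.den * p : ℤ) := by exact_mod_cast h3
  have a2 : (q k * r.num - r.den * p : ℤ) < 1 := by exact_mod_cast hk
  omega

/-- Birkhoff sum of the `k`-th term -/
noncomputable def v (k n : ℕ) (x : ℝ) : ℝ :=
  - Real.sin (Real.pi * q k * n * α) * Real.sin (2 * Real.pi * q k * x + Real.pi * q k * n * α)

lemma v_eq (k n : ℕ) (x : ℝ) : v k n x =
    (Real.cos (2 * Real.pi * q k * (x + n * α)) - Real.cos (2 * Real.pi * q k * x)) / 2 := by
  rw [Real.cos_sub_cos, v,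
    show (2 * Real.pi * q k * (x + n * α) + 2 * Real.pi * q k * x) / 2 =
      2 * Real.pi * q k * x + Real.pi * q k * n * α by ring,
    show (2 * Real.pi * q k * (x + n * α) - 2 * Real.pi * q k * x) / 2 =
      Real.pi * q k * n * α by ring]
  ring

lemma abs_sin_int (y : ℝ) (m : ℕ) (t : ℝ) (h : y = m + t) :
    |Real.sin (Real.pi * y)| ≤ Real.pi * |t| := by
  rw [h, mul_add, mul_comm Real.pi (m:ℝ), add_comm, Real.sin_add_nat_mul_pi, abs_mul, abs_pow]
  simp only [abs_neg, abs_one, one_pow, one_mul]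
  calc _ ≤ |Real.pi * t| := Real.abs_sin_le_abs
    _ = _ := by rw [abs_mul, abs_of_pos Real.pi_pos]

lemma abs_s (k n : ℕ) : |Real.sin (Real.pi * q k * n * α)| ≤ Real.pi * (n * δ k) := by
  obtain ⟨p, hp⟩ := exists_p k
  have := abs_sin_int (q k * n * α) (n * p) (n * δ k)
    (by push_cast; linear_combination (n:ℝ) * hp)
  rw [abs_of_nonneg (mul_nonneg (Nat.cast_nonneg n) (δ_pos k).le)] at this
  convert this using 3; ring

lemma abs_v (k n : ℕ) (x : ℝ) : |v k n x| ≤ |Real.sin (Real.pi * q k * n * α)| := by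
  rw [v, abs_mul, abs_neg]
  exact mul_le_of_le_one_right (abs_nonneg _) (Real.abs_sin_le_one _)

lemma abs_v' (k n : ℕ) (x : ℝ) : |v k n x| ≤ (2 * Real.pi * n) * ((q k : ℝ)^1 * (1/2) ^ (q k)) := by
  refine (abs_v k n x).trans ((abs_s k n).trans ?_)
  have := mul_le_mul_of_nonneg_left (δ_le k) (show 0 ≤ Real.pi * n by positivity)
  rw [pow_one]; linarith

lemma summable_v (n : ℕ) (x : ℝ) : Summable fun k => v k n x :=
  Summable.of_norm_bounded ((summable_q 1 (by norm_num) (by norm_num)).mul_left _)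
    (fun k => abs_v' k n x)

noncomputable def S (n : ℕ) (x : ℝ) : ℝ := ∑' k, v k n x

noncomputable def g (x : ℝ) : ℝ := S 1 x

lemma v_add (k n m : ℕ) (x : ℝ) : v k (n + m) x = v k n x + v k m (x + n * α) := by
  rw [v_eq, v_eq, v_eq]; push_cast
  rw [show x + n * α + m * α = x + (n + m) * α by ring]; ring

lemma S_succ (n : ℕ) (x : ℝ) : S (n+1) x = S n x + g (x + n * α) := by
  rw [S, S, g, S, ← (summable_v _ _).tsum_add (summable_v _ _)]
  exact tsum_congr fun k => v_add k n 1 x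

lemma S_zero (x : ℝ) : S 0 x = 0 := by simp [S, v]

lemma S_eq (n : ℕ) (x : ℝ) : S n x = ∑ j ∈ Finset.range n, g (x + j * α) := by
  induction n with
  | zero => simp [S_zero]
  | succ n ih => rw [S_succ, Finset.sum_range_succ, ih]

lemma v_periodic (k n : ℕ) (x : ℝ) : v k n (x + 1) = v k n x := by
  rw [v, v, show 2 * Real.pi * q k * (x + 1) + Real.pi * q k * n * α =
    2 * Real.pi * q k * x + Real.pi * q k * n * α + (q k : ℕ) * (2 * Real.pi) by ring,
    Real.sin_add_nat_mul_two_pi]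

lemma g_periodic : Function.Periodic g 1 := fun x => by
  rw [g, g, S, S]; exact tsum_congr fun k => v_periodic k 1 x

lemma norm_csin (w : ℂ) : ‖Complex.sin w‖ ≤ Real.exp |w.im| := by
  rw [Complex.sin, norm_div, norm_mul, Complex.norm_I, mul_one]
  have h : ‖Complex.exp (-w * Complex.I) - Complex.exp (w * Complex.I)‖ ≤ 2 * Real.exp |w.im| := by
    refine (norm_sub_le _ _).trans ?_
    rw [Complex.norm_exp, Complex.norm_exp]
    have a := Real.exp_le_exp.2 (le_abs_self w.im)
    have b := Real.exp_le_exp.2 (neg_le_abs w.im)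
    simp
    linarith
  simp only [Complex.norm_ofNat]
  linarith

noncomputable def cv (k : ℕ) (z : ℂ) : ℂ :=
  ((- Real.sin (Real.pi * q k * (1:ℕ) * α) : ℝ) : ℂ) *
    Complex.sin (((2 * Real.pi * q k : ℝ) : ℂ) * z + ((Real.pi * q k * (1:ℕ) * α : ℝ) : ℂ))

lemma cv_ofReal (k : ℕ) (x : ℝ) : cv k x = (v k 1 x : ℂ) := by
  rw [cv, v]; push_cast; rfl

lemma cv_bound (k : ℕ) (z : ℂ) (hz : |z.im| < 1/100) :
    ‖cv k z‖ ≤ (2 * Real.pi) * ((q k : ℝ)^1 * (3/4) ^ (q k)) := by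
  rw [cv, norm_mul, Complex.norm_real, norm_neg, Real.norm_eq_abs]
  have h1 : |Real.sin (Real.pi * q k * (1:ℕ) * α)| ≤ Real.pi * (2 * q k * (1/2) ^ (q k)) := by
    refine (abs_s k 1).trans ?_
    have := mul_le_mul_of_nonneg_left (δ_le k) Real.pi_pos.le
    simpa using this
  have h2 : ‖Complex.sin (((2 * Real.pi * q k : ℝ) : ℂ) * z + ((Real.pi * q k * (1:ℕ) * α : ℝ) : ℂ))‖
      ≤ (3/2) ^ (q k) := by
    refine (norm_csin _).trans ?_
    rw [Complex.add_im, Complex.ofReal_im, add_zero, Complex.im_ofReal_mul, abs_mul]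
    have hq := Qpos k
    rw [abs_of_pos (by positivity)]
    have e1 : Real.exp (1/10) ≤ 3/2 := by
      have := Real.exp_bound' (x := 1/10) (by norm_num) (by norm_num) (n := 2) (by norm_num)
      norm_num [Finset.sum_range_succ, Nat.factorial] at this
      linarith
    calc _ ≤ Real.exp ((q k : ℕ) * (1/10)) := by
          apply Real.exp_le_exp.2
          have : 2 * Real.pi * |z.im| ≤ 1/10 := by nlinarith [Real.pi_lt_four, Real.pi_pos, Real.pi_lt_d2]
          nlinarith
      _ = Real.exp (1/10) ^ (q k) := Real.exp_nat_mul _ _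
      _ ≤ _ := by gcongr
  calc _ ≤ Real.pi * (2 * q k * (1/2) ^ (q k)) * (3/2) ^ (q k) := by gcongr
    _ = 2 * Real.pi * (q k ^ 1 * ((1/2) * (3/2)) ^ (q k)) := by rw [mul_pow]; ring
    _ = _ := by norm_num

lemma g_analytic (x : ℝ) : AnalyticAt ℝ g x := by
  have ho : IsOpen {z : ℂ | |z.im| < 1/100} :=
    isOpen_lt (Complex.continuous_im.abs) continuous_const
  have hd : DifferentiableOn ℂ (fun z => ∑' k, cv k z) {z : ℂ | |z.im| < 1/100} := by
    refine Complex.differentiableOn_tsum_of_summable_norm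
      ((summable_q 1 (r := 3/4) (by norm_num) (by norm_num)).mul_left (2 * Real.pi)) ?_ ho
      (fun k z hz => cv_bound k z hz)
    intro k
    unfold cv
    fun_prop
  have ha : AnalyticAt ℂ (fun z => ∑' k, cv k z) (x : ℂ) :=
    hd.analyticAt (ho.mem_nhds (by simp))
  have hb : AnalyticAt ℝ (fun y : ℝ => (∑' k, cv k (y : ℂ)).re) x := by
    have h1 := ha.restrictScalars (𝕜 := ℝ)
    have h2 : AnalyticAt ℝ (fun y : ℝ => (y : ℂ)) x := Complex.ofRealCLM.analyticAt x
    have h3 := AnalyticAt.fun_comp (f := fun y : ℝ => (y : ℂ)) (x := x) h1 h2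
    exact (Complex.reCLM.analyticAt _).fun_comp h3
  convert hb using 2 with y
  rw [g, S]
  simp_rw [cv_ofReal]
  rw [← Complex.ofReal_tsum, Complex.ofReal_re]

lemma g_cont : Continuous g := continuous_iff_continuousAt.2 fun x => (g_analytic x).continuousAt

lemma v_cont (k n : ℕ) : Continuous (v k n) := by unfold v; fun_prop

lemma g_int : (∫ x in (0 : ℝ)..1, g x) = 0 := by
  have h := intervalIntegral.hasSum_integral_of_dominated_convergence
    (μ := volume) (a := 0) (b := 1) (F := fun k x => v k 1 x) (f := g)
    (fun k _ => (2 * Real.pi * (1:ℕ)) * ((q k : ℝ)^1 * (1/2) ^ (q k)))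
    (fun k => (v_cont k 1).aestronglyMeasurable)
    (fun k => Eventually.of_forall fun x _ => abs_v' k 1 x)
    (Eventually.of_forall fun x _ => (summable_q 1 (by norm_num) (by norm_num)).mul_left _)
    (by simp)
    (Eventually.of_forall fun x _ => (summable_v 1 x).hasSum)
  have h0 : ∀ k, (∫ x in (0:ℝ)..1, v k 1 x) = 0 := by
    intro k
    let c : ℝ → ℝ := fun x => Real.cos (2 * Real.pi * q k * x)
    have hc : Function.Periodic c 1 := fun x => by
      simp only [c]
      rw [show 2 * Real.pi * q k * (x + 1) = 2 * Real.pi * q k * x + (q k : ℕ) * (2 * Real.pi) by ring,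
        Real.cos_add_nat_mul_two_pi]
    have hcc : Continuous c := by fun_prop
    have e : ∀ x, v k 1 x = (c (x + α) - c x) / 2 := fun x => by
      rw [v_eq]; simp [c]
    simp_rw [e]
    rw [intervalIntegral.integral_div, intervalIntegral.integral_sub
      ((show Continuous fun x => c (x + α) by fun_prop).intervalIntegrable _ _) (hcc.intervalIntegrable _ _),
      intervalIntegral.integral_comp_add_right]
    have := hc.intervalIntegral_add_eq (0 + α) 0
    rw [show (1:ℝ) + α = 0 + α + 1 by ring, this]; simp
  simp_rw [h0] at h
  exact h.unique hasSum_zero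

/-- Lipschitz bound -/
lemma S_lip (s : ℝ) (hs : 0 < s) (hs1 : s ≤ 1) : ∃ C : ℝ, 0 ≤ C ∧ ∀ (n : ℕ) (x y : ℝ),
    |S n x - S n y| ≤ C * (n:ℝ) ^ s * |x - y| := by
  let r : ℝ := (1/2) ^ s
  have hr0 : 0 ≤ r := by positivity
  have hr1 : r < 1 := Real.rpow_lt_one (by norm_num) (by norm_num) hs
  have hsum := ((summable_q 2 hr0 hr1).mul_left (2 * Real.pi * (2 * Real.pi)))
  refine ⟨∑' k, (2 * Real.pi * (2 * Real.pi)) * ((q k : ℝ)^2 * r ^ (q k)),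
    tsum_nonneg fun k => by positivity, fun n x y => ?_⟩
  have key : ∀ k, |v k n x - v k n y| ≤
      ((2 * Real.pi * (2 * Real.pi)) * ((q k : ℝ)^2 * r ^ (q k))) * ((n:ℝ) ^ s * |x - y|) := by
    intro k
    have hq := Qpos k
    have hq1 : (1:ℝ) ≤ q k := by exact_mod_cast q_pos k
    have h1 : |v k n x - v k n y| ≤ |Real.sin (Real.pi * q k * n * α)| * (2 * Real.pi * q k * |x - y|) := by
      rw [v, v, ← mul_sub, abs_mul, abs_neg]
      refine mul_le_mul_of_nonneg_left ?_ (abs_nonneg _)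
      refine (Real.abs_sin_sub_sin_le _ _).trans (le_of_eq ?_)
      rw [show 2 * Real.pi * q k * x + Real.pi * q k * n * α -
        (2 * Real.pi * q k * y + Real.pi * q k * n * α) = (2 * Real.pi * q k) * (x - y) by ring,
        abs_mul, abs_of_pos (by positivity)]
    have h2 : |Real.sin (Real.pi * q k * n * α)| ≤ (2 * Real.pi) * q k * (r ^ (q k) * (n:ℝ)^s) := by
      set t := |Real.sin (Real.pi * q k * n * α)| with ht
      have t0 : 0 ≤ t := abs_nonneg _
      have t1 : t ≤ 1 := Real.abs_sin_le_one _
      have a : t ≤ t ^ s := by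
        rcases eq_or_lt_of_le t0 with h | h
        · rw [← h]; positivity
        · simpa using Real.rpow_le_rpow_of_exponent_ge h t1 hs1
      have b : t ≤ ((2 * Real.pi) * q k) * ((1/2)^(q k) * n) := by
        refine (abs_s k n).trans ?_
        have := mul_le_mul_of_nonneg_left (δ_le k) (show 0 ≤ Real.pi * n by positivity)
        linarith
      have c1 : 1 ≤ (2 * Real.pi) * q k := by nlinarith [Real.pi_gt_three]
      calc t ≤ t ^ s := a
        _ ≤ (((2 * Real.pi) * q k) * ((1/2)^(q k) * n)) ^ s := by gcongr
        _ = ((2 * Real.pi) * q k) ^ s * (((1/2)^(q k)) ^ s * (n:ℝ)^s) := by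
          rw [Real.mul_rpow (x := (2 * Real.pi) * q k) (by positivity) (by positivity),
            Real.mul_rpow (x := (1/2)^(q k)) (by positivity) (by positivity)]
        _ ≤ ((2 * Real.pi) * q k) * (((1/2)^(q k)) ^ s * (n:ℝ)^s) := by
          gcongr
          simpa using Real.rpow_le_rpow_of_exponent_le c1 hs1
        _ = _ := by
          congr 2
          rw [← Real.rpow_natCast, ← Real.rpow_natCast, ← Real.rpow_mul (by norm_num),
            ← Real.rpow_mul (by norm_num), mul_comm]
    calc _ ≤ _ := h1
      _ ≤ (2 * Real.pi) * q k * (r ^ (q k) * (n:ℝ)^s) * (2 * Real.pi * q k * |x - y|) := by gcongr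
      _ = _ := by ring
  have hs2 := hsum.mul_right ((n:ℝ) ^ s * |x - y|)
  rw [S, S, ← (summable_v n x).tsum_sub (summable_v n y), mul_assoc, ← tsum_mul_right]
  exact tsum_of_norm_bounded (f := fun k => v k n x - v k n y) hs2.hasSum key

lemma deriv_bound (n : ℕ) (L : ℝ) (hL : 0 ≤ L) (h : ∀ x y, |S n x - S n y| ≤ L * |x - y|) (x : ℝ) :
    |∑ j ∈ Finset.range n, deriv g (x + (j : ℝ) * α)| ≤ L := by
  have hd : HasDerivAt (S n) (∑ j ∈ Finset.range n, deriv g (x + (j : ℝ) * α)) x := by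
    have : S n = fun x => ∑ j ∈ Finset.range n, g (x + j * α) := funext (S_eq n)
    rw [this]
    apply HasDerivAt.fun_sum
    intro j _
    have h1 := (g_analytic (x + j * α)).differentiableAt.hasDerivAt
    exact h1.comp_add_const x (j * α)
  rw [← hd.deriv]
  have hl : LipschitzWith ⟨L, hL⟩ (S n) := LipschitzWith.of_dist_le_mul fun x y => h x y
  exact norm_deriv_le_of_lipschitz hl

lemma slow (ε : ℝ) (hε : 0 < ε) :
    (fun n : ℕ => ⨆ x : ℝ, |∑ j ∈ Finset.range n, deriv g (x + (j : ℝ) * α)|)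
          =o[atTop] fun n : ℕ => (n : ℝ) ^ ε := by
  obtain ⟨C, hC, h⟩ := S_lip (min (ε/2) 1) (by positivity) (min_le_right _ _)
  have h1 : (fun n : ℕ => ⨆ x : ℝ, |∑ j ∈ Finset.range n, deriv g (x + (j : ℝ) * α)|)
      =O[atTop] fun n : ℕ => (n : ℝ) ^ (min (ε/2) 1) := by
    refine IsBigO.of_bound C (Eventually.of_forall fun n => ?_)
    rw [Real.norm_of_nonneg (Real.iSup_nonneg fun x => abs_nonneg _),
      Real.norm_of_nonneg (by positivity)]
    exact ciSup_le fun x => deriv_bound n _ (by positivity) (h n) x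
  refine h1.trans_isLittleO ?_
  have hlt : min (ε/2) 1 < ε := lt_of_le_of_lt (min_le_left _ _) (by linarith)
  have ht : Tendsto (fun x : ℝ => x ^ (min (ε/2) 1) / x ^ ε) atTop (𝓝 0) := by
    refine (tendsto_rpow_neg_atTop (sub_pos.2 hlt)).congr' ?_
    filter_upwards [eventually_gt_atTop 0] with x hx
    rw [← Real.rpow_sub hx, neg_sub]
  refine (isLittleO_iff_tendsto' ?_).2 (ht.comp tendsto_natCast_atTop_atTop)
  filter_upwards [eventually_gt_atTop 0] with n hn h0
  have : (0:ℝ) < (n:ℝ) ^ ε := Real.rpow_pos_of_pos (by exact_mod_cast hn) _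
  exact absurd h0 this.ne'

noncomputable def e (k j : ℕ) : ℝ :=
  if j < k then Real.pi * (q j / q k) else 2 * Real.pi * ((q j : ℝ)^2 * (1/2) ^ (q j))

lemma e_nonneg (k j : ℕ) : 0 ≤ e k j := by
  unfold e; split_ifs <;> positivity

lemma e_le (k j : ℕ) : e k j ≤ 2 * Real.pi * ((q j : ℝ)^2 * (1/2) ^ (q j)) := by
  unfold e; split_ifs with h
  · have h1 : (q (j+1) : ℝ) ≤ q k := by exact_mod_cast q_strictMono.monotone h
    have hq : (1:ℝ) ≤ q j := by exact_mod_cast q_pos j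
    have h2 : (q j : ℝ) / q k ≤ q j * (1/2) ^ (q j) := by
      calc (q j : ℝ) / q k ≤ q j / q (j+1) := by
            have := Qpos (j+1); gcongr
        _ = _ := by rw [q_succ]; push_cast; rw [div_eq_mul_inv, one_div, inv_pow]
    have h3 : (q j : ℝ) * (1/2) ^ (q j) ≤ (q j : ℝ)^2 * (1/2) ^ (q j) := by
      gcongr; nlinarith
    have := Real.pi_pos
    have h4 : 0 ≤ (q j : ℝ)^2 * (1/2) ^ (q j) := by positivity
    nlinarith
  · exact le_rfl

lemma summable_e0 : Summable fun j => 2 * Real.pi * ((q j : ℝ)^2 * (1/2) ^ (q j)) :=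
  (summable_q 2 (by norm_num) (by norm_num)).mul_left _

lemma summable_e (k : ℕ) : Summable (e k) :=
  Summable.of_nonneg_of_le (e_nonneg k) (e_le k) summable_e0

lemma tendsto_inv_q : Tendsto (fun k => (q k : ℝ)⁻¹) atTop (𝓝 0) := by
  simpa using (summable_inv 0).tendsto_atTop_zero

lemma tendsto_E : Tendsto (fun k => ∑' j, e k j) atTop (𝓝 0) := by
  have := tendsto_tsum_of_dominated_convergence (𝓕 := atTop) (f := e) (g := fun _ => 0)
    summable_e0 (fun j => ?_) (Eventually.of_forall fun k j => ?_)
  · simpa using this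
  · have h := (tendsto_inv_q.const_mul (Real.pi * q j))
    rw [mul_zero] at h
    refine h.congr' ?_
    filter_upwards [eventually_gt_atTop j] with k hk
    rw [e, if_pos hk]; ring
  · rw [Real.norm_of_nonneg (e_nonneg k j)]; exact e_le k j

lemma cnorm_le (x : ℝ) : ‖(x : AddCircle (1:ℝ))‖ ≤ |x| := by
  have := round_le x 0
  rw [UnitAddCircle.norm_eq]; simpa using this

lemma keyA (k : ℕ) (θ : ℝ) (h0 : 0 ≤ θ) (h1 : θ ≤ 1) : ∃ n : ℕ,
    ‖((n * α : ℝ) : AddCircle (1:ℝ))‖ ≤ (q k : ℝ)⁻¹ ∧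
    ∀ x, |S n x - (Real.cos (2 * Real.pi * q k * x + 2 * Real.pi * θ)
      - Real.cos (2 * Real.pi * q k * x)) / 2| ≤ ∑' j, e k j := by
  have hq := Qpos k
  have hδ := δ_pos k
  obtain ⟨p, hp⟩ := exists_p k
  have hqd : 0 < q k * δ k := by positivity
  set m := ⌊θ / (q k * δ k)⌋₊ with hm
  have m1 : m * (q k * δ k) ≤ θ := by
    rw [← le_div_iff₀ hqd]; exact Nat.floor_le (by positivity)
  have m2 : θ < (m + 1) * (q k * δ k) := by
    rw [← div_lt_iff₀ hqd]; exact Nat.lt_floor_add_one _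
  have hna : ((m * q k : ℕ) : ℝ) * α = ((m * p : ℕ) : ℝ) + m * δ k := by
    push_cast; linear_combination (m:ℝ) * hp
  have hξ : m * δ k ≤ (q k : ℝ)⁻¹ := by
    rw [← one_div, le_div_iff₀ hq]; linarith
  have hξ0 : 0 ≤ m * δ k := by positivity
  have hn : ((m * q k : ℕ) : ℝ) ≤ q (k+1) := by
    have a := le_δ k
    have hq1 : (1:ℝ) ≤ q k := by exact_mod_cast q_pos k
    have b : (q (k+1) : ℝ)⁻¹ ≤ δ k := by
      refine le_trans ?_ a
      exact le_mul_of_one_le_left (by positivity) hq1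
    have hq2 := Qpos (k+1)
    have c : ((m * q k : ℕ) : ℝ) * δ k ≤ 1 := by push_cast; linarith
    have d : ((m * q k : ℕ) : ℝ) * (q (k+1) : ℝ)⁻¹ ≤ 1 :=
      (mul_le_mul_of_nonneg_left b (by positivity)).trans c
    rwa [← div_eq_mul_inv, div_le_one hq2] at d
  refine ⟨m * q k, ?_, fun x => ?_⟩
  · rw [hna, AddCircle.coe_add]
    have : (((m * p : ℕ) : ℝ) : AddCircle (1:ℝ)) = 0 := by
      rw [AddCircle.coe_eq_zero_iff]
      exact ⟨(m * p : ℕ), by simp⟩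
    rw [this, zero_add]
    refine (cnorm_le _).trans ?_
    rwa [abs_of_nonneg hξ0]
  · set T := (Real.cos (2 * Real.pi * q k * x + 2 * Real.pi * θ)
      - Real.cos (2 * Real.pi * q k * x)) / 2 with hT
    have hTs : HasSum (fun j => if j = k then T else 0) T := hasSum_ite_eq k T
    have hS := ((summable_v (m * q k) x).hasSum.sub hTs)
    rw [S, ← hS.tsum_eq]
    refine tsum_of_norm_bounded (f := fun j => v j (m * q k) x - if j = k then T else 0)
      (summable_e k).hasSum (fun j => ?_)
    rw [Real.norm_eq_abs]
    have hpi := Real.pi_pos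
    rcases lt_trichotomy j k with hjk | hjk | hjk
    · rw [if_neg hjk.ne, sub_zero, e, if_pos hjk]
      refine (abs_v _ _ _).trans ?_
      have := abs_sin_int (q j * (m * q k : ℕ) * α) (q j * (m * p)) (q j * (m * δ k))
        (by rw [mul_assoc, hna]; push_cast; ring)
      rw [abs_of_nonneg (show 0 ≤ q j * (m * δ k) by positivity)] at this
      calc _ = _ := by rw [show Real.pi * q j * (m * q k : ℕ) * α =
              Real.pi * (q j * (m * q k : ℕ) * α) by ring]
        _ ≤ _ := this
        _ ≤ _ := by rw [div_eq_mul_inv]; gcongr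
    · subst hjk
      rw [if_pos rfl, e, if_neg (lt_irrefl _), hT, v_eq]
      have c1 : Real.cos (2 * Real.pi * q j * (x + (m * q j : ℕ) * α)) =
          Real.cos (2 * Real.pi * q j * x + 2 * Real.pi * (m * (q j * δ j))) := by
        rw [hna, show 2 * Real.pi * q j * (x + (((m * p : ℕ) : ℝ) + m * δ j)) =
          2 * Real.pi * q j * x + 2 * Real.pi * (m * (q j * δ j)) + (q j * (m * p) : ℕ) * (2 * Real.pi) by
            push_cast; ring, Real.cos_add_nat_mul_two_pi]
      rw [c1, ← sub_div, sub_sub_sub_cancel_right, abs_div, abs_two]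
      have c2 := Real.abs_cos_sub_cos_le (2 * Real.pi * q j * x + 2 * Real.pi * (m * (q j * δ j)))
        (2 * Real.pi * q j * x + 2 * Real.pi * θ)
      rw [add_sub_add_left_eq_sub, ← mul_sub, abs_mul, abs_of_pos (show 0 < 2 * Real.pi by positivity),
        abs_of_nonpos (show m * (q j * δ j) - θ ≤ 0 by linarith)] at c2
      have c3 : -(m * (q j * δ j) - θ) ≤ q j * δ j := by linarith
      have c4 := mul_le_mul_of_nonneg_left (δ_le j) hq.le
      have c5 := mul_le_mul_of_nonneg_left (c3.trans c4) (show 0 ≤ 2 * Real.pi by positivity)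
      rw [div_le_iff₀ two_pos]
      refine (c2.trans c5).trans (le_of_eq ?_)
      ring
    · rw [if_neg hjk.ne', sub_zero, e, if_neg hjk.not_gt]
      refine (abs_v _ _ _).trans ((abs_s _ _).trans ?_)
      have hj : ((m * q k : ℕ) : ℝ) ≤ q j :=
        hn.trans (by exact_mod_cast q_strictMono.monotone hjk)
      calc _ ≤ Real.pi * (q j * (2 * q j * (1/2) ^ (q j))) := by
            have := δ_le j; have := (δ_pos j).le; gcongr
        _ = _ := by ring

lemma dist_coe (x y : ℝ) : dist (x : AddCircle (1:ℝ)) y = ‖((x - y : ℝ) : AddCircle (1:ℝ))‖ := by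
  rw [dist_eq_norm, AddCircle.coe_sub]

lemma dist_coe_le (x y : ℝ) : dist (x : AddCircle (1:ℝ)) y ≤ |x - y| := by
  rw [dist_coe]; exact cnorm_le _

lemma fiber (x y y' ε : ℝ) (hε : 0 < ε) : ∃ n : ℕ, ‖((n * α : ℝ) : AddCircle (1:ℝ))‖ < ε ∧
    dist ((y + S n x : ℝ) : AddCircle (1:ℝ)) (y' : AddCircle (1:ℝ)) < ε := by
  obtain ⟨k, hk1, hk2⟩ := ((tendsto_E.eventually (gt_mem_nhds hε)).and
    (tendsto_inv_q.eventually (gt_mem_nhds hε))).exists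
  set t := y' - y + Real.cos (2 * Real.pi * q k * x) / 2 with ht
  set c := t - round t with hc
  have hc1 : |c| ≤ 1/2 := abs_sub_round t
  rw [abs_le] at hc1
  set φ := Real.arccos (2 * c)
  have hφ : Real.cos φ = 2 * c := Real.cos_arccos (by linarith) (by linarith)
  set w := (φ - 2 * Real.pi * q k * x) / (2 * Real.pi) with hw
  have hpi := Real.pi_pos
  obtain ⟨n, hn1, hn2⟩ := keyA k (Int.fract w) (Int.fract_nonneg _) (Int.fract_lt_one _).le
  refine ⟨n, hn1.trans_lt hk2, ?_⟩
  have hcos : Real.cos (2 * Real.pi * q k * x + 2 * Real.pi * Int.fract w) = 2 * c := by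
    rw [← hφ, Int.fract, show 2 * Real.pi * q k * x + 2 * Real.pi * (w - ⌊w⌋) =
      φ - ⌊w⌋ * (2 * Real.pi) by rw [hw]; field_simp; ring, Real.cos_sub_int_mul_two_pi]
  have h := hn2 x
  rw [hcos] at h
  have e1 : ((y' : ℝ) : AddCircle (1:ℝ)) = ((y' - round t : ℝ) : AddCircle (1:ℝ)) := by
    rw [AddCircle.coe_sub]
    have : ((round t : ℝ) : AddCircle (1:ℝ)) = 0 := by
      rw [AddCircle.coe_eq_zero_iff]
      exact ⟨round t, by simp⟩
    rw [this, sub_zero]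
  rw [e1]
  refine (dist_coe_le _ _).trans_lt (lt_of_le_of_lt ?_ hk1)
  have e2 : y + S n x - (y' - round t) = S n x - (2 * c - Real.cos (2 * Real.pi * q k * x)) / 2 := by
    rw [hc]; linarith [ht]
  rw [e2]; exact h

noncomputable def G : AddCircle (1:ℝ) → AddCircle (1:ℝ) :=
  (show Function.Periodic (fun x => ((g x : ℝ) : AddCircle (1:ℝ))) 1 from
    fun x => by simp only [g_periodic x]).lift

lemma G_coe (x : ℝ) : G x = ((g x : ℝ) : AddCircle (1:ℝ)) := rfl

lemma G_cont : Continuous G := by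
  have : Continuous fun x => ((g x : ℝ) : AddCircle (1:ℝ)) :=
    (AddCircle.continuous_mk' 1).comp g_cont
  exact continuous_coinduced_dom.2 this

noncomputable def F : (AddCircle (1 : ℝ) × AddCircle (1 : ℝ)) ≃ₜ (AddCircle (1 : ℝ) × AddCircle (1 : ℝ)) where
  toFun p := (p.1 + (α : AddCircle (1:ℝ)), p.2 + G p.1)
  invFun p := (p.1 - (α : AddCircle (1:ℝ)), p.2 - G (p.1 - (α : AddCircle (1:ℝ))))
  left_inv p := by simp
  right_inv p := by simp
  continuous_toFun := by have := G_cont; fun_prop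
  continuous_invFun := by have := G_cont; fun_prop

lemma F_apply (p) : F p = (p.1 + (α : AddCircle (1:ℝ)), p.2 + G p.1) := rfl

lemma F_coe (x y : ℝ) : F ((x : AddCircle (1 : ℝ)), (y : AddCircle (1 : ℝ)))
          = (((x + α : ℝ) : AddCircle (1 : ℝ)), ((y + g x : ℝ) : AddCircle (1 : ℝ))) := by
  rw [F_apply, G_coe, AddCircle.coe_add, AddCircle.coe_add]

lemma F_iter (n : ℕ) (x y : ℝ) : F^[n] ((x : AddCircle (1 : ℝ)), (y : AddCircle (1 : ℝ)))
    = (((x + n * α : ℝ) : AddCircle (1 : ℝ)), ((y + S n x : ℝ) : AddCircle (1 : ℝ))) := by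
  induction n with
  | zero => simp [S_zero]
  | succ n ih =>
    rw [Function.iterate_succ_apply', ih, F_coe, S_succ]
    have a1 : x + n * α + α = x + (n + 1 : ℕ) * α := by push_cast; ring
    have a2 : y + S n x + g (x + n * α) = y + (S n x + g (x + n * α)) := by ring
    rw [a1, a2]

lemma F_pow (n : ℕ) (p) : (F.toEquiv ^ (n:ℤ)) p = F^[n] p := by
  rw [zpow_natCast, ← Equiv.Perm.iterate_eq_pow]; rfl

lemma F_zpow_fst (m : ℤ) (p) : ((F.toEquiv ^ m) p).1 = p.1 + ((m * α : ℝ) : AddCircle (1:ℝ)) := by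
  induction m using Int.induction_on generalizing p with
  | zero => simp
  | succ n ih =>
    rw [zpow_add_one, Equiv.Perm.mul_apply, ih]
    change p.1 + (α : AddCircle (1:ℝ)) + _ = _
    rw [add_assoc, ← AddCircle.coe_add]; push_cast; congr 2; ring
  | pred n ih =>
    rw [zpow_sub_one, Equiv.Perm.mul_apply, ih]
    change p.1 - (α : AddCircle (1:ℝ)) + _ = _
    rw [sub_add_eq_add_sub, add_sub_assoc, ← AddCircle.coe_sub]; push_cast; congr 2; ring

lemma minimal (p : AddCircle (1 : ℝ) × AddCircle (1 : ℝ)) :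
    Dense (Set.range fun n : ℤ => (F.toEquiv ^ n) p) := by
  rw [Metric.dense_iff]
  rintro ⟨a, b⟩ ε hε
  obtain ⟨b', rfl⟩ := QuotientAddGroup.mk_surjective b
  have hd : DenseRange (fun m : ℤ => m • (α : AddCircle (1:ℝ))) := by
    rw [AddCircle.denseRange_zsmul_coe_iff]
    simpa using irr
  obtain ⟨m, hm⟩ := hd.exists_dist_lt (a - p.1) (half_pos hε)
  obtain ⟨⟨x0, y0⟩, h0⟩ : ∃ z, z = (F.toEquiv ^ m) p := ⟨_, rfl⟩
  have hx0 : x0 = p.1 + ((m * α : ℝ) : AddCircle (1:ℝ)) := by rw [← F_zpow_fst, ← h0]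
  obtain ⟨x, rfl⟩ := QuotientAddGroup.mk_surjective x0
  obtain ⟨y, rfl⟩ := QuotientAddGroup.mk_surjective y0
  obtain ⟨n, hn1, hn2⟩ := fiber x y b' (ε/2) (half_pos hε)
  refine ⟨F^[n] (x, y), ?_, (n:ℤ) + m, ?_⟩
  · rw [Metric.mem_ball, F_iter, Prod.dist_eq, max_lt_iff]
    refine ⟨?_, hn2.trans (half_lt_self hε)⟩
    have e1 : dist (x : AddCircle (1:ℝ)) a < ε / 2 := by
      rw [dist_comm]
      rw [show (x : AddCircle (1:ℝ)) = _ from hx0]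
      rw [dist_eq_norm] at hm ⊢
      convert hm using 2
      rw [← zsmul_eq_mul, AddCircle.coe_zsmul]; abel
    calc _ ≤ dist ((x + n * α : ℝ) : AddCircle (1:ℝ)) x + dist (x : AddCircle (1:ℝ)) a := dist_triangle _ _ _
      _ < ε/2 + ε/2 := by
        gcongr
        rw [dist_coe, add_sub_cancel_left]; exact hn1
      _ = ε := by ring
  · simp only [zpow_add, Equiv.Perm.mul_apply]
    rw [← h0, F_pow]

lemma not_equi : ¬ ∀ ε : ℝ, 0 < ε → ∃ δ : ℝ, 0 < δ ∧
        ∀ p q : AddCircle (1 : ℝ) × AddCircle (1 : ℝ), dist p q < δ →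
          ∀ n : ℤ, dist ((F.toEquiv ^ n) p) ((F.toEquiv ^ n) q) < ε := by
  intro H
  obtain ⟨d, hd, h⟩ := H (1/4) (by norm_num)
  obtain ⟨k, hk1, hk2⟩ := ((tendsto_E.eventually (gt_mem_nhds (show (0:ℝ) < 1/8 by norm_num))).and
    (tendsto_inv_q.eventually (gt_mem_nhds hd))).exists
  obtain ⟨n, -, hn⟩ := keyA k (1/6) (by norm_num) (by norm_num)
  have hq := Qpos k
  set x : ℝ := (q k : ℝ)⁻¹ / 2 with hx
  have hx0 : 0 < x := by positivity
  have h1 := h ((0:ℝ), (0:ℝ)) (x, (0:ℝ)) (by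
    rw [Prod.dist_eq, dist_self, max_lt_iff]
    refine ⟨(dist_coe_le _ _).trans_lt ?_, hd⟩
    rw [zero_sub, abs_neg, abs_of_pos hx0]
    have : x ≤ (q k : ℝ)⁻¹ := half_le_self (by positivity)
    linarith) n
  rw [F_pow, F_pow, F_iter, F_iter, Prod.dist_eq, max_lt_iff] at h1
  have h2 := h1.2
  simp only [zero_add] at h2
  rw [dist_coe] at h2
  have a0 := hn 0
  have ax := hn x
  have c1 : Real.cos (2 * Real.pi * q k * 0 + 2 * Real.pi * (1/6)) = 1/2 := by
    rw [← Real.cos_pi_div_three]; congr 1; ring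
  have c2 : 2 * Real.pi * q k * x = Real.pi := by rw [hx]; field_simp
  have c3 : Real.cos (Real.pi + 2 * Real.pi * (1/6)) = -(1/2) := by
    rw [add_comm, Real.cos_add_pi, ← Real.cos_pi_div_three]; congr 2; ring
  rw [c1, mul_zero, Real.cos_zero] at a0
  rw [c2, c3, Real.cos_pi] at ax
  have a0' := abs_le.1 (a0.trans hk1.le)
  have ax' := abs_le.1 (ax.trans hk1.le)
  -- difference near -1/2
  set D := S n 0 - S n x with hD
  have hD1 : -3/4 ≤ D := by linarith [a0'.1, ax'.2]
  have hD2 : D ≤ -1/4 := by linarith [a0'.2, ax'.1]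
  rw [UnitAddCircle.norm_eq] at h2
  rw [abs_lt] at h2
  obtain ⟨r1, r2⟩ := h2
  have b1 : (round D : ℝ) < 0 := by linarith
  have b2 : (-1 : ℝ) < round D := by linarith
  have b3 : round D < 0 := by exact_mod_cast b1
  have b4 : -1 < round D := by exact_mod_cast b2
  omega

lemma mp : MeasurePreserving (⇑F) volume volume := by
  have h1 : MeasurePreserving (fun x : AddCircle (1:ℝ) => x + (α : AddCircle (1:ℝ))) volume volume :=
    measurePreserving_add_right _ _
  have := h1.skew_product (μc := (volume : Measure (AddCircle (1:ℝ))))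
    (μd := (volume : Measure (AddCircle (1:ℝ)))) (g := fun x y => y + G x)
    (by
      have := G_cont
      exact (show Continuous (fun p : AddCircle (1:ℝ) × AddCircle (1:ℝ) => p.2 + G p.1) by
        fun_prop).measurable)
    (Eventually.of_forall fun x => (measurePreserving_add_right _ _).map_eq)
  exact this

lemma grid (N : ℕ) (hN : 0 < N) (a : AddCircle (1:ℝ)) : ∃ (x : ℝ) (i : Fin N),
    a = (x : AddCircle (1:ℝ)) ∧ |x - (i : ℕ) / N| ≤ 1 / N := by
  obtain ⟨x, rfl⟩ := QuotientAddGroup.mk_surjective a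
  have hN' : (0:ℝ) < N := by exact_mod_cast hN
  have f0 := Int.fract_nonneg x
  have f1 := Int.fract_lt_one x
  refine ⟨Int.fract x, ⟨⌊Int.fract x * N⌋₊, ?_⟩, ?_, ?_⟩
  · rw [Nat.floor_lt (by positivity)]; nlinarith
  · change (x : AddCircle (1:ℝ)) = _
    rw [Int.fract, AddCircle.coe_sub, eq_comm, sub_eq_self, AddCircle.coe_eq_zero_iff]
    exact ⟨⌊x⌋, by simp⟩
  · simp only
    have g1 := Nat.floor_le (show 0 ≤ Int.fract x * N by positivity)
    have g2 := Nat.lt_floor_add_one (Int.fract x * N)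
    rw [abs_of_nonneg (by rw [sub_nonneg, div_le_iff₀ hN']; exact g1), sub_le_iff_le_add,
      ← add_div, le_div_iff₀ hN']
    linarith

lemma cov_le (ε : ℝ) (n N M : ℕ) (hN : 0 < N) (hM : 0 < M) (L : ℝ)
    (hL : ∀ j < n, ∀ x y, |S j x - S j y| ≤ L * |x - y|) (h1 : 1 / (N:ℝ) < ε)
    (hL0 : 0 ≤ L) (h2 : 1 / (M:ℝ) + L * (1 / N) < ε) : covNum F ε n ≤ N * M := by
  classical
  let pt : Fin N × Fin M → AddCircle (1 : ℝ) × AddCircle (1 : ℝ) := fun z =>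
    ((((z.1 : ℕ) / N : ℝ) : AddCircle (1:ℝ)), (((z.2 : ℕ) / M : ℝ) : AddCircle (1:ℝ)))
  have hc : (Finset.univ.image pt).card ≤ N * M := by
    refine Finset.card_image_le.trans ?_
    simp
  refine le_trans (Nat.sInf_le ⟨Finset.univ.image pt, rfl, ?_⟩) hc
  rintro ⟨a, b⟩
  obtain ⟨x, i, rfl, hx⟩ := grid N hN a
  obtain ⟨y, l, rfl, hy⟩ := grid M hM b
  refine ⟨pt (i, l), Finset.mem_image_of_mem _ (Finset.mem_univ _), fun j hj => ?_⟩
  simp only [pt]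
  rw [F_iter, F_iter, Prod.dist_eq, max_lt_iff]
  constructor
  · refine (dist_coe_le _ _).trans_lt (lt_of_le_of_lt ?_ h1)
    rwa [add_sub_add_right_eq_sub]
  · refine (dist_coe_le _ _).trans_lt (lt_of_le_of_lt ?_ h2)
    rw [add_sub_add_comm]
    refine (abs_add_le _ _).trans (add_le_add hy ((hL j hj _ _).trans ?_))
    gcongr

lemma hpol_zero : hpol (⇑F) = 0 := by
  rw [hpol, ENNReal.iSup_eq_zero]
  intro ε
  rw [ENNReal.iSup_eq_zero]
  intro hε
  have key : ∀ s : ℝ, 0 < s → s ≤ 1 → (atTop.limsup fun n : ℕ =>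
      ENNReal.ofReal (Real.log (covNum F ε n) / Real.log n)) ≤ ENNReal.ofReal (2 * s) := by
    intro s hs hs1
    obtain ⟨C, hC, hl⟩ := S_lip s hs hs1
    set M := ⌊2 / ε⌋₊ + 1 with hM
    set D : ℝ := (2 * (C + 1) / ε + 1) * M with hD
    have hM0 : (0:ℝ) < M := by positivity
    have hM1 : 1 / (M:ℝ) < ε / 2 := by
      rw [div_lt_iff₀ hM0]
      have := Nat.lt_floor_add_one (2/ε)
      rw [div_lt_iff₀ hε] at this
      push_cast [hM]; linarith
    have hD0 : 0 < D := by positivity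
    have hlog : Tendsto (fun n : ℕ => Real.log n) atTop atTop :=
      Real.tendsto_log_atTop.comp tendsto_natCast_atTop_atTop
    refine limsup_le_of_le (by isBoundedDefault) ?_
    filter_upwards [hlog.eventually_ge_atTop (Real.log D / s), hlog.eventually_gt_atTop 0,
      eventually_ge_atTop 1] with n hn1 hn2 hn3
    apply ENNReal.ofReal_le_ofReal
    rw [div_le_iff₀ hn2]
    have hn : (1:ℝ) ≤ n := by exact_mod_cast hn3
    have hns : 1 ≤ (n:ℝ) ^ s := Real.one_le_rpow hn hs.le
    set N := ⌊2 * (C + 1) * (n:ℝ)^s / ε⌋₊ + 1 with hN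
    have hN0 : (0:ℝ) < N := by positivity
    have hN1 : (C + 1) * (n:ℝ)^s * (1 / N) < ε / 2 := by
      rw [mul_one_div, div_lt_iff₀ hN0]
      have := Nat.lt_floor_add_one (2 * (C + 1) * (n:ℝ)^s / ε)
      rw [div_lt_iff₀ hε] at this
      push_cast [hN]; linarith
    have hi : 0 < 1 / (N:ℝ) := by positivity
    have hCn : 0 ≤ C * (n:ℝ)^s * (1 / N) := by positivity
    have hexp : (C + 1) * (n:ℝ)^s * (1 / N) = C * (n:ℝ)^s * (1 / N) + (n:ℝ)^s * (1/N) := by ring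
    have hge : 1 / (N:ℝ) ≤ (n:ℝ)^s * (1/N) := le_mul_of_one_le_left hi.le hns
    have hcov : covNum F ε n ≤ N * M := by
      refine cov_le ε n N M (by omega) (by omega) (C * (n:ℝ)^s) ?_ ?_ (by positivity) ?_
      · intro j hj x y
        refine (hl j x y).trans ?_
        gcongr
      · linarith
      · linarith
    have hNM : ((N * M : ℕ) : ℝ) ≤ D * (n:ℝ)^s := by
      have := Nat.floor_le (show 0 ≤ 2 * (C + 1) * (n:ℝ)^s / ε by positivity)
      have hNn : (N:ℝ) ≤ (2 * (C + 1) / ε + 1) * (n:ℝ)^s := by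
        rw [add_mul, one_mul, div_mul_eq_mul_div]; push_cast [hN]; linarith
      rw [hD]; push_cast
      nlinarith
    have hlogD : Real.log D ≤ s * Real.log n := by
      rw [div_le_iff₀ hs] at hn1; linarith
    rcases Nat.eq_zero_or_pos (covNum F ε n) with h0 | h0
    · rw [h0]; simp; positivity
    · have h0' : (0:ℝ) < covNum F ε n := by exact_mod_cast h0
      have : (covNum F ε n : ℝ) ≤ D * (n:ℝ)^s := le_trans (by exact_mod_cast hcov) hNM
      have h3 := Real.log_le_log h0' this
      rw [Real.log_mul hD0.ne' (by positivity), Real.log_rpow (by linarith)] at h3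
      linarith
  refine le_antisymm (le_of_forall_gt fun c hc => ?_) bot_le
  have ht : Tendsto (fun s : ℝ => ENNReal.ofReal (2 * s)) (𝓝[>] 0) (𝓝 0) := by
    have : Continuous fun s : ℝ => ENNReal.ofReal (2 * s) :=
      ENNReal.continuous_ofReal.comp (continuous_const.mul continuous_id)
    have h := (this.tendsto 0).mono_left (nhdsWithin_le_nhds (s := Set.Ioi 0))
    simpa using h
  have hI : ∀ᶠ s in 𝓝[>] (0:ℝ), s ∈ Set.Ioc (0:ℝ) 1 := Ioc_mem_nhdsGT (by norm_num)
  obtain ⟨s, ⟨hs0, hs1⟩, hs2⟩ := (hI.and (ht.eventually (gt_mem_nhds hc))).exists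
  exact (key s hs0 hs1).trans_lt hs2

end Slow

/-- There exist an irrational `α` and a real-analytic `1`-periodic `g : ℝ → ℝ` with
`∫₀¹ g = 0` such that the homeomorphism `f(x,y) = (x+α, y+g(x))` of the torus
`𝕋² = (ℝ/ℤ)²` is minimal, its family of iterates `{f^n : n ∈ ℤ}` is not
(uniformly) equicontinuous, the derivative sums `sup_x |∑_{j<n} g'(x+jα)|` are
`o(n^ε)` for every `ε > 0`, its polynomial entropy vanishes, and `f` preserves the
Haar (Lebesgue) probability measure of `𝕋²`. -/
theorem exists_minimal_slow_not_equicontinuous :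
    ∃ (α : ℝ) (g : ℝ → ℝ)
      (f : (AddCircle (1 : ℝ) × AddCircle (1 : ℝ)) ≃ₜ (AddCircle (1 : ℝ) × AddCircle (1 : ℝ))),
      Irrational α ∧
      (∀ x : ℝ, AnalyticAt ℝ g x) ∧
      Function.Periodic g 1 ∧
      (∫ x in (0 : ℝ)..1, g x) = 0 ∧
      (∀ x y : ℝ, f ((x : AddCircle (1 : ℝ)), (y : AddCircle (1 : ℝ)))
          = (((x + α : ℝ) : AddCircle (1 : ℝ)), ((y + g x : ℝ) : AddCircle (1 : ℝ)))) ∧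
      -- (1) minimality: every (ℤ-)orbit is dense
      (∀ p : AddCircle (1 : ℝ) × AddCircle (1 : ℝ),
        Dense (Set.range fun n : ℤ => (f.toEquiv ^ n) p)) ∧
      -- (2) the iterates do not form an equicontinuous family
      (¬ ∀ ε : ℝ, 0 < ε → ∃ δ : ℝ, 0 < δ ∧
        ∀ p q : AddCircle (1 : ℝ) × AddCircle (1 : ℝ), dist p q < δ →
          ∀ n : ℤ, dist ((f.toEquiv ^ n) p) ((f.toEquiv ^ n) q) < ε) ∧
      -- (3) slow growth of the derivatives of the iterates
      (∀ ε : ℝ, 0 < ε →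
        (fun n : ℕ => ⨆ x : ℝ, |∑ j ∈ Finset.range n, deriv g (x + (j : ℝ) * α)|)
          =o[atTop] fun n : ℕ => (n : ℝ) ^ ε) ∧
      -- (4) vanishing polynomial entropy
      hpol (⇑f) = 0 ∧
      -- f preserves the Haar (Lebesgue) probability measure
      MeasurePreserving (⇑f) volume volume := by
  exact ⟨Slow.α, Slow.g, Slow.F, Slow.irr, Slow.g_analytic, Slow.g_periodic, Slow.g_int,
    Slow.F_coe, Slow.minimal, Slow.not_equi, Slow.slow, Slow.hpol_zero, Slow.mp⟩
end
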